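/- Let f : ℝ_{>0} → ℝ_{>0} be an increasing function and fix an integer 1 ≤ i ≤ d − 1, where d = m + n. Then ∑_{k=1}^∞ 1/f(k) < ∞ if and only if for almost every m×n real matrix B there exists R₀ > 0 such that for all R ≥ R₀ one has λ_i(A_R U_B ℤ^d) > (f(log R))^{−1/(d·i)}. -/

import Mathlib

open MeasureTheory
open scoped ENNReal

/-- The `L^p` norm of a vector in `ℝ^ι`, for `p ∈ [1,∞]` (junk values otherwise). -/
noncomputable def lpNorm (p : ℝ≥0∞) {ι : Type*} [Fintype ι] (x : ι → ℝ) : ℝ :=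
  ‖(WithLp.equiv p (ι → ℝ)).symm x‖

/-- The Euclidean (`L²`) norm of a vector. -/
noncomputable def euclNorm {ι : Type*} [Fintype ι] (x : ι → ℝ) : ℝ :=
  Real.sqrt (∑ i, x i ^ 2)

/-- `cone(S) = {c • u : u ∈ S, c > 0}`. -/
def cone {m : ℕ} (S : Set (Fin m → ℝ)) : Set (Fin m → ℝ) :=
  {y | ∃ u ∈ S, ∃ c : ℝ, 0 < c ∧ y = c • u}

/-- `S` is an open subset of the unit (Euclidean) sphere of `ℝ^m`. -/
def IsOpenSubsetOfSphere {m : ℕ} (S : Set (Fin m → ℝ)) : Prop :=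
  ∃ U : Set (Fin m → ℝ), IsOpen U ∧ S = U ∩ {u | euclNorm u = 1}

/-- Matrix-vector multiplication, with the matrix given as `Fin m → Fin n → ℝ`. -/
def matVec {m n : ℕ} (B : Fin m → Fin n → ℝ) (x : Fin n → ℝ) : Fin m → ℝ :=
  fun i => ∑ j, B i j * x j

/-- The block matrix `U_B = [[Id_n, 0], [B, Id_m]]`, indexed by `Fin n ⊕ Fin m`. -/
def UB {m n : ℕ} (B : Fin m → Fin n → ℝ) :
    Matrix (Fin n ⊕ Fin m) (Fin n ⊕ Fin m) ℝ :=
  Matrix.fromBlocks 1 0 (Matrix.of B) 1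

/-- The diagonal matrix `A_Q = diag(Q^{-1/n} Id_n, Q^{1/m} Id_m)`. -/
noncomputable def AQ (m n : ℕ) (Q : ℝ) :
    Matrix (Fin n ⊕ Fin m) (Fin n ⊕ Fin m) ℝ :=
  Matrix.diagonal
    (Sum.elim (fun _ : Fin n => Q ^ (-(n : ℝ)⁻¹)) (fun _ : Fin m => Q ^ ((m : ℝ)⁻¹)))

/-- The lattice `Mℤ^d` generated by the columns of `M`. -/
def colLattice {ι : Type*} [Fintype ι] (M : Matrix ι ι ℝ) : Submodule ℤ (ι → ℝ) :=
  Submodule.span ℤ (Set.range fun j => fun i => M i j)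

/-- The `i`-th successive minimum of a lattice `L ⊆ ℝ^ι`: the least `r > 0` such that `L`
contains `i` linearly independent vectors of Euclidean norm at most `r`. -/
noncomputable def succMin {ι : Type*} [Fintype ι] (L : Submodule ℤ (ι → ℝ)) (i : ℕ) : ℝ :=
  sInf {r : ℝ | 0 < r ∧ ∃ v : Fin i → (ι → ℝ), (∀ j, v j ∈ L) ∧
    LinearIndependent ℝ v ∧ ∀ j, euclNorm (v j) ≤ r}

namespace KM

set_option linter.unusedSectionVars false
set_option linter.unusedSimpArgs false
set_option linter.unusedVariables false

open Matrix

section inst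
variable {κ l : Type*} [Fintype κ] [Fintype l]

noncomputable instance instMeasMat : MeasureSpace (Matrix κ l ℝ) :=
  inferInstanceAs (MeasureSpace (κ → l → ℝ))

instance instBorelMat : BorelSpace (Matrix κ l ℝ) :=
  inferInstanceAs (BorelSpace (κ → l → ℝ))

instance instHaarMat : (volume : Measure (Matrix κ l ℝ)).IsAddHaarMeasure :=
  MeasureTheory.Measure.pi.isAddHaarMeasure (fun _ : κ => (volume : Measure (l → ℝ)))

instance instSFMat : SigmaFinite (volume : Measure (Matrix κ l ℝ)) :=
  inferInstanceAs (SigmaFinite (volume : Measure (κ → l → ℝ)))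

instance instSCMat : SecondCountableTopology (Matrix κ l ℝ) :=
  inferInstanceAs (SecondCountableTopology (κ → l → ℝ))

end inst

section rowmap
variable {κ l : Type*} [Fintype κ] [Fintype l] [DecidableEq l]

/-- row-wise right multiplication -/
def rowMap (V : κ → Matrix l l ℝ) (h : Matrix κ l ℝ) : Matrix κ l ℝ :=
  Matrix.of fun a => h a ᵥ* V a

lemma rowMap_const (V : Matrix l l ℝ) (h : Matrix κ l ℝ) :
    rowMap (fun _ => V) h = h * V := by
  ext a b; rfl

lemma rowMap_diag (D : κ → ℝ) [DecidableEq κ] (V : Matrix l l ℝ) (h : Matrix κ l ℝ) :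
    rowMap (fun a => D a • V) h = Matrix.diagonal D * h * V := by
  ext a b
  simp only [rowMap, vecMul, dotProduct, mul_apply (M := diagonal D * h), diagonal_mul, of_apply,
    Matrix.smul_apply, smul_eq_mul]
  apply Finset.sum_congr rfl; intros; ring

lemma continuous_rowMap (V : κ → Matrix l l ℝ) : Continuous (rowMap V) := by
  refine continuous_pi fun a => continuous_pi fun b => ?_
  simp only [rowMap, of_apply, vecMul, dotProduct]
  exact continuous_finsetSum _ fun c _ =>
    (continuous_id.matrix_elem a c).mul continuous_const

lemma map_rowMap (V : κ → Matrix l l ℝ) (hV : ∀ a, (V a).det ≠ 0) :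
    Measure.map (rowMap V) volume =
      ENNReal.ofReal (∏ a, |(V a).det|⁻¹) • (volume : Measure (Matrix κ l ℝ)) := by
  have key : ∀ a, Measure.map (fun x : l → ℝ => x ᵥ* V a) volume
      = ENNReal.ofReal (|(V a).det|⁻¹) • volume := by
    intro a
    have := Real.map_matrix_volume_pi_eq_smul_volume_pi (M := (V a)ᵀ) (by simpa using hV a)
    rw [det_transpose, abs_inv] at this
    rw [← this]
    congr 1
    ext x b
    simp [toLin'_apply, mulVec_transpose]
  have hm : ∀ a, Measurable (fun x : l → ℝ => x ᵥ* V a) := by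
    intro a
    apply Continuous.measurable
    refine continuous_pi fun b => ?_
    simp only [vecMul, dotProduct]
    fun_prop
  have hsf : ∀ a, SigmaFinite (Measure.map (fun x : l → ℝ => x ᵥ* V a) volume) := by
    intro a; rw [key a]; exact SMul.sigmaFinite (μ := (volume : Measure (l → ℝ))) (Real.toNNReal _)
  have h1 := Measure.pi_map_pi (μ := fun _ : κ => (volume : Measure (l → ℝ)))
    (f := fun a (x : l → ℝ) => x ᵥ* V a) (fun a => (hm a).aemeasurable)
  change Measure.map (fun (x : κ → l → ℝ) a => x a ᵥ* V a) (Measure.pi fun _ => volume) = _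
  rw [h1]
  refine (Measure.pi_eq fun s hs => ?_)
  change (ENNReal.ofReal _ • (Measure.pi fun _ : κ => (volume : Measure (l → ℝ)))) _ = _
  simp_rw [key]
  simp only [Measure.smul_apply, smul_eq_mul, Measure.pi_pi]
  rw [ENNReal.ofReal_prod_of_nonneg (fun _ _ => by positivity), Finset.prod_mul_distrib]

lemma lintegral_rowMap (V : κ → Matrix l l ℝ) (hV : ∀ a, (V a).det ≠ 0)
    (F : Matrix κ l ℝ → ℝ≥0∞) (hF : Measurable F) :
    ∫⁻ h, F (rowMap V h) = ENNReal.ofReal (∏ a, |(V a).det|⁻¹) * ∫⁻ h, F h := by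
  rw [← lintegral_map hF (continuous_rowMap V).measurable, map_rowMap V hV, lintegral_smul_measure,
    smul_eq_mul]

lemma vol_rowMap (V : κ → Matrix l l ℝ) (hV : ∀ a, (V a).det ≠ 0)
    (S : Set (Matrix κ l ℝ)) (hS : MeasurableSet S) :
    volume {h | rowMap V h ∈ S} = ENNReal.ofReal (∏ a, |(V a).det|⁻¹) * volume S := by
  have := Measure.map_apply (μ := volume) (continuous_rowMap V).measurable hS
  rw [map_rowMap V hV] at this
  exact this.symm

lemma vol_rowMap_le (V : κ → Matrix l l ℝ) (hV : ∀ a, (V a).det ≠ 0)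
    (S : Set (Matrix κ l ℝ)) :
    volume {h | rowMap V h ∈ S} ≤ ENNReal.ofReal (∏ a, |(V a).det|⁻¹) * volume S := by
  rw [← measure_toMeasurable S, ← vol_rowMap V hV _ (measurableSet_toMeasurable _ _)]
  exact measure_mono fun h hh => subset_toMeasurable _ _ hh

/-- right multiplication by an invertible matrix -/
lemma vol_mul_right (V : Matrix l l ℝ) (hV : V.det ≠ 0)
    (S : Set (Matrix κ l ℝ)) (hS : MeasurableSet S) :
    volume {h : Matrix κ l ℝ | h * V ∈ S} =
      ENNReal.ofReal ((|V.det|⁻¹) ^ Fintype.card κ) * volume S := by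
  have := vol_rowMap (κ := κ) (fun _ => V) (fun _ => hV) S hS
  simpa [rowMap_const] using this

end rowmap

section blk
variable {I J K : Type*} [Fintype I] [Fintype J] [Fintype K]

/-- columns glue -/
lemma mp_cols : MeasurePreserving
    (fun p : Matrix I J ℝ × Matrix I K ℝ => (Matrix.of fun a => Sum.elim (p.1 a) (p.2 a)
      : Matrix I (J ⊕ K) ℝ)) volume volume := by
  have h1 := (volume_measurePreserving_arrowProdEquivProdArrow (J → ℝ) (K → ℝ) I).symm
  have h2 := volume_preserving_pi (ι := I) (fun _ => 
     volume_measurePreserving_sumPiEquivProdPi_symm (fun _ : J ⊕ K => ℝ))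
  have := h2.comp h1
  exact this

lemma mp_rows : MeasurePreserving
    (fun p : Matrix J I ℝ × Matrix K I ℝ => (Matrix.of (Sum.elim p.1 p.2)
      : Matrix (J ⊕ K) I ℝ)) volume volume := by
  have h2 := volume_measurePreserving_sumPiEquivProdPi_symm (fun _ : J ⊕ K => I → ℝ)
  exact h2

lemma mp_blk : MeasurePreserving
    (fun p : (Matrix J J ℝ × Matrix J K ℝ) × (Matrix K J ℝ × Matrix K K ℝ) =>
      (fromBlocks p.1.1 p.1.2 p.2.1 p.2.2)) volume volume := by
  have := (mp_rows (I := J ⊕ K) (J := J) (K := K)).comp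
    ((mp_cols (I := J) (J := J) (K := K)).prod (mp_cols (I := K) (J := J) (K := K)))
  convert! this using 1

lemma lintegral_blk (F : Matrix (J ⊕ K) (J ⊕ K) ℝ → ℝ≥0∞) (hF : Measurable F) :
    ∫⁻ g, F g = ∫⁻ A : Matrix J J ℝ, ∫⁻ C : Matrix K J ℝ, ∫⁻ N : Matrix J K ℝ, ∫⁻ Z : Matrix K K ℝ,
      F (fromBlocks A N C Z) := by
  have hm := (mp_blk (J := J) (K := K)).measurable
  rw [← (mp_blk (J := J) (K := K)).lintegral_comp hF]
  have hFm := hF.comp hm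
  simp only [Function.comp_def] at hFm
  rw [Measure.volume_eq_prod, lintegral_prod _ hFm.aemeasurable]
  rw [Measure.volume_eq_prod, lintegral_prod]
  · refine lintegral_congr fun A => ?_
    trans ∫⁻ N : Matrix J K ℝ, ∫⁻ C : Matrix K J ℝ, ∫⁻ Z : Matrix K K ℝ, F (fromBlocks A N C Z)
    · refine lintegral_congr fun N => ?_
      rw [Measure.volume_eq_prod, lintegral_prod]
      exact (hF.comp (hm.comp (measurable_prodMk_left (x := (A, N))))).aemeasurable
    · apply lintegral_lintegral_swap
      apply Measurable.aemeasurable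
      have : Measurable fun q : (Matrix J K ℝ × Matrix K J ℝ) × Matrix K K ℝ =>
          F (fromBlocks A q.1.1 q.1.2 q.2) := by
        apply hF.comp
        have h3 : Measurable fun q : (Matrix J K ℝ × Matrix K J ℝ) × Matrix K K ℝ =>
          (((A, q.1.1), (q.1.2, q.2)) :
            (Matrix J J ℝ × Matrix J K ℝ) × (Matrix K J ℝ × Matrix K K ℝ)) := by fun_prop
        exact hm.comp h3
      exact this.lintegral_prod_right'
  · exact hFm.lintegral_prod_right'.aemeasurable

/-- reindexing preserves volume -/
lemma mp_reindex {κ l : Type*} [Fintype κ] [Fintype l] (e : κ ≃ l) : MeasurePreserving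
    (fun g : Matrix l l ℝ => g.submatrix e e) volume volume := by
  have h1 := volume_measurePreserving_piCongrLeft (fun _ : κ => ℝ) e.symm
  have h2 := volume_preserving_pi (ι := l) (fun _ => h1)
  have h3 := (volume_measurePreserving_piCongrLeft (fun _ : κ => κ → ℝ) e.symm).comp h2
  convert! h3 using 1
  funext g
  ext a b
  have t1 := Equiv.piCongrLeft_apply_apply (P := fun _ : κ => κ → ℝ) (e := e.symm)
    (fun i => MeasurableEquiv.piCongrLeft (fun x : κ => ℝ) e.symm (g i)) (e a)
  have t2 := Equiv.piCongrLeft_apply_apply (P := fun _ : κ => ℝ) (e := e.symm) (g (e a)) (e b)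
  simp only [Equiv.symm_apply_apply] at t1 t2
  have t3 := congrFun t1 b
  exact (t3.trans t2).symm

end blk
end KM

open MeasureTheory
open scoped ENNReal
namespace KM
set_option linter.unusedSectionVars false
set_option linter.unusedSimpArgs false
set_option linter.unusedVariables false
open Matrix

section basic
variable {κ l : Type*} [Fintype κ] [Fintype l] [DecidableEq κ] [DecidableEq l]

/-- real version of an integer matrix -/
def toR {κ l : Type*} (W : Matrix κ l ℤ) : Matrix κ l ℝ := W.map (fun z => (z : ℝ))

@[simp] lemma toR_apply (W : Matrix κ l ℤ) (a b) : toR W a b = (W a b : ℝ) := rfl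

lemma det_toR (W : Matrix κ κ ℤ) : (toR W).det = (W.det : ℝ) := by
  have := RingHom.map_det (Int.castRingHom ℝ) W
  simpa [toR] using this.symm

lemma toR_mul {p : Type*} (W : Matrix p κ ℤ) (V : Matrix κ l ℤ) : toR (W * V) = toR W * toR V := by
  ext a b; simp [mul_apply]

lemma toR_one : toR (1 : Matrix κ κ ℤ) = 1 := by
  ext a b; by_cases h : a = b <;> simp [one_apply, h]

lemma toR_smul (z : ℤ) (W : Matrix κ l ℤ) : toR (z • W) = (z : ℝ) • toR W := by
  ext a b; simp

lemma det_toR_ne (W : Matrix κ κ ℤ) (hW : W.det ≠ 0) : (toR W).det ≠ 0 := by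
  rw [det_toR]; exact_mod_cast hW

lemma one_le_abs_det (W : Matrix κ κ ℤ) (hW : W.det ≠ 0) : 1 ≤ |(toR W).det| := by
  rw [det_toR]; exact_mod_cast Int.one_le_abs hW

/-- entrywise bound -/
def Bd {κ l : Type*} (M : ℝ) (g : Matrix κ l ℝ) : Prop := ∀ a b, |g a b| ≤ M

/-- bounded with determinant bounded below -/
def Om (M : ℝ) : Set (Matrix κ κ ℝ) := {g | Bd M g ∧ M⁻¹ ≤ |g.det|}

lemma Bd.mono {M N : ℝ} {g : Matrix κ l ℝ} (h : Bd M g) (hMN : M ≤ N) : Bd N g :=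
  fun a b => (h a b).trans hMN

lemma Om.mono {M N : ℝ} (hM : 0 < M) {g : Matrix κ κ ℝ} (h : g ∈ Om M) (hMN : M ≤ N) :
    g ∈ Om N :=
  ⟨h.1.mono hMN, (inv_anti₀ hM hMN).trans h.2⟩

lemma Bd.mul {p : Type*} {M N : ℝ} (hM : 0 ≤ M) {g : Matrix p κ ℝ} {h : Matrix κ l ℝ}
    (hg : Bd M g) (hh : Bd N h) : Bd (Fintype.card κ * (M * N)) (g * h) := by
  intro a b
  rw [mul_apply]
  refine (Finset.abs_sum_le_sum_abs _ _).trans ?_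
  calc _ ≤ ∑ c : κ, M * N := Finset.sum_le_sum fun c _ => by
        rw [abs_mul]; exact mul_le_mul (hg a c) (hh c b) (abs_nonneg _) hM
    _ = _ := by simp

lemma Bd.add {M N : ℝ} {g h : Matrix κ l ℝ} (hg : Bd M g) (hh : Bd N h) : Bd (M + N) (g + h) :=
  fun a b => (abs_add_le _ _).trans (add_le_add (hg a b) (hh a b))

lemma Bd.neg {M : ℝ} {g : Matrix κ l ℝ} (hg : Bd M g) : Bd M (-g) :=
  fun a b => by simpa using hg a b

lemma Bd.smul {M : ℝ} {g : Matrix κ l ℝ} (hg : Bd M g) (c : ℝ) : Bd (|c| * M) (c • g) :=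
  fun a b => by
    simp only [Matrix.smul_apply, smul_eq_mul, abs_mul]
    exact mul_le_mul_of_nonneg_left (hg a b) (abs_nonneg _)

lemma Bd.mulVec {M N : ℝ} (hM : 0 ≤ M) {g : Matrix κ l ℝ} (hg : Bd M g) {v : l → ℝ}
    (hv : ∀ b, |v b| ≤ N) (a : κ) : |(g *ᵥ v) a| ≤ Fintype.card l * (M * N) := by
  refine (Finset.abs_sum_le_sum_abs _ _).trans ?_
  calc _ ≤ ∑ c : l, M * N := Finset.sum_le_sum fun c _ => by
        rw [abs_mul]; exact mul_le_mul (hg a c) (hv c) (abs_nonneg _) hM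
    _ = _ := by simp

lemma Bd_one : Bd 1 (1 : Matrix κ κ ℝ) := by
  intro a b; by_cases h : a = b <;> simp [one_apply, h]

/-- the constant `d! M^d` -/
noncomputable def dC (κ : Type*) [Fintype κ] (M : ℝ) : ℝ :=
  (Fintype.card κ).factorial * M ^ Fintype.card κ

lemma dC_pos (M : ℝ) (hM : 0 < M) : 0 < dC κ M := by unfold dC; positivity

lemma Bd.det_le {M : ℝ} {g : Matrix κ κ ℝ} (hg : Bd M g) : |g.det| ≤ dC κ M := by
  have := Matrix.det_le (A := g) (abv := AbsoluteValue.abs) (x := M) hg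
  simpa [dC] using this

lemma Bd.adjugate {M : ℝ} (hM : 1 ≤ M) {g : Matrix κ κ ℝ} (hg : Bd M g) :
    Bd (dC κ M) g.adjugate := by
  intro a b
  rw [adjugate_apply]
  apply Bd.det_le
  intro c e
  by_cases h : c = b
  · subst h
    rw [updateRow_self]
    by_cases h' : e = a
    · subst h'; simpa using hM
    · simp [h', Pi.single_apply]; linarith
  · rw [updateRow_ne h]; exact hg c e

lemma Om.det_ne {M : ℝ} (hM : 0 < M) {g : Matrix κ κ ℝ} (hg : g ∈ Om M) : g.det ≠ 0 := by
  have := hg.2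
  have h2 : 0 < M⁻¹ := by positivity
  intro h; rw [h, abs_zero] at this; linarith

lemma Om.inv {M : ℝ} (hM : 1 ≤ M) {g : Matrix κ κ ℝ} (hg : g ∈ Om M) :
    Bd (M * dC κ M) g⁻¹ := by
  have h0 : 0 < M := by linarith
  rw [Matrix.inv_def, Ring.inverse_eq_inv']
  refine (Bd.smul (hg.1.adjugate hM) _).mono ?_
  apply mul_le_mul_of_nonneg_right _ (dC_pos _ h0).le
  rw [abs_inv]
  exact inv_le_of_inv_le₀ h0 hg.2

lemma continuous_elem (a : κ) (b : l) : Continuous fun g : Matrix κ l ℝ => g a b :=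
  continuous_id.matrix_elem a b

lemma isClosed_Bd (M : ℝ) : IsClosed {g : Matrix κ l ℝ | Bd M g} := by
  simp only [Bd, Set.ofPred_forall]
  exact isClosed_iInter fun a => isClosed_iInter fun b =>
    isClosed_le (continuous_elem a b).abs continuous_const

lemma isClosed_Om (M : ℝ) : IsClosed (Om M : Set (Matrix κ κ ℝ)) := by
  have h : IsClosed {g : Matrix κ κ ℝ | M⁻¹ ≤ |g.det|} :=
    isClosed_le continuous_const (continuous_id.matrix_det).abs
  have := (isClosed_Bd (κ := κ) (l := κ) M).inter h
  exact this

lemma measurableSet_Om (M : ℝ) : MeasurableSet (Om M : Set (Matrix κ κ ℝ)) :=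
  (isClosed_Om M).measurableSet

lemma meas_mul_right (V : Matrix κ l ℝ) {p : Type*} [Fintype p] :
    Measurable fun g : Matrix p κ ℝ => g * V :=
  (continuous_id.matrix_mul continuous_const).measurable

lemma meas_mul_left (V : Matrix κ l ℝ) {p : Type*} [Fintype p] :
    Measurable fun g : Matrix l p ℝ => V * g :=
  (continuous_const.matrix_mul continuous_id).measurable

/-- volume of a box of matrices -/
lemma vol_box (S : κ → l → Set ℝ) :
    volume {g : Matrix κ l ℝ | ∀ a b, g a b ∈ S a b} = ∏ a, ∏ b, volume (S a b) := by
  have : {g : Matrix κ l ℝ | ∀ a b, g a b ∈ S a b} =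
    (Set.pi Set.univ fun a => Set.pi Set.univ fun b => S a b) := by
    ext g
    constructor
    · intro h a _ b _; exact h a b
    · intro h a b; exact h a trivial b trivial
  rw [this]
  change (Measure.pi fun _ : κ => (volume : Measure (l → ℝ))) _ = _
  rw [Measure.pi_pi]
  congr 1; ext a
  exact volume_pi_pi _

lemma Bd_eq_box (M : ℝ) : {g : Matrix κ l ℝ | Bd M g} =
    {g : Matrix κ l ℝ | ∀ a b, g a b ∈ Set.Icc (-M) M} := by
  ext g; simp [Bd, abs_le]

lemma vol_Bd_lt_top (M : ℝ) : volume {g : Matrix κ l ℝ | Bd M g} < ⊤ := by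
  rw [Bd_eq_box, vol_box]
  refine ENNReal.prod_lt_top fun a _ => ENNReal.prod_lt_top fun b _ => ?_
  simp

lemma vol_Om_lt_top (M : ℝ) : volume (Om M : Set (Matrix κ κ ℝ)) < ⊤ :=
  (measure_mono fun g hg => hg.1).trans_lt (vol_Bd_lt_top M)

end basic

section count
variable {κ : Type*} [Fintype κ] [DecidableEq κ]

lemma card_quot (W : Matrix κ κ ℤ) (hW : W.det ≠ 0) :
    Nat.card ((κ → ℤ) ⧸ LinearMap.range (toLin' Wᵀ)) = W.det.natAbs := by
  have hinj : Function.Injective (toLin' Wᵀ) := by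
    rw [← LinearMap.ker_eq_bot, Matrix.ker_toLin'_eq_bot_iff]
    intro v hv
    exact Matrix.eq_zero_of_mulVec_eq_zero (by simpa using hW) hv
  have := Submodule.natAbs_det_equiv (LinearMap.range (toLin' Wᵀ))
    (LinearEquiv.ofInjective (toLin' Wᵀ) hinj)
  rw [← this]
  congr 1
  have h2 : ((LinearMap.range (toLin' Wᵀ)).subtype ∘ₗ AddMonoidHom.toIntLinearMap
    ((LinearEquiv.ofInjective (toLin' Wᵀ) hinj : (κ → ℤ) ≃ₗ[ℤ] _) : (κ → ℤ) →+ _)) = toLin' Wᵀ := by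
    ext x; rfl
  rw [h2, LinearMap.det_toLin', det_transpose]

lemma L1 (W : Matrix κ κ ℤ) (hW : W.det ≠ 0) (C : ℕ) (T : Finset (κ → ℤ))
    (hT : ∀ x ∈ T, ∃ c : κ → ℝ, (∀ a, |c a| ≤ C) ∧ (fun a => (x a : ℝ)) = c ᵥ* toR W) :
    T.card ≤ (2 * C + 1) ^ Fintype.card κ * W.det.natAbs := by
  classical
  choose! c hc1 hc2 using hT
  let Q := (κ → ℤ) ⧸ LinearMap.range (toLin' Wᵀ)
  have hcard := card_quot W hW
  have hfin : Finite Q := Nat.finite_of_card_ne_zero (by rw [hcard]; simpa using hW)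
  have := Fintype.ofFinite Q
  let φ : (κ → ℤ) → (κ → ℤ) × Q := fun x =>
    (fun a => ⌊c x a⌋, Submodule.Quotient.mk x)
  let T' : Finset ((κ → ℤ) × Q) :=
    (Fintype.piFinset fun _ : κ => Finset.Icc (-(C : ℤ)) C) ×ˢ Finset.univ
  have hmaps : ∀ x ∈ T, φ x ∈ T' := by
    intro x hx
    simp only [T', φ, Finset.mem_product, Fintype.mem_piFinset, Finset.mem_Icc, Finset.mem_univ,
      and_true]
    intro a
    have := abs_le.mp (hc1 x hx a)
    constructor
    · rw [Int.le_floor]; push_cast; exact this.1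
    · have : (⌊c x a⌋ : ℝ) ≤ C := (Int.floor_le _).trans this.2
      exact_mod_cast this
  have hinj : Set.InjOn φ T := by
    intro x hx y hy hxy
    simp only [φ, Prod.mk.injEq] at hxy
    obtain ⟨h1, h2⟩ := hxy
    rw [Submodule.Quotient.eq] at h2
    obtain ⟨z, hz⟩ := h2
    have hzR : (fun a => (z a : ℝ)) ᵥ* toR W = (c x - c y) ᵥ* toR W := by
      rw [Matrix.sub_vecMul, ← hc2 x hx, ← hc2 y hy]
      ext a
      have := congrFun hz a
      simp only [toLin'_apply, mulVec_transpose, vecMul, dotProduct, Pi.sub_apply] at this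
      simp only [vecMul, dotProduct, Pi.sub_apply, toR_apply]
      exact_mod_cast this
    have hzc : (fun a => (z a : ℝ)) = c x - c y := by
      have hu : IsUnit (toR W) := by
        rw [Matrix.isUnit_iff_isUnit_det]; exact (det_toR_ne W hW).isUnit
      exact Matrix.vecMul_injective_of_isUnit hu hzR
    have hz0 : z = 0 := by
      ext a
      have h3 := congrFun hzc a
      have h4 := congrFun h1 a
      simp only [Pi.sub_apply] at h3
      have h5 := Int.abs_sub_lt_one_of_floor_eq_floor h4
      rw [← h3] at h5
      have h6 : |z a| < 1 := by exact_mod_cast h5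
      simpa using Int.abs_lt_one_iff.mp h6
    rw [hz0, map_zero] at hz
    exact (sub_eq_zero.mp hz.symm)
  calc T.card ≤ T'.card := Finset.card_le_card_of_injOn φ hmaps hinj
    _ = _ := by
      simp only [T', Finset.card_product, Fintype.card_piFinset, Int.card_Icc, Finset.prod_const,
        Finset.card_univ]
      rw [← Nat.card_eq_fintype_card (α := Q), hcard]
      congr 2
      omega

end count
end KM

open MeasureTheory
open scoped ENNReal
namespace KM
set_option linter.unusedSectionVars false
set_option linter.unusedSimpArgs false
set_option linter.unusedVariables false
open Matrix

instance instCountMat {κ l : Type*} [Finite κ] [Finite l] : Countable (Matrix κ l ℤ) :=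
  inferInstanceAs (Countable (κ → l → ℤ))

section L2
variable {κ : Type*} [Fintype κ] [DecidableEq κ]

lemma L2_pt (M : ℝ) (hM : 1 ≤ M) : ∃ C : ℝ, 0 ≤ C ∧ ∀ Y : Matrix κ κ ℝ,
    ∀ T : Finset {W : Matrix κ κ ℤ // W.det ≠ 0}, (∀ W ∈ T, Y * (toR W.1)⁻¹ ∈ Om M) →
    ∑ W ∈ T, (|(toR W.1).det|⁻¹) ^ Fintype.card κ ≤ C := by
  classical
  have hM0 : 0 < M := by linarith
  set d := Fintype.card κ with hd
  have hD := dC_pos (κ := κ) M hM0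
  obtain ⟨N, hN⟩ := exists_nat_ge ((d : ℝ) * (M * dC κ M * M))
  refine ⟨((2 * N + 1 : ℝ) ^ d * (M * dC κ M)) ^ d, by positivity, ?_⟩
  intro Y T hT
  rcases T.eq_empty_or_nonempty with rfl | ⟨W0, hW0⟩
  · simp; positivity
  have hg0 := hT W0 hW0
  set g0 := Y * (toR W0.1)⁻¹
  have hY0 : Y = g0 * toR W0.1 := by
    simp only [g0]
    rw [Matrix.mul_assoc, Matrix.nonsing_inv_mul _ (det_toR_ne _ W0.2).isUnit, Matrix.mul_one]
  have hdW0 : 0 < |(toR W0.1).det| := by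
    have := one_le_abs_det _ W0.2; linarith
  have hW : ∀ W ∈ T, ∃ g ∈ Om M, g * toR W.1 = Y := by
    intro W hW
    refine ⟨_, hT W hW, ?_⟩
    rw [Matrix.mul_assoc, Matrix.nonsing_inv_mul _ (det_toR_ne _ W.2).isUnit, Matrix.mul_one]
  have hrow : ∀ W ∈ T, ∃ Q : Matrix κ κ ℝ, Bd N Q ∧ toR W.1 = Q * toR W0.1 := by
    intro W hWT
    obtain ⟨g, hg, hgY⟩ := hW W hWT
    refine ⟨g⁻¹ * g0, ((Om.inv hM hg).mul (by positivity) hg0.1).mono hN, ?_⟩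
    rw [Matrix.mul_assoc, ← hY0, ← hgY, ← Matrix.mul_assoc,
      Matrix.nonsing_inv_mul _ (Om.det_ne hM0 hg).isUnit, Matrix.one_mul]
  have hterm : ∀ W ∈ T, (|(toR W.1).det|⁻¹) ^ d ≤ ((M * dC κ M) * |(toR W0.1).det|⁻¹) ^ d := by
    intro W hWT
    obtain ⟨g, hg, hgY⟩ := hW W hWT
    apply pow_le_pow_left₀ (by positivity)
    have h1 : |g.det| * |(toR W.1).det| = |g0.det| * |(toR W0.1).det| := by
      rw [← abs_mul, ← abs_mul, ← det_mul, ← det_mul, hgY, hY0]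
    have h2 := hg.1.det_le
    have h3 := hg0.2
    have h4 : 0 < |(toR W.1).det| := by
      have := one_le_abs_det _ W.2; linarith
    rw [← div_eq_mul_inv, inv_eq_one_div, div_le_div_iff₀ h4 hdW0]
    have h5 : 1 ≤ M * |g0.det| := by
      calc 1 = M * M⁻¹ := by field_simp
        _ ≤ _ := by gcongr
    calc 1 * |(toR W0.1).det| ≤ (M * |g0.det|) * |(toR W0.1).det| := by gcongr
      _ = M * (|g.det| * |(toR W.1).det|) := by rw [h1]; ring
      _ ≤ M * (dC κ M * |(toR W.1).det|) := by gcongr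
      _ = _ := by ring
  have hcard : (T.card : ℝ) ≤ ((2 * N + 1 : ℝ) ^ d * |(toR W0.1).det|) ^ d := by
    let Ta : κ → Finset (κ → ℤ) := fun a => T.image fun W => W.1 a
    have hTa : ∀ a, (Ta a).card ≤ (2 * N + 1) ^ d * W0.1.det.natAbs := by
      intro a
      apply L1 W0.1 W0.2
      intro x hx
      obtain ⟨W, hWT, rfl⟩ := Finset.mem_image.mp hx
      obtain ⟨Q, hQ, hWQ⟩ := hrow W hWT
      exact ⟨Q a, fun b => hQ a b, congrFun hWQ a⟩
    have h1 : T.card ≤ (Fintype.piFinset Ta).card := by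
      refine Finset.card_le_card_of_injOn (fun W => (W.1 : κ → κ → ℤ)) ?_ ?_
      · intro W hWT
        refine Finset.mem_coe.mpr (Fintype.mem_piFinset.mpr ?_)
        intro a
        exact Finset.mem_image_of_mem (fun W : {W : Matrix κ κ ℤ // W.det ≠ 0} => W.1 a) hWT
      · intro W _ V _ h
        exact Subtype.ext h
    have h2 : T.card ≤ ((2 * N + 1) ^ d * W0.1.det.natAbs) ^ d := by
      refine h1.trans ?_
      rw [Fintype.card_piFinset]
      calc _ ≤ ∏ a : κ, ((2 * N + 1) ^ d * W0.1.det.natAbs) := Finset.prod_le_prod' fun a _ => hTa a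
        _ = _ := by simp [hd]
    have h3 : (T.card : ℝ) ≤ (((2 * N + 1) ^ d * W0.1.det.natAbs) ^ d : ℕ) := by exact_mod_cast h2
    rw [det_toR]
    rw [Nat.cast_pow, Nat.cast_mul, Nat.cast_natAbs] at h3
    simp only [Int.cast_abs, Nat.cast_pow, Nat.cast_add, Nat.cast_mul, Nat.cast_ofNat,
      Nat.cast_one] at h3
    exact h3
  calc _ ≤ ∑ W ∈ T, ((M * dC κ M) * |(toR W0.1).det|⁻¹) ^ d := Finset.sum_le_sum hterm
    _ = T.card * ((M * dC κ M) * |(toR W0.1).det|⁻¹) ^ d := by simp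
    _ ≤ ((2 * N + 1 : ℝ) ^ d * |(toR W0.1).det|) ^ d * ((M * dC κ M) * |(toR W0.1).det|⁻¹) ^ d := by
        gcongr
    _ = _ := by
        rw [← mul_pow]; congr 1
        field_simp

lemma L2 (M : ℝ) (hM : 1 ≤ M) : ∃ C : ℝ, 0 ≤ C ∧ ∀ S : Set (Matrix κ κ ℝ), MeasurableSet S →
    ∑' W : {W : Matrix κ κ ℤ // W.det ≠ 0}, volume {g | g ∈ Om M ∧ g * toR W.1 ∈ S}
      ≤ ENNReal.ofReal C * volume S := by
  classical
  obtain ⟨C, hC, h⟩ := L2_pt (κ := κ) M hM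
  refine ⟨C, hC, fun S hS => ?_⟩
  have hOW : ∀ W : {W : Matrix κ κ ℤ // W.det ≠ 0},
      MeasurableSet {Y : Matrix κ κ ℝ | Y * (toR W.1)⁻¹ ∈ Om M} := fun W =>
    measurableSet_preimage (meas_mul_right _) (measurableSet_Om M)
  have h1 : ∀ W : {W : Matrix κ κ ℤ // W.det ≠ 0}, volume {g | g ∈ Om M ∧ g * toR W.1 ∈ S}
      = ∫⁻ Y in S, ENNReal.ofReal ((|(toR W.1).det|⁻¹) ^ Fintype.card κ) *
        {Y : Matrix κ κ ℝ | Y * (toR W.1)⁻¹ ∈ Om M}.indicator 1 Y := by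
    intro W
    have := vol_mul_right (κ := κ) (toR W.1) (det_toR_ne _ W.2)
      ({Y : Matrix κ κ ℝ | Y * (toR W.1)⁻¹ ∈ Om M} ∩ S) ((hOW W).inter hS)
    rw [lintegral_const_mul _ (measurable_one.indicator (hOW W)), lintegral_indicator_one (hOW W),
      Measure.restrict_apply (hOW W), ← this]
    congr 1
    ext g
    simp only [Set.mem_ofPred_eq, Set.mem_inter_iff]
    rw [Matrix.mul_assoc, Matrix.mul_nonsing_inv _ (det_toR_ne _ W.2).isUnit, Matrix.mul_one]
  simp_rw [h1]
  rw [← lintegral_tsum]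
  · calc _ ≤ ∫⁻ Y in S, ENNReal.ofReal C := by
          refine lintegral_mono fun Y => ?_
          rw [ENNReal.tsum_eq_iSup_sum]
          refine iSup_le fun T => ?_
          have := h Y (T.filter fun W => Y * (toR W.1)⁻¹ ∈ Om M) (by simp)
          refine le_trans ?_ (ENNReal.ofReal_le_ofReal this)
          rw [ENNReal.ofReal_sum_of_nonneg (fun _ _ => by positivity), Finset.sum_filter]
          refine Finset.sum_le_sum fun W _ => ?_
          by_cases hh : Y * (toR W.1)⁻¹ ∈ Om M <;> simp [Set.indicator, hh]
      _ = _ := by simp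
  · intro W
    exact ((measurable_one.indicator (hOW W)).const_mul _).aemeasurable

end L2

section completion
variable {κ I : Type*} [Fintype κ] [DecidableEq κ] [Fintype I] [DecidableEq I]

/-- cast of an integer vector -/
def vR {κ : Type*} (w : κ → ℤ) : κ → ℝ := fun a => (w a : ℝ)

lemma completion (w : I → κ → ℤ) (hw : LinearIndependent ℝ (fun c => vR (w c)))
    (φ : I ↪ κ) : ∃ W : Matrix κ κ ℤ, W.det ≠ 0 ∧ (∀ c, W.col (φ c) = w c) ∧
      ∀ b, (∀ c, φ c ≠ b) → ∃ a, W.col b = Pi.single a 1 := by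
  classical
  -- induction over sets containing the range of `φ`
  have key : ∀ s : Finset κ, ∃ v : κ → κ → ℤ, (∀ c, v (φ c) = w c) ∧
      LinearIndepOn ℝ (fun b => vR (v b)) (Set.range φ ∪ s) ∧
      ∀ b ∈ s, b ∉ Set.range φ → ∃ a, v b = Pi.single a 1 := by
    intro s
    induction s using Finset.induction_on with
    | empty =>
      refine ⟨fun b => if h : ∃ c, φ c = b then w h.choose else 0, ?_, ?_, by simp⟩
      · intro c
        have hc : ∃ c', φ c' = φ c := ⟨c, rfl⟩
        have := φ.injective hc.choose_spec
        simp only [hc, dif_pos, this]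
      · simp only [Finset.coe_empty, Set.union_empty]
        rw [linearIndepOn_range_iff φ.injective]
        convert hw using 1
        ext c : 1
        have hc : ∃ c', φ c' = φ c := ⟨c, rfl⟩
        have := φ.injective hc.choose_spec
        simp only [Function.comp_apply, hc, dif_pos, this]
    | insert b s hb ih =>
      obtain ⟨v, h1, h2, h3⟩ := ih
      by_cases hbr : b ∈ Set.range φ
      · refine ⟨v, h1, ?_, ?_⟩
        · convert h2 using 1
          ext x; simp; rintro rfl; left; simpa using hbr
        · intro b' hb' hb''
          rcases Finset.mem_insert.mp hb' with rfl | h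
          · exact absurd hbr hb''
          · exact h3 b' h hb''
      · obtain ⟨a, ha⟩ : ∃ a : κ, (Pi.single a 1 : κ → ℝ) ∉
            Submodule.span ℝ ((fun b => vR (v b)) '' (Set.range φ ∪ s)) := by
          by_contra hcon
          push Not at hcon
          have htop : Submodule.span ℝ ((fun b => vR (v b)) '' (Set.range φ ∪ s)) = ⊤ := by
            rw [eq_top_iff, ← (Pi.basisFun ℝ κ).span_eq, Submodule.span_le]
            rintro _ ⟨a, rfl⟩
            rw [Pi.basisFun_apply]
            exact hcon a
          let t : Finset κ := Finset.univ.erase b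
          have h4 : Submodule.span ℝ ((t.image (fun b => vR (v b)) : Finset (κ → ℝ)) : Set (κ → ℝ)) = ⊤ := by
            rw [eq_top_iff, ← htop]
            apply Submodule.span_mono
            rw [Finset.coe_image]
            apply Set.image_mono
            intro x hx
            simp only [t, Finset.coe_erase, Finset.coe_univ, Set.mem_sdiff, Set.mem_univ, true_and,
              Set.mem_singleton_iff]
            rintro rfl
            rcases hx with hx | hx
            · exact hbr hx
            · exact hb (by simpa using hx)
          have h5 := finrank_span_finset_le_card (R := ℝ) (t.image (fun b => vR (v b)))
          rw [Set.finrank, h4, finrank_top, Module.finrank_fintype_fun_eq_card] at h5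
          have h6 := h5.trans Finset.card_image_le
          rw [Finset.card_erase_of_mem (Finset.mem_univ _), Finset.card_univ] at h6
          have : 0 < Fintype.card κ := Fintype.card_pos_iff.mpr ⟨b⟩
          omega
        refine ⟨Function.update v b (Pi.single a 1), ?_, ?_, ?_⟩
        · intro c
          rw [Function.update_of_ne, h1]
          rintro rfl; exact hbr ⟨c, rfl⟩
        · have hins : (Set.range φ ∪ ((insert b s : Finset κ) : Set κ)) =
              insert b (Set.range φ ∪ (s : Set κ)) := by
            ext x; simp
          have heq : ∀ x ∈ Set.range φ ∪ (s : Set κ),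
              (fun b' => vR (Function.update v b (Pi.single a 1) b')) x = (fun b' => vR (v b')) x := by
            intro x hx
            have : x ≠ b := by
              rintro rfl
              rcases hx with hx | hx
              · exact hbr hx
              · exact hb (by simpa using hx)
            simp only [Function.update_of_ne this]
          rw [hins]
          apply LinearIndepOn.insert
          · exact (linearIndepOn_congr heq).mpr h2
          · rw [Set.image_congr heq]
            simp only [Function.update_self]
            have : vR (Pi.single a 1 : κ → ℤ) = Pi.single a 1 := by
              ext x
              by_cases hx : x = a <;> simp [vR, Pi.single_apply, hx]
            rw [this]
            exact ha
        · intro b' hb' hb''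
          by_cases h : b' = b
          · subst h; exact ⟨a, by simp⟩
          · rw [Function.update_of_ne h]
            exact h3 b' (by simpa [h] using hb') hb''
  obtain ⟨v, h1, h2, h3⟩ := key Finset.univ
  refine ⟨(Matrix.of v)ᵀ, ?_, ?_, ?_⟩
  · have h4 : LinearIndependent ℝ (toR (Matrix.of v)ᵀ).col := by
      rw [← linearIndepOn_univ_iff]
      exact h2.mono (by simp)
    rw [Matrix.linearIndependent_cols_iff_isUnit, Matrix.isUnit_iff_isUnit_det, det_toR] at h4
    exact_mod_cast h4.ne_zero
  · intro c; exact h1 c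
  · intro b hb
    exact h3 b (Finset.mem_univ _) (by rintro ⟨c, rfl⟩; exact hb c rfl)

end completion

section L3
variable {κ : Type*} [Fintype κ] [DecidableEq κ]

lemma mul_toR_col (g : Matrix κ κ ℝ) (W : Matrix κ κ ℤ) (a b : κ) :
    (g * toR W) a b = (g *ᵥ vR (W.col b)) a := by
  simp [mul_apply, mulVec, dotProduct, vR]

lemma mulVec_vR_single (g : Matrix κ κ ℝ) (a b : κ) :
    (g *ᵥ vR (Pi.single b 1)) a = g a b := by
  have : vR (Pi.single b 1 : κ → ℤ) = Pi.single b 1 := by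
    ext x
    by_cases hx : x = b <;> simp [vR, Pi.single_apply, hx]
  rw [this]; simp

lemma L3 (I : Type*) [Fintype I] [DecidableEq I] (M : ℝ) (hM : 1 ≤ M) :
    ∃ C : ℝ, 0 ≤ C ∧ ∀ β : κ → I → ℝ, (∀ a c, 0 ≤ β a c) →
    volume {g : Matrix κ κ ℝ | g ∈ Om M ∧ ∃ w : I → κ → ℤ,
      LinearIndependent ℝ (fun c => vR (w c)) ∧ ∀ c a, |(g *ᵥ vR (w c)) a| ≤ β a c}
    ≤ ENNReal.ofReal (C * ∏ c, ∏ a, β a c) := by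
  classical
  by_cases hcard : Fintype.card I ≤ Fintype.card κ
  swap
  · refine ⟨0, le_rfl, fun β hβ => ?_⟩
    refine le_trans (measure_mono (t := ∅) ?_) (by simp)
    rintro g ⟨_, w, hw, _⟩
    have := hw.fintype_card_le_finrank
    rw [Module.finrank_fintype_fun_eq_card] at this
    exact absurd this hcard
  obtain ⟨φ⟩ := Function.Embedding.nonempty_of_card_le hcard
  obtain ⟨C, hC, h⟩ := L2 (κ := κ) M hM
  let K : ℝ := (∏ b ∈ (Finset.univ.map φ)ᶜ, ∏ a : κ, 2 * M)
  let K2 : ℝ := (∏ c : I, ∏ a : κ, 2)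
  have hM0 : 0 < M := by linarith
  have hK : 0 ≤ K := by positivity
  have hK2 : 0 ≤ K2 := by positivity
  refine ⟨C * (K2 * K), by positivity, fun β hβ => ?_⟩
  let β' : κ → κ → ℝ := fun a b => if h : ∃ c, φ c = b then β a h.choose else M
  have hβ' : ∀ a c, β' a (φ c) = β a c := by
    intro a c
    have hc : ∃ c', φ c' = φ c := ⟨c, rfl⟩
    have := φ.injective hc.choose_spec
    simp only [β', hc, dif_pos, this]
  have hβM : ∀ a b, (∀ c, φ c ≠ b) → β' a b = M := by
    intro a b hb
    have : ¬ ∃ c, φ c = b := by push Not; exact hb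
    simp only [β', this, dif_neg, not_false_eq_true]
  have hβ0 : ∀ a b, 0 ≤ β' a b := by
    intro a b
    simp only [β']
    split_ifs
    · exact hβ _ _
    · exact hM0.le
  let S : Set (Matrix κ κ ℝ) := {Y | ∀ a b, Y a b ∈ Set.Icc (-β' a b) (β' a b)}
  have hS : MeasurableSet S := by
    simp only [S, Set.ofPred_forall]
    exact MeasurableSet.iInter fun a => MeasurableSet.iInter fun b =>
      measurableSet_preimage (continuous_elem a b).measurable measurableSet_Icc
  have hvS : volume S = ENNReal.ofReal ((K2 * K) * ∏ c, ∏ a, β a c) := by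
    rw [vol_box, Finset.prod_comm]
    have : ∀ b a, volume (Set.Icc (-β' a b) (β' a b)) = ENNReal.ofReal (2 * β' a b) := by
      intro b a; rw [Real.volume_Icc]; congr 1; ring
    simp_rw [this]
    have h2 : ∀ b, ∏ a, ENNReal.ofReal (2 * β' a b) = ENNReal.ofReal (∏ a, 2 * β' a b) := by
      intro b
      rw [ENNReal.ofReal_prod_of_nonneg]
      intro a _; have := hβ0 a b; positivity
    simp_rw [h2]
    rw [← ENNReal.ofReal_prod_of_nonneg
      (fun b _ => Finset.prod_nonneg fun a _ => by have := hβ0 a b; positivity)]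
    congr 1
    rw [← Finset.prod_mul_prod_compl (Finset.univ.map φ), Finset.prod_map]
    simp_rw [hβ']
    have h3 : ∏ b ∈ (Finset.univ.map φ)ᶜ, ∏ a, 2 * β' a b = K := by
      refine Finset.prod_congr rfl fun b hb => Finset.prod_congr rfl fun a _ => ?_
      rw [hβM]
      intro c hc
      simp at hb
      exact hb c hc
    rw [h3]
    simp_rw [Finset.prod_mul_distrib]
    simp only [K2]
    ring
  calc _ ≤ volume (⋃ W : {W : Matrix κ κ ℤ // W.det ≠ 0}, {g | g ∈ Om M ∧ g * toR W.1 ∈ S}) := by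
        apply measure_mono
        rintro g ⟨hg, w, hw, hgw⟩
        obtain ⟨W, hW, h1, h2⟩ := completion w hw φ
        refine Set.mem_iUnion.mpr ⟨⟨W, hW⟩, hg, ?_⟩
        intro a b
        rw [mul_toR_col, Set.mem_Icc, ← abs_le]
        by_cases hb : ∃ c, φ c = b
        · obtain ⟨c, rfl⟩ := hb
          rw [hβ', h1]
          exact hgw c a
        · push Not at hb
          rw [hβM a b hb]
          obtain ⟨a', ha'⟩ := h2 b hb
          rw [ha', mulVec_vR_single]
          exact hg.1 a a'
    _ ≤ _ := measure_iUnion_le _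
    _ ≤ _ := h S hS
    _ = _ := by
      rw [hvS, ← ENNReal.ofReal_mul hC]; congr 1; ring

lemma L3' (M : ℝ) (hM : 1 ≤ M) :
    ∃ C : ℝ, 0 ≤ C ∧ ∀ y θ : κ → ℝ, (∀ a, 0 ≤ θ a) →
    ∑' τ : {τ : κ → ℤ // τ ≠ 0}, volume {Z : Matrix κ κ ℝ | Z ∈ Om M ∧
      ∀ a, |y a + (Z *ᵥ vR τ.1) a| ≤ θ a}
    ≤ ENNReal.ofReal (C * ∏ a, θ a) := by
  classical
  obtain ⟨C, hC, h⟩ := L2 (κ := κ) M hM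
  have hM0 : 0 < M := by linarith
  cases isEmpty_or_nonempty κ with
  | inl hE =>
    have : IsEmpty {τ : κ → ℤ // τ ≠ 0} := ⟨fun τ => τ.2 (Subsingleton.elim _ _)⟩
    exact ⟨0, le_rfl, fun y θ _ => by simp⟩
  | inr hne =>
  obtain ⟨b0⟩ := hne
  have hex : ∀ τ : {τ : κ → ℤ // τ ≠ 0}, ∃ W : {W : Matrix κ κ ℤ // W.det ≠ 0},
      W.1.col b0 = τ.1 ∧ ∀ b, b ≠ b0 → ∃ a, W.1.col b = Pi.single a 1 := by
    intro τ
    have hli : LinearIndependent ℝ (fun _ : Unit => vR τ.1) := by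
      apply LinearIndependent.of_subsingleton ()
      intro h0
      apply τ.2
      ext a
      have := congrFun h0 a
      simpa [vR] using this
    obtain ⟨W, h1, h2, h3⟩ := completion (fun _ : Unit => τ.1) hli ⟨fun _ => b0, fun _ _ _ => rfl⟩
    exact ⟨⟨W, h1⟩, h2 (), fun b hb => h3 b (fun _ => hb.symm)⟩
  choose W hW1 hW2 using hex
  have hinj : Function.Injective W := by
    intro τ τ' h
    apply Subtype.ext
    rw [← hW1, ← hW1, h]
  let d := Fintype.card κ
  let K : ℝ := (∏ b ∈ Finset.univ.erase b0, ∏ a : κ, 2 * M)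
  refine ⟨C * (2 ^ d * K), by positivity, fun y θ hθ => ?_⟩
  let lo : κ → κ → ℝ := fun a b => if b = b0 then -y a - θ a else -M
  let hi : κ → κ → ℝ := fun a b => if b = b0 then -y a + θ a else M
  let S : Set (Matrix κ κ ℝ) := {Y | ∀ a b, Y a b ∈ Set.Icc (lo a b) (hi a b)}
  have hS : MeasurableSet S := by
    simp only [S, Set.ofPred_forall]
    exact MeasurableSet.iInter fun a => MeasurableSet.iInter fun b =>
      measurableSet_preimage (continuous_elem a b).measurable measurableSet_Icc
  have hvS : volume S = ENNReal.ofReal ((2 ^ d * K) * ∏ a, θ a) := by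
    rw [vol_box, Finset.prod_comm, ← Finset.mul_prod_erase _ _ (Finset.mem_univ b0)]
    have h1 : ∏ a, volume (Set.Icc (lo a b0) (hi a b0)) = ENNReal.ofReal (2 ^ d * ∏ a, θ a) := by
      have : ∀ a, volume (Set.Icc (lo a b0) (hi a b0)) = ENNReal.ofReal (2 * θ a) := by
        intro a
        simp only [lo, hi, if_true, Real.volume_Icc]
        congr 1; ring
      simp_rw [this]
      rw [← ENNReal.ofReal_prod_of_nonneg (fun a _ => by have := hθ a; positivity),
        Finset.prod_mul_distrib]
      simp [d]
    have h2 : ∏ b ∈ Finset.univ.erase b0, ∏ a, volume (Set.Icc (lo a b) (hi a b)) =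
        ENNReal.ofReal K := by
      rw [ENNReal.ofReal_prod_of_nonneg (fun _ _ => Finset.prod_nonneg fun _ _ => by positivity)]
      refine Finset.prod_congr rfl fun b hb => ?_
      rw [ENNReal.ofReal_prod_of_nonneg (fun _ _ => by positivity)]
      refine Finset.prod_congr rfl fun a _ => ?_
      simp only [lo, hi, Finset.ne_of_mem_erase hb, if_false, Real.volume_Icc]
      congr 1; ring
    rw [h1, h2, ← ENNReal.ofReal_mul]
    · congr 1; ring
    · have := Finset.prod_nonneg (s := Finset.univ) (fun a _ => hθ a)
      positivity
  calc _ ≤ ∑' τ : {τ : κ → ℤ // τ ≠ 0}, volume {g | g ∈ Om M ∧ g * toR (W τ).1 ∈ S} := by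
        refine ENNReal.tsum_le_tsum fun τ => measure_mono ?_
        rintro g ⟨hg, hgτ⟩
        refine ⟨hg, fun a b => ?_⟩
        rw [mul_toR_col]
        by_cases hb : b = b0
        · subst hb
          rw [hW1]
          have := abs_le.mp (hgτ a)
          simp only [lo, hi, if_true, Set.mem_Icc]
          constructor <;> linarith
        · obtain ⟨a', ha'⟩ := hW2 τ b hb
          simp only [lo, hi, hb, if_false]
          rw [ha', mulVec_vR_single, Set.mem_Icc, ← abs_le]
          exact hg.1 a a'
    _ ≤ ∑' W : {W : Matrix κ κ ℤ // W.det ≠ 0}, volume {g | g ∈ Om M ∧ g * toR W.1 ∈ S} :=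
        ENNReal.tsum_comp_le_tsum_of_injective hinj
          (fun W => volume {g | g ∈ Om M ∧ g * toR W.1 ∈ S})
    _ ≤ _ := h S hS
    _ = _ := by
      rw [hvS, ← ENNReal.ofReal_mul hC]; congr 1; ring

end L3
end KM

open MeasureTheory
open scoped ENNReal
namespace KM
set_option linter.unusedSectionVars false
set_option linter.unusedSimpArgs false
set_option linter.unusedVariables false
open Matrix

section transp
variable {κ l : Type*} [Fintype κ] [Fintype l] [DecidableEq κ] [DecidableEq l]

lemma mp_transpose : MeasurePreserving (fun g : Matrix κ l ℝ => gᵀ) volume volume := by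
  have hm : Measurable (fun g : Matrix κ l ℝ => gᵀ) :=
    (continuous_id.matrix_transpose).measurable
  refine ⟨hm, ?_⟩
  symm
  change (Measure.pi fun _ : l => (volume : Measure (κ → ℝ))) = _
  refine Measure.pi_eq_generateFrom
    (C := fun _ : l => Set.pi Set.univ '' Set.pi Set.univ fun _ : κ => {s : Set ℝ | MeasurableSet s})
    (fun _ => generateFrom_pi) (fun _ => isPiSystem_pi)
    (fun _ => Measure.FiniteSpanningSetsIn.pi (fun _ => (volume : Measure ℝ).toFiniteSpanningSetsIn))
    ?_
  intro s hs
  choose t ht1 ht2 using hs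
  have hst : Set.pi Set.univ s = {g : Matrix l κ ℝ | ∀ b a, g b a ∈ t b a} := by
    ext g
    constructor
    · intro h b a
      have := h b trivial
      rw [← ht2] at this
      exact this a trivial
    · intro h b _
      rw [← ht2]
      intro a _
      exact h b a
  have hmt : MeasurableSet {g : Matrix l κ ℝ | ∀ b a, g b a ∈ t b a} := by
    simp only [Set.ofPred_forall]
    exact MeasurableSet.iInter fun a => MeasurableSet.iInter fun b =>
      measurableSet_preimage (continuous_elem a b).measurable (ht1 a b trivial)
  have h1 : (Measure.map (fun g : Matrix κ l ℝ => gᵀ) volume) {g : Matrix l κ ℝ | ∀ b a, g b a ∈ t b a}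
      = ∏ b, ∏ a, volume (t b a) := by
    rw [Measure.map_apply hm hmt, Finset.prod_comm, ← vol_box]
    congr 1
    ext g
    exact forall_comm
  refine (congrArg _ hst).trans (h1.trans ?_)
  congr 1
  ext b
  rw [← ht2]
  exact (Measure.pi_pi _ _).symm

lemma lintegral_mul_left (V : Matrix κ κ ℝ) (hV : V.det ≠ 0)
    (F : Matrix κ l ℝ → ℝ≥0∞) (hF : Measurable F) :
    ∫⁻ h : Matrix κ l ℝ, F (V * h) = ENNReal.ofReal ((|V.det|⁻¹) ^ Fintype.card l) * ∫⁻ h : Matrix κ l ℝ, F h := by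
  have hmt : Measurable (fun g : Matrix l κ ℝ => gᵀ) :=
    (continuous_id.matrix_transpose).measurable
  have h1 := lintegral_rowMap (κ := l) (fun _ => Vᵀ) (fun _ => by simpa using hV)
    (fun g : Matrix l κ ℝ => F gᵀ) (hF.comp hmt)
  simp only [rowMap_const, transpose_mul, transpose_transpose, det_transpose, Finset.prod_const,
    Finset.card_univ] at h1
  rw [(mp_transpose (κ := l) (l := κ)).lintegral_comp hF] at h1
  rw [← h1]
  exact ((mp_transpose (κ := l) (l := κ)).lintegral_comp (hF.comp (meas_mul_left V))).symm

end transp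

section blk2
variable {J K : Type*} [Fintype J] [Fintype K]

lemma lintegral_blk' (F : Matrix (J ⊕ K) (J ⊕ K) ℝ → ℝ≥0∞) (hF : Measurable F) :
    ∫⁻ g, F g = ∫⁻ Z : Matrix K K ℝ, ∫⁻ C : Matrix K J ℝ, ∫⁻ N : Matrix J K ℝ, ∫⁻ A : Matrix J J ℝ,
      F (fromBlocks A N C Z) := by
  have hm := (mp_blk (J := J) (K := K)).measurable
  rw [← (mp_blk (J := J) (K := K)).lintegral_comp hF]
  have hFm := hF.comp hm
  simp only [Function.comp_def] at hFm
  rw [Measure.volume_eq_prod, lintegral_prod_symm _ hFm.aemeasurable]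
  rw [Measure.volume_eq_prod, lintegral_prod_symm]
  · refine lintegral_congr fun Z => ?_
    refine lintegral_congr fun C => ?_
    rw [Measure.volume_eq_prod, lintegral_prod_symm]
    exact (hF.comp (hm.comp (measurable_prodMk_right (y := (C, Z))))).aemeasurable
  · exact hFm.lintegral_prod_left'.aemeasurable

lemma meas_blk {X : Type*} [MeasurableSpace X] {A : X → Matrix J J ℝ} {N : X → Matrix J K ℝ}
    {C : X → Matrix K J ℝ} {Z : X → Matrix K K ℝ} (hA : Measurable A) (hN : Measurable N)
    (hC : Measurable C) (hZ : Measurable Z) :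
    Measurable fun x => fromBlocks (A x) (N x) (C x) (Z x) :=
  (mp_blk (J := J) (K := K)).measurable.comp ((hA.prodMk hN).prodMk (hC.prodMk hZ))

end blk2

section small
variable {κ : Type*} [Fintype κ] [DecidableEq κ] {I : Type*}

/-- the lattice `g ℤ^κ` has `|I|` independent vectors of sup norm at most `r` -/
def Small (I : Type*) (g : Matrix κ κ ℝ) (r : ℝ) : Prop :=
  ∃ w : I → κ → ℤ, LinearIndependent ℝ (fun c => vR (w c)) ∧ ∀ c a, |(g *ᵥ vR (w c)) a| ≤ r

lemma Small.mono {g : Matrix κ κ ℝ} {r r' : ℝ} (h : Small I g r) (hr : r ≤ r') : Small I g r' := by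
  obtain ⟨w, h1, h2⟩ := h
  exact ⟨w, h1, fun c a => (h2 c a).trans hr⟩

lemma Small.left {g p : Matrix κ κ ℝ} {r C : ℝ} (hC : 0 ≤ C) (hp : Bd C p) (h : Small I g r) :
    Small I (p * g) (Fintype.card κ * (C * r)) := by
  obtain ⟨w, h1, h2⟩ := h
  refine ⟨w, h1, fun c a => ?_⟩
  rw [← mulVec_mulVec]
  exact hp.mulVec hC (h2 c) a

lemma vR_mulVec (W : Matrix κ κ ℤ) (w : κ → ℤ) : vR (W *ᵥ w) = toR W *ᵥ vR w := by
  ext a; simp [vR, mulVec, dotProduct]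

lemma linInd_mulVec (W : Matrix κ κ ℤ) (hW : W.det ≠ 0) (w : I → κ → ℤ)
    (hw : LinearIndependent ℝ (fun c => vR (w c))) :
    LinearIndependent ℝ (fun c => vR (W *ᵥ w c)) := by
  have : (fun c => vR (W *ᵥ w c)) = toLin' (toR W) ∘ (fun c => vR (w c)) := by
    ext c a; simp [vR_mulVec]
  rw [this]
  apply hw.map'
  rw [Matrix.ker_toLin'_eq_bot_iff]
  intro v hv
  exact Matrix.eq_zero_of_mulVec_eq_zero (det_toR_ne W hW) hv

lemma Small.of_mul {h : Matrix κ κ ℝ} {W : Matrix κ κ ℤ} (hW : W.det ≠ 0) {r : ℝ}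
    (hs : Small I (h * toR W) r) : Small I h r := by
  obtain ⟨w, h1, h2⟩ := hs
  refine ⟨fun c => W *ᵥ w c, linInd_mulVec W hW w h1, fun c a => ?_⟩
  rw [vR_mulVec, mulVec_mulVec]
  exact h2 c a

lemma toR_adj (V : Matrix κ κ ℤ) : toR V * toR V.adjugate = ((V.det : ℤ) : ℝ) • 1 := by
  rw [← toR_mul, mul_adjugate, toR_smul, toR_one]

lemma Small.adj {h : Matrix κ κ ℝ} {V : Matrix κ κ ℤ} (hV : V.det ≠ 0) {r : ℝ}
    (hs : Small I h r) : Small I (h * toR V) (|(toR V).det| * r) := by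
  obtain ⟨w, h1, h2⟩ := hs
  have hadj : V.adjugate.det ≠ 0 := by
    rw [det_adjugate]; exact pow_ne_zero _ hV
  refine ⟨fun c => V.adjugate *ᵥ w c, linInd_mulVec _ hadj w h1, fun c a => ?_⟩
  rw [vR_mulVec, mulVec_mulVec, Matrix.mul_assoc, toR_adj, det_toR]
  simp only [Matrix.mul_smul, Matrix.mul_one, smul_mulVec, Pi.smul_apply, smul_eq_mul, abs_mul]
  exact mul_le_mul_of_nonneg_left (h2 c a) (abs_nonneg _)

lemma continuous_mulVec (v : κ → ℝ) (a : κ) : Continuous fun g : Matrix κ κ ℝ => (g *ᵥ v) a := by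
  simp only [mulVec, dotProduct]
  exact continuous_finsetSum _ fun c _ => (continuous_elem a c).mul continuous_const

/-- general measurability -/
lemma measurableSet_exBd [Fintype I] (β : κ → I → ℝ) (P : (I → κ → ℤ) → Prop) :
    MeasurableSet {g : Matrix κ κ ℝ | ∃ w : I → κ → ℤ, P w ∧ ∀ c a, |(g *ᵥ vR (w c)) a| ≤ β a c} := by
  have : {g : Matrix κ κ ℝ | ∃ w : I → κ → ℤ, P w ∧ ∀ c a, |(g *ᵥ vR (w c)) a| ≤ β a c} =
      ⋃ w : {w : I → κ → ℤ // P w}, {g | ∀ c a, |(g *ᵥ vR (w.1 c)) a| ≤ β a c} := by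
    ext g
    simp only [Set.mem_ofPred_eq, Set.mem_iUnion, Subtype.exists, exists_prop]
  rw [this]
  refine MeasurableSet.iUnion fun w => IsClosed.measurableSet ?_
  simp only [Set.ofPred_forall]
  exact isClosed_iInter fun c => isClosed_iInter fun a =>
    isClosed_le (continuous_mulVec _ a).abs continuous_const

lemma measurableSet_Small [Fintype I] (r : ℝ) : MeasurableSet {g : Matrix κ κ ℝ | Small I g r} :=
  measurableSet_exBd (fun _ _ => r) _

lemma vol_Om_pos {M : ℝ} (hM : 1 < M) : 0 < volume (Om M : Set (Matrix κ κ ℝ)) := by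
  have hopen : IsOpen {g : Matrix κ κ ℝ | (∀ a b, |g a b| < M) ∧ M⁻¹ < |g.det|} := by
    refine IsOpen.and ?_ (isOpen_lt continuous_const (continuous_id.matrix_det).abs)
    simp only [Set.ofPred_forall]
    exact isOpen_iInter_of_finite fun a => isOpen_iInter_of_finite fun b =>
      isOpen_lt (continuous_elem a b).abs continuous_const
  refine (hopen.measure_pos volume ⟨1, ?_, ?_⟩).trans_le (measure_mono ?_)
  · intro a b; exact (Bd_one a b).trans_lt hM
  · simp; exact inv_lt_one_of_one_lt₀ hM
  · rintro g ⟨h1, h2⟩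
    exact ⟨fun a b => (h1 a b).le, h2.le⟩

lemma vol_Bd_pos {l : Type*} [Fintype l] [DecidableEq l] {M : ℝ} (hM : 0 < M) :
    0 < volume {g : Matrix κ l ℝ | Bd M g} := by
  rw [Bd_eq_box, vol_box]
  simp only [Real.volume_Icc]
  rw [pos_iff_ne_zero]
  simp [Finset.prod_eq_zero_iff]
  intro _ _; linarith

end small

section flow
variable {κ : Type*} [Fintype κ] [DecidableEq κ]

/-- diagonal flow with weights `ω` -/
noncomputable def fl (ω : κ → ℝ) (s : ℝ) : Matrix κ κ ℝ := diagonal fun a => Real.exp (s * ω a)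

lemma fl_add (ω : κ → ℝ) (s t : ℝ) : fl ω s * fl ω t = fl ω (s + t) := by
  simp [fl, diagonal_mul_diagonal, ← Real.exp_add, add_mul]

lemma fl_zero (ω : κ → ℝ) : fl ω 0 = 1 := by simp [fl]

lemma fl_neg_mul (ω : κ → ℝ) (s : ℝ) : fl ω (-s) * fl ω s = 1 := by simp [fl_add, fl_zero]
lemma fl_mul_neg (ω : κ → ℝ) (s : ℝ) : fl ω s * fl ω (-s) = 1 := by simp [fl_add, fl_zero]

lemma det_fl (ω : κ → ℝ) (s : ℝ) (hω : ∑ a, ω a = 0) : (fl ω s).det = 1 := by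
  rw [fl, det_diagonal, ← Real.exp_sum, ← Finset.mul_sum, hω]; simp

lemma fl_mulVec (ω : κ → ℝ) (s : ℝ) (v : κ → ℝ) (a : κ) :
    (fl ω s *ᵥ v) a = Real.exp (s * ω a) * v a := by
  simp [fl, mulVec_diagonal]

lemma fl_mul_apply {l : Type*} (ω : κ → ℝ) (s : ℝ) (g : Matrix κ l ℝ) (a : κ) (b : l) :
    (fl ω s * g) a b = Real.exp (s * ω a) * g a b := by
  simp [fl, diagonal_mul]

lemma mul_fl_apply {l : Type*} (ω : κ → ℝ) (s : ℝ) (g : Matrix l κ ℝ) (a : l) (b : κ) :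
    (g * fl ω s) a b = g a b * Real.exp (s * ω b) := by
  simp [fl, mul_diagonal]

end flow
end KM

open MeasureTheory
open scoped ENNReal
namespace KM
set_option linter.unusedSectionVars false
set_option linter.unusedSimpArgs false
set_option linter.unusedVariables false
open Matrix


section link
variable {κ : Type*} [Fintype κ] [DecidableEq κ]

lemma linInd_mulVec_iff {I : Type*} (g : Matrix κ κ ℝ) (hg : g.det ≠ 0) (w : I → κ → ℝ) :
    LinearIndependent ℝ (fun c => g *ᵥ w c) ↔ LinearIndependent ℝ w := by
  have : (fun c => g *ᵥ w c) = toLin' g ∘ w := by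
    ext c a; simp
  rw [this]
  apply LinearMap.linearIndependent_iff
  rw [Matrix.ker_toLin'_eq_bot_iff]
  intro v hv
  exact Matrix.eq_zero_of_mulVec_eq_zero hg hv

lemma mem_colLattice (g : Matrix κ κ ℝ) (v : κ → ℝ) :
    v ∈ colLattice g ↔ ∃ w : κ → ℤ, v = g *ᵥ vR w := by
  rw [colLattice, Submodule.mem_span_range_iff_exists_fun]
  refine exists_congr fun w => ?_
  have : ∑ i, w i • (fun a => g a i) = g *ᵥ vR w := by
    ext a
    simp [mulVec, dotProduct, vR, Finset.sum_apply, mul_comm]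
  rw [this]
  exact eq_comm

lemma succMin_le_of_Small {i : ℕ} {g : Matrix κ κ ℝ} (hg : g.det ≠ 0) {r : ℝ} (hr : 0 < r)
    (h : Small (Fin i) g r) : succMin (colLattice g) i ≤ (Fintype.card κ + 1) * r := by
  obtain ⟨w, h1, h2⟩ := h
  refine csInf_le ⟨0, fun x hx => hx.1.le⟩ ⟨by positivity, fun c => g *ᵥ vR (w c), ?_, ?_, ?_⟩
  · intro j; exact (mem_colLattice _ _).2 ⟨_, rfl⟩
  · exact (linInd_mulVec_iff g hg _).2 h1
  · intro j
    rw [euclNorm, Real.sqrt_le_left (by positivity)]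
    have : ∑ a, (g *ᵥ vR (w j)) a ^ 2 ≤ ∑ a : κ, r ^ 2 := by
      refine Finset.sum_le_sum fun a _ => ?_
      exact sq_le_sq' (by linarith [(abs_le.1 (h2 j a)).1]) (abs_le.1 (h2 j a)).2
    refine this.trans ?_
    simp only [Finset.sum_const, Finset.card_univ, nsmul_eq_mul]
    rw [mul_pow]
    refine mul_le_mul_of_nonneg_right ?_ (sq_nonneg r)
    nlinarith [(Nat.cast_nonneg (Fintype.card κ) : (0:ℝ) ≤ _)]

lemma le_euclNorm (v : κ → ℝ) (a : κ) : |v a| ≤ euclNorm v := by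
  rw [euclNorm]
  apply Real.abs_le_sqrt
  exact Finset.single_le_sum (f := fun i => v i ^ 2) (fun i _ => sq_nonneg _) (Finset.mem_univ a)

lemma Small_of_succMin_le {i : ℕ} (hi : i ≤ Fintype.card κ) {g : Matrix κ κ ℝ} (hg : g.det ≠ 0)
    {x : ℝ} (hx : 0 < x) (h : succMin (colLattice g) i ≤ x) : Small (Fin i) g (2 * x) := by
  have hne : {r : ℝ | 0 < r ∧ ∃ v : Fin i → (κ → ℝ), (∀ j, v j ∈ colLattice g) ∧
    LinearIndependent ℝ v ∧ ∀ j, euclNorm (v j) ≤ r}.Nonempty := by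
    have hc : Fintype.card (Fin i) ≤ Fintype.card κ := by simpa using hi
    obtain ⟨e⟩ := Function.Embedding.nonempty_of_card_le hc
    refine ⟨1 + ∑ j : Fin i, euclNorm (g *ᵥ Pi.single (e j) 1), ?_, fun j => g *ᵥ Pi.single (e j) 1, ?_, ?_, ?_⟩
    · have : 0 ≤ ∑ j : Fin i, euclNorm (g *ᵥ Pi.single (e j) 1) :=
        Finset.sum_nonneg fun j _ => Real.sqrt_nonneg _
      linarith
    · intro j
      refine (mem_colLattice _ _).2 ⟨Pi.single (e j) 1, ?_⟩
      have h0 : vR (Pi.single (e j) 1 : κ → ℤ) = Pi.single (e j) 1 := by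
        ext a
        simp [vR, Pi.single_apply]
      rw [h0]
    · rw [linInd_mulVec_iff g hg]
      exact (Pi.linearIndependent_single_one κ ℝ).comp e e.injective
    · intro j
      have := Finset.single_le_sum (f := fun j => euclNorm (g *ᵥ Pi.single (e j) 1))
        (fun i _ => Real.sqrt_nonneg _) (Finset.mem_univ j)
      linarith
  obtain ⟨r, ⟨hr0, v, hv1, hv2, hv3⟩, hr⟩ := (csInf_lt_iff ⟨0, fun x hx => hx.1.le⟩ hne).1
    (lt_of_le_of_lt h (by linarith : x < 2 * x))
  choose w hw using fun j => (mem_colLattice g (v j)).1 (hv1 j)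
  refine ⟨w, ?_, fun c a => ?_⟩
  · rw [← linInd_mulVec_iff g hg]
    convert! hv2 using 2
    rw [hw]
  · rw [← hw]
    exact (le_euclNorm _ a).trans ((hv3 c).trans hr.le)

end link

section lemU
variable {T B : Type*} [Fintype T] [DecidableEq T] [Fintype B] [DecidableEq B]

/-- unipotent element -/
def ub (b : Matrix B T ℝ) : Matrix (T ⊕ B) (T ⊕ B) ℝ := fromBlocks 1 0 b 1

lemma ub_add (b c : Matrix B T ℝ) : ub (b + c) = ub b * ub c := by
  simp [ub, fromBlocks_multiply]

lemma ub_zero : ub (0 : Matrix B T ℝ) = 1 := by simp [ub]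

lemma det_ub (b : Matrix B T ℝ) : (ub b).det = 1 := by simp [ub]

lemma Bd_ub {M : ℝ} (hM : 1 ≤ M) {b : Matrix B T ℝ} (hb : Bd M b) : Bd M (ub b) := by
  rintro (a | a) (c | c)
  · exact (Bd_one a c).trans hM
  · simp [ub]; linarith
  · exact hb a c
  · exact (Bd_one a c).trans hM

lemma Bd_blk {J K J' K' : Type*} {M : ℝ} {X : Matrix J J' ℝ} {Y : Matrix J K' ℝ} {W : Matrix K J' ℝ} {Z : Matrix K K' ℝ}
    (hX : Bd M X) (hY : Bd M Y) (hW : Bd M W) (hZ : Bd M Z) : Bd M (fromBlocks X Y W Z) := by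
  rintro (a | a) (c | c)
  · exact hX a c
  · exact hY a c
  · exact hW a c
  · exact hZ a c

lemma Bd_zero {J K : Type*} {M : ℝ} (hM : 0 ≤ M) : Bd M (0 : Matrix J K ℝ) := by
  intro a b; simpa using hM

/-- the weights -/
def om (p q : ℝ) : T ⊕ B → ℝ := Sum.elim (fun _ => -p) (fun _ => q)

lemma sum_om {p q : ℝ} (hpq : Fintype.card T * p = Fintype.card B * q) :
    ∑ a, (om p q : T ⊕ B → ℝ) a = 0 := by
  simp [om, Fintype.sum_sum_type]; linarith

lemma fl_om (p q s : ℝ) : fl (om p q : T ⊕ B → ℝ) s =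
    fromBlocks (Real.exp (-(s * p)) • 1) 0 0 (Real.exp (s * q) • 1) := by
  ext (a | a) (b | b) <;> simp [fl, om, Matrix.one_apply, diagonal_apply]

lemma fl_ub (p q s : ℝ) (b : Matrix B T ℝ) :
    fl (om p q) s * ub b = ub (Real.exp (s * (p + q)) • b) * fl (om p q) s := by
  rw [fl_om, ub, ub, fromBlocks_multiply, fromBlocks_multiply]
  simp [smul_smul, ← Real.exp_add]
  ring_nf

/-- conjugation of the opposite parabolic is contracting -/
lemma Bd_conj {p q s M : ℝ} (hs : 0 ≤ s * (p + q)) {X : Matrix T T ℝ} {Y : Matrix T B ℝ} {Z : Matrix B B ℝ}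
    (hM : 0 ≤ M) (hX : Bd M X) (hY : Bd M Y) (hZ : Bd M Z) :
    Bd M (fl (om p q) s * fromBlocks X Y 0 Z * fl (om p q) (-s)) := by
  rintro (a | a) (b | b) <;> rw [mul_fl_apply, fl_mul_apply] <;> simp only [om, Sum.elim_inl, Sum.elim_inr,
    fromBlocks_apply₁₁, fromBlocks_apply₁₂, fromBlocks_apply₂₁, fromBlocks_apply₂₂]
  · rw [mul_right_comm, ← Real.exp_add]
    simpa using hX a b
  · rw [mul_right_comm, ← Real.exp_add, abs_mul, Real.abs_exp]
    calc _ ≤ 1 * |Y a b| := by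
          gcongr
          rw [Real.exp_le_one_iff]; linarith
      _ ≤ _ := by simpa using hY a b
  · simpa using hM
  · rw [mul_right_comm, ← Real.exp_add]
    simpa using hZ a b

lemma measurable_ub : Measurable (ub : Matrix B T ℝ → Matrix (T ⊕ B) (T ⊕ B) ℝ) :=
  meas_blk measurable_const measurable_const measurable_id measurable_const

lemma prod_exp_om {p q : ℝ} (hpq : Fintype.card T * p = Fintype.card B * q) (s : ℝ) :
    ∏ a, Real.exp (s * (om p q : T ⊕ B → ℝ) a) = 1 := by
  rw [← Real.exp_sum, ← Finset.mul_sum, sum_om hpq]; simp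

/-- thickening lower bound -/
lemma thicken (S : Set (Matrix B T ℝ)) (hS : MeasurableSet S)
    (G : Set (Matrix (T ⊕ B) (T ⊕ B) ℝ)) (hG : MeasurableSet G)
    (h : ∀ b ∈ S, ∀ X ∈ (Om 2 : Set (Matrix T T ℝ)), ∀ Y : Matrix T B ℝ, Bd 1 Y → ∀ Z ∈ (Om 2 : Set (Matrix B B ℝ)),
      fromBlocks X Y 0 Z * ub b ∈ G) :
    volume S * (volume (Om 2 : Set (Matrix T T ℝ)) * volume {Y : Matrix T B ℝ | Bd 1 Y} *
      volume (Om 2 : Set (Matrix B B ℝ))) ≤ 2 ^ Fintype.card T * volume G := by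
  set v1 := volume (Om 2 : Set (Matrix T T ℝ))
  set v2 := volume {Y : Matrix T B ℝ | Bd 1 Y}
  have hind : Measurable (G.indicator (1 : Matrix (T ⊕ B) (T ⊕ B) ℝ → ℝ≥0∞)) := measurable_one.indicator hG
  have hY : MeasurableSet {Y : Matrix T B ℝ | Bd 1 Y} := (isClosed_Bd 1).measurableSet
  have key : ∀ Z ∈ (Om 2 : Set (Matrix B B ℝ)), volume S * (v1 * v2) ≤ 2 ^ Fintype.card T *
      ∫⁻ C : Matrix B T ℝ, ∫⁻ N : Matrix T B ℝ, ∫⁻ A : Matrix T T ℝ, G.indicator 1 (fromBlocks A N C Z) := by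
    intro Z hZ
    set F : Matrix B T ℝ → ℝ≥0∞ := fun C => ∫⁻ N : Matrix T B ℝ, ∫⁻ A : Matrix T T ℝ,
      G.indicator 1 (fromBlocks A N C Z) with hF
    have hFm : Measurable F := by
      have h1 : Measurable fun x : (Matrix B T ℝ × Matrix T B ℝ) × Matrix T T ℝ =>
          G.indicator (1 : Matrix (T ⊕ B) (T ⊕ B) ℝ → ℝ≥0∞) (fromBlocks x.2 x.1.2 x.1.1 Z) :=
        hind.comp (meas_blk measurable_snd (measurable_snd.comp measurable_fst)
          (measurable_fst.comp measurable_fst) measurable_const)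
      exact h1.lintegral_prod_right'.lintegral_prod_right'
    have h0 := lintegral_mul_left (l := T) Z (Om.det_ne (by norm_num) hZ) F hFm
    have h1 : ∫⁻ b : Matrix B T ℝ, F (Z * b) ≤ 2 ^ Fintype.card T * ∫⁻ C, F C := by
      rw [h0]
      gcongr
      rw [show (2 : ℝ≥0∞) ^ Fintype.card T = ENNReal.ofReal (2 ^ Fintype.card T) by
        rw [ENNReal.ofReal_pow (by norm_num)]; norm_num]
      apply ENNReal.ofReal_le_ofReal
      gcongr
      exact inv_le_of_inv_le₀ (by norm_num) hZ.2
    refine le_trans ?_ h1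
    have h2 : ∀ b, S.indicator (fun _ => v1 * v2) b ≤ F (Z * b) := by
      intro b
      by_cases hb : b ∈ S
      · rw [Set.indicator_of_mem hb]
        have h3 : ∀ N : Matrix T B ℝ, {Y : Matrix T B ℝ | Bd 1 Y}.indicator (fun _ => v1) N ≤
            ∫⁻ A : Matrix T T ℝ, G.indicator 1 (fromBlocks A N (Z * b) Z) := by
          intro N
          by_cases hN : N ∈ {Y : Matrix T B ℝ | Bd 1 Y}
          · rw [Set.indicator_of_mem hN]
            rw [← lintegral_add_right_eq_self _ (N * b)]
            have : v1 = ∫⁻ A : Matrix T T ℝ, (Om 2).indicator 1 A := by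
              rw [lintegral_indicator_one (measurableSet_Om 2)]
            rw [this]
            refine lintegral_mono fun A => ?_
            by_cases hA : A ∈ (Om 2 : Set (Matrix T T ℝ))
            · have := h b hb A hA N hN Z hZ
              rw [ub, fromBlocks_multiply] at this
              simp only [Matrix.mul_one, Matrix.mul_zero, zero_add, Matrix.zero_mul] at this
              rw [Set.indicator_of_mem hA, Set.indicator_of_mem this]; simp
            · rw [Set.indicator_of_notMem hA]; simp
          · rw [Set.indicator_of_notMem hN]; simp
        refine le_trans ?_ (lintegral_mono h3)
        rw [lintegral_indicator_const hY]
      · rw [Set.indicator_of_notMem hb]; simp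
    refine le_trans ?_ (lintegral_mono h2)
    rw [lintegral_indicator_const hS, mul_comm]
  have h5 : volume S * (v1 * v2) * volume (Om 2 : Set (Matrix B B ℝ)) ≤ 2 ^ Fintype.card T * volume G := by
    rw [← lintegral_indicator_one hG, lintegral_blk' _ hind, ← lintegral_const_mul']
    · rw [← lintegral_indicator_const (measurableSet_Om 2)]
      refine lintegral_mono fun Z => ?_
      by_cases hZ : Z ∈ (Om 2 : Set (Matrix B B ℝ))
      · rw [Set.indicator_of_mem hZ]; exact key Z hZ
      · rw [Set.indicator_of_notMem hZ]; simp
    · exact ENNReal.pow_ne_top (by norm_num)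
  rw [← mul_assoc]; exact h5

lemma L4 (I : Type*) [Fintype I] [DecidableEq I] {p q : ℝ} (hp : 0 ≤ p) (hq : 0 ≤ q)
    (hpq : Fintype.card T * p = Fintype.card B * q) {M : ℝ} (hM : 1 ≤ M) :
    ∃ C : ℝ, 0 ≤ C ∧ ∀ h' ∈ (Om M : Set (Matrix (T ⊕ B) (T ⊕ B) ℝ)), ∀ s : ℝ, 0 ≤ s → ∀ r : ℝ, 0 ≤ r →
      volume {b : Matrix B T ℝ | Bd 1 b ∧ Small I (fl (om p q) s * ub b * h') r} ≤
        ENNReal.ofReal (C * r ^ (Fintype.card (T ⊕ B) * Fintype.card I)) := by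
  set k : ℝ := (Fintype.card (T ⊕ B) : ℝ) with hk
  have hk0 : 0 ≤ k := Nat.cast_nonneg _
  set M' : ℝ := k * (k * (2 * 1) * M) + 4 * M + 1 with hM'
  have hM'1 : 1 ≤ M' := by nlinarith [mul_nonneg hk0 hk0]
  obtain ⟨C3, hC3, H3⟩ := L3 (κ := T ⊕ B) I M' hM'1
  set v : ℝ≥0∞ := volume (Om 2 : Set (Matrix T T ℝ)) * volume {Y : Matrix T B ℝ | Bd 1 Y} *
      volume (Om 2 : Set (Matrix B B ℝ)) with hv
  have hv0 : v ≠ 0 := by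
    refine mul_ne_zero (mul_ne_zero ?_ ?_) ?_
    · exact (vol_Om_pos (by norm_num)).ne'
    · exact (vol_Bd_pos (by norm_num)).ne'
    · exact (vol_Om_pos (by norm_num)).ne'
  have hvt : v ≠ ⊤ := by
    refine ENNReal.mul_ne_top (ENNReal.mul_ne_top ?_ ?_) ?_
    · exact (vol_Om_lt_top 2).ne
    · exact (vol_Bd_lt_top 1).ne
    · exact (vol_Om_lt_top 2).ne
  have hvr : 0 < v.toReal := ENNReal.toReal_pos hv0 hvt
  set N := Fintype.card (T ⊕ B) * Fintype.card I with hN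
  refine ⟨2 ^ Fintype.card T * M ^ Fintype.card (T ⊕ B) * C3 * (2 * k) ^ N / v.toReal, by positivity, ?_⟩
  intro h' hh' s hs r hr
  have hM0 : 0 < M := by linarith
  set S3 : Set (Matrix (T ⊕ B) (T ⊕ B) ℝ) := {g | g ∈ Om M' ∧ ∃ w : I → T ⊕ B → ℤ,
    LinearIndependent ℝ (fun c => vR (w c)) ∧
      ∀ c a, |(g *ᵥ vR (w c)) a| ≤ Real.exp (-s * om p q a) * (k * (2 * r))} with hS3
  have hS3m : MeasurableSet S3 := by
    have := (measurableSet_Om (κ := T ⊕ B) M').inter (measurableSet_exBd (I := I) (κ := T ⊕ B)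
      (fun a c => Real.exp (-s * om p q a) * (k * (2 * r))) (fun w => LinearIndependent ℝ (fun c => vR (w c))))
    exact this
  have hS3v := H3 (fun a c => Real.exp (-s * om p q a) * (k * (2 * r))) (fun a c => by positivity)
  have hpr : ∏ c : I, ∏ a : T ⊕ B, Real.exp (-s * om p q a) * (k * (2 * r)) = (k * (2 * r)) ^ N := by
    simp_rw [Finset.prod_mul_distrib, prod_exp_om hpq]
    simp only [Finset.prod_const, Finset.card_univ, one_pow, one_mul]
    rw [← pow_mul, hN, mul_pow, mul_pow]
    simp only [← pow_mul]
  rw [hpr] at hS3v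
  have hGv := vol_mul_right h' (Om.det_ne hM0 hh') S3 hS3m
  have hGm : MeasurableSet {g : Matrix (T ⊕ B) (T ⊕ B) ℝ | g * h' ∈ S3} := meas_mul_right h' hS3m
  set S : Set (Matrix B T ℝ) := {b | Bd 1 b ∧ Small I (fl (om p q) s * ub b * h') r} with hS
  have hSm : MeasurableSet S := by
    have h1 : MeasurableSet {b : Matrix B T ℝ | Small I (fl (om p q) s * ub b * h') r} :=
      ((meas_mul_right h').comp ((meas_mul_left _).comp measurable_ub)) (measurableSet_Small (I := I) r)
    exact (isClosed_Bd 1).measurableSet.inter h1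
  have key := thicken S hSm {g : Matrix (T ⊕ B) (T ⊕ B) ℝ | g * h' ∈ S3} hGm ?_
  · have h6 : volume S * v ≤ ENNReal.ofReal (2 ^ Fintype.card T * (M ^ Fintype.card (T ⊕ B) * (C3 * (k * (2 * r)) ^ N))) := by
      refine key.trans ?_
      rw [ENNReal.ofReal_mul (by positivity), ENNReal.ofReal_pow (by norm_num)]
      simp only [ENNReal.ofReal_ofNat]
      gcongr
      rw [hGv, ENNReal.ofReal_mul (by positivity)]
      gcongr
      · exact inv_le_of_inv_le₀ hM0 hh'.2
    have h7 : volume S ≤ ENNReal.ofReal (2 ^ Fintype.card T * (M ^ Fintype.card (T ⊕ B) * (C3 * (k * (2 * r)) ^ N))) / v :=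
      (ENNReal.le_div_iff_mul_le (Or.inl hv0) (Or.inl hvt)).2 h6
    refine h7.trans ?_
    rw [← ENNReal.ofReal_toReal hvt, ← ENNReal.ofReal_div_of_pos hvr, ENNReal.toReal_ofReal hvr.le]
    apply ENNReal.ofReal_le_ofReal
    rw [show k * (2 * r) = 2 * k * r by ring, mul_pow]
    apply le_of_eq
    ring
  · rintro b ⟨hb1, hb2⟩ X hX Y hY Z hZ
    have hY2 : Bd 2 Y := hY.mono (by norm_num)
    have hPB : Bd 2 (fromBlocks X Y 0 Z) := Bd_blk hX.1 hY2 (Bd_zero (by norm_num)) hZ.1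
    refine ⟨⟨?_, ?_⟩, ?_⟩
    · refine ((hPB.mul (by norm_num) (Bd_ub le_rfl hb1)).mul (by positivity) hh'.1).mono ?_
      linarith
    · rw [det_mul, det_mul, det_ub, det_fromBlocks_zero₂₁, abs_mul, mul_one, abs_mul]
      have h1 := hX.2
      have h2 := hZ.2
      have h3 := hh'.2
      calc M'⁻¹ ≤ (4 * M)⁻¹ := by
            apply inv_anti₀ (by positivity)
            nlinarith [mul_nonneg hk0 hk0]
        _ = 2⁻¹ * 2⁻¹ * M⁻¹ := by rw [mul_inv]; norm_num
        _ ≤ _ := by gcongr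
    · have hsm := hb2.left (I := I) (by norm_num) (Bd_conj (p := p) (q := q) (s := s) (by positivity) (by norm_num) hX.1 hY2 hZ.1)
      obtain ⟨w, hw1, hw2⟩ := hsm
      refine ⟨w, hw1, fun c a => ?_⟩
      have := hw2 c a
      rw [show fl (om p q) s * fromBlocks X Y 0 Z * fl (om p q) (-s) * (fl (om p q) s * ub b * h') =
        fl (om p q) s * (fromBlocks X Y 0 Z * ub b * h') by
          simp only [Matrix.mul_assoc]
          rw [← Matrix.mul_assoc (fl (om p q) (-s)) (fl (om p q) s), fl_neg_mul, Matrix.one_mul],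
        ← mulVec_mulVec, fl_mulVec, abs_mul, Real.abs_exp] at this
      have h8 := mul_le_mul_of_nonneg_left this (Real.exp_nonneg (-s * om p q a))
      rw [← mul_assoc, ← Real.exp_add] at h8
      rw [show -s * (om p q a) + s * om p q a = 0 by ring, Real.exp_zero, one_mul] at h8
      exact h8

end lemU
end KM

open MeasureTheory
open scoped ENNReal
namespace KM
set_option linter.unusedSectionVars false
set_option linter.unusedSimpArgs false
set_option linter.unusedVariables false
open Matrix


section conv

lemma AQ_eq {m n : ℕ} {R : ℝ} (hR : 0 < R) :
    AQ m n R = fl (om (n : ℝ)⁻¹ (m : ℝ)⁻¹ : Fin n ⊕ Fin m → ℝ) (Real.log R) := by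
  unfold AQ fl
  congr 1
  ext (a | a) <;> simp [om, Real.rpow_def_of_pos hR]

lemma AQ_UB_eq {m n : ℕ} {R : ℝ} (hR : 0 < R) (b : Fin m → Fin n → ℝ) :
    AQ m n R * UB b = fl (om (n : ℝ)⁻¹ (m : ℝ)⁻¹) (Real.log R) * ub (of b) := by
  rw [AQ_eq hR]; rfl

lemma toR_ub {T B : Type*} [Fintype T] [DecidableEq T] [Fintype B] [DecidableEq B] (c : Matrix B T ℤ) :
    toR (fromBlocks 1 0 c 1 : Matrix (T ⊕ B) (T ⊕ B) ℤ) = ub (of fun a b => (c a b : ℝ)) := by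
  ext (a | a) (b | b) <;> simp [toR_apply, ub, Matrix.one_apply]

lemma det_fl_ub {T B : Type*} [Fintype T] [DecidableEq T] [Fintype B] [DecidableEq B] {p q : ℝ}
    (hpq : Fintype.card T * p = Fintype.card B * q) (s : ℝ) (b : Matrix B T ℝ) :
    (fl (om p q) s * ub b).det = 1 := by
  rw [det_mul, det_ub, det_fl _ _ (sum_om hpq), mul_one]

lemma Bd_fl {κ : Type*} [Fintype κ] [DecidableEq κ] {ω : κ → ℝ} (hω : ∀ a, |ω a| ≤ 1) {s : ℝ} (hs : |s| ≤ 1) :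
    Bd (Real.exp 1) (fl ω s) := by
  intro a b
  rw [fl, diagonal_apply]
  split_ifs
  · rw [Real.abs_exp, Real.exp_le_exp]
    refine (le_abs_self _).trans ?_
    rw [abs_mul]
    exact mul_le_one₀ hs (abs_nonneg _) (hω a)
  · simp; positivity

lemma BC_conv {T B : Type*} [Fintype T] [DecidableEq T] [Fintype B] [DecidableEq B] {p q : ℝ}
    (hp : 0 ≤ p) (hq : 0 ≤ q)
    (hpq : Fintype.card T * p = Fintype.card B * q) (I : Type*) [Fintype I] [DecidableEq I]
    (s r : ℕ → ℝ) (hs : ∀ k, 0 ≤ s k) (hr : ∀ k, 0 ≤ r k)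
    (hsum : Summable fun k => r k ^ (Fintype.card (T ⊕ B) * Fintype.card I)) :
    ∀ᵐ b : Matrix B T ℝ, ∀ᶠ k in Filter.atTop, ¬ Small I (fl (om p q) (s k) * ub b) (r k) := by
  obtain ⟨C, hC, H⟩ := L4 (T := T) (B := B) I hp hq hpq le_rfl
  have hone : (1 : Matrix (T ⊕ B) (T ⊕ B) ℝ) ∈ Om 1 := ⟨Bd_one, by simp⟩
  have hnull : volume {b : Matrix B T ℝ | ∃ᶠ k in Filter.atTop,
      (Bd 1 b ∧ Small I (fl (om p q) (s k) * ub b) (r k))} = 0 := by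
    apply measure_setOfPred_frequently_eq_zero
    have h1 : ∀ k, volume {b : Matrix B T ℝ | Bd 1 b ∧ Small I (fl (om p q) (s k) * ub b) (r k)} ≤
        ENNReal.ofReal (C * r k ^ (Fintype.card (T ⊕ B) * Fintype.card I)) := by
      intro k
      have := H 1 hone (s k) (hs k) (r k) (hr k)
      simpa only [Matrix.mul_one] using this
    refine ne_top_of_le_ne_top ?_ (ENNReal.tsum_le_tsum h1)
    exact (hsum.mul_left C).tsum_ofReal_ne_top
  have hcov : {b : Matrix B T ℝ | ¬ ∀ᶠ k in Filter.atTop, ¬ Small I (fl (om p q) (s k) * ub b) (r k)} ⊆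
      ⋃ c : Matrix B T ℤ, (fun b => b + (of fun a d => (c a d : ℝ))) ⁻¹' {b : Matrix B T ℝ | ∃ᶠ k in Filter.atTop,
      (Bd 1 b ∧ Small I (fl (om p q) (s k) * ub b) (r k))} := by
    intro b hb
    rw [Set.mem_iUnion]
    refine ⟨of fun a d => -⌊b a d⌋, ?_⟩
    have hb' : ∃ᶠ k in Filter.atTop, Small I (fl (om p q) (s k) * ub b) (r k) := hb
    refine hb'.mono fun k hk => ⟨?_, ?_⟩
    · intro a d
      have h0 := Int.floor_le (b a d)
      have h1 := Int.lt_floor_add_one (b a d)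
      simp only [Matrix.add_apply, of_apply, Int.cast_neg]
      rw [abs_le]; constructor <;> linarith
    · refine Small.of_mul (W := fromBlocks 1 0 (of fun a d => ⌊b a d⌋) 1) (by simp) ?_
      rw [toR_ub, Matrix.mul_assoc, ← ub_add]
      convert! hk using 3
      ext a d
      simp
  rw [ae_iff]
  refine measure_mono_null hcov ?_
  rw [measure_iUnion_null_iff]
  intro c
  rw [measure_preimage_add_right]
  exact hnull

theorem conv_dir (m n : ℕ) (hm : 1 ≤ m) (hn : 1 ≤ n)
    (f : ℝ → ℝ) (hfpos : ∀ x > (0 : ℝ), 0 < f x) (hfmono : MonotoneOn f (Set.Ioi 0))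
    (i : ℕ) (hi1 : 1 ≤ i) (hi2 : i ≤ m + n - 1) (hsum : Summable fun k : ℕ => 1 / f (k + 1)) :
      ∀ᵐ B : Fin m → Fin n → ℝ ∂volume, ∃ R₀ > (0 : ℝ), ∀ R ≥ R₀,
        f (Real.log R) ^ (-(((m + n : ℕ) : ℝ) * (i : ℝ))⁻¹)
          < succMin (colLattice (AQ m n R * UB B)) i := by
  set p : ℝ := (n : ℝ)⁻¹ with hp
  set q : ℝ := (m : ℝ)⁻¹ with hq
  have hn0 : (0 : ℝ) < n := by exact_mod_cast hn
  have hm0 : (0 : ℝ) < m := by exact_mod_cast hm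
  have hp1 : p ≤ 1 := inv_le_one_of_one_le₀ (by exact_mod_cast hn)
  have hq1 : q ≤ 1 := inv_le_one_of_one_le₀ (by exact_mod_cast hm)
  have hp0 : 0 ≤ p := by positivity
  have hq0 : 0 ≤ q := by positivity
  have hpq : Fintype.card (Fin n) * p = Fintype.card (Fin m) * q := by
    simp [hp, hq, hn0.ne', hm0.ne']
  set d := m + n with hd
  set e : ℝ := -((d : ℝ) * (i : ℝ))⁻¹ with he
  set c : ℝ := d * (Real.exp 1 * 2) with hc
  have hdi : (0 : ℝ) < (d : ℝ) * i := by
    have : (0 : ℝ) < i := by exact_mod_cast hi1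
    have : (0 : ℝ) < d := by rw [hd]; push_cast; linarith
    positivity
  have hbc := BC_conv hp0 hq0 hpq (Fin i) (fun k => (k : ℝ) + 1) (fun k => c * f (k + 1) ^ e)
    (fun k => by positivity) (fun k => by have := hfpos (k + 1) (by positivity); positivity) ?_
  · have hbc' : ∀ᵐ b : Fin m → Fin n → ℝ, ∀ᶠ k : ℕ in Filter.atTop,
        ¬ Small (Fin i) (fl (om p q) ((k : ℝ) + 1) * ub (of b)) (c * f (k + 1) ^ e) := hbc
    filter_upwards [hbc'] with b hb
    obtain ⟨k0, hk0⟩ := Filter.eventually_atTop.1 hb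
    refine ⟨Real.exp (k0 + 1), Real.exp_pos _, fun R hR => ?_⟩
    have hR0 : 0 < R := (Real.exp_pos _).trans_le hR
    rw [AQ_UB_eq hR0]
    set t := Real.log R with ht
    have ht1 : (k0 : ℝ) + 1 ≤ t := by rwa [ht, Real.le_log_iff_exp_le hR0]
    by_contra hcon
    push Not at hcon
    have ht0 : 0 < t := by
      have : (0:ℝ) ≤ k0 := Nat.cast_nonneg _
      linarith
    have hft : 0 < f t := hfpos t ht0
    have hxpos : 0 < f t ^ e := by positivity
    have hsm := Small_of_succMin_le (by simp; omega) (by rw [det_fl_ub hpq]; exact one_ne_zero) hxpos hcon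
    have hfl0 : 0 ≤ t - 1 := by have : (0:ℝ) ≤ k0 := by positivity
                                linarith
    set k := ⌊t - 1⌋₊ with hk
    have hk1 : (k : ℝ) ≤ t - 1 := Nat.floor_le hfl0
    have hk2 : t - 1 < k + 1 := Nat.lt_floor_add_one _
    have hkk0 : k0 ≤ k := Nat.le_floor (by linarith)
    refine hk0 k hkk0 ?_
    have h1 := hsm.left (p := fl (om p q) (k + 1 - t)) (Real.exp_nonneg 1) (Bd_fl (by
      rintro (a | a)
      · simp only [om, Sum.elim_inl]; rw [abs_neg, abs_of_nonneg hp0]; exact hp1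
      · simp only [om, Sum.elim_inr]; rw [abs_of_nonneg hq0]; exact hq1) (by rw [abs_le]; constructor <;> linarith))
    rw [← Matrix.mul_assoc, fl_add, sub_add_cancel] at h1
    refine h1.mono ?_
    have h2 : f t ^ e ≤ f (k + 1) ^ e := by
      refine Real.rpow_le_rpow_of_nonpos (hfpos _ (by positivity)) (hfmono ?_ ?_ (by linarith)) ?_
      · show (0:ℝ) < k + 1; positivity
      · exact ht0
      · rw [he]; simp; positivity
    rw [hc]
    have : (Fintype.card (Fin n ⊕ Fin m) : ℝ) = d := by simp [hd]; ring
    rw [this, mul_assoc (d : ℝ), mul_assoc (Real.exp 1)]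
    gcongr
  · have hcard : Fintype.card (Fin n ⊕ Fin m) * Fintype.card (Fin i) = d * i := by simp [hd, add_comm]
    rw [hcard]
    refine (hsum.mul_left (c ^ (d * i))).congr fun k => ?_
    rw [mul_pow c, ← Real.rpow_natCast (f _ ^ e), ← Real.rpow_mul (hfpos _ (by positivity)).le, he]
    push_cast
    rw [neg_mul, inv_mul_cancel₀ hdi.ne', Real.rpow_neg_one]
    simp

end conv
end KM

open MeasureTheory
open scoped ENNReal
namespace KM
set_option linter.unusedSectionVars false
set_option linter.unusedSimpArgs false
set_option linter.unusedVariables false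
open Matrix


section L5
variable {κ : Type*} [Fintype κ] [DecidableEq κ]

/-- Minkowski's linear forms theorem (strict version) -/
lemma minkowski_forms (P : Matrix κ κ ℝ) (hP : P.det ≠ 0) (β : κ → ℝ) (hβ : ∀ a, 0 ≤ β a)
    (h : |P.det| < ∏ a, β a) : ∃ w : κ → ℤ, w ≠ 0 ∧ ∀ a, |(P *ᵥ vR w) a| ≤ β a := by
  set s : Set (κ → ℝ) := (toLin' P) ⁻¹' (Set.Icc (fun a => -β a) β) with hs
  have fund := ZSpan.isAddFundamentalDomain' (Pi.basisFun ℝ κ) volume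
  have hvF : volume (ZSpan.fundamentalDomain (Pi.basisFun ℝ κ)) = 1 := by
    rw [ZSpan.volume_fundamentalDomain]
    have : (of (Pi.basisFun ℝ κ) : Matrix κ κ ℝ) = 1 := by
      ext a b; simp [Matrix.one_apply, Pi.single_apply, eq_comm]
    rw [this]; simp
  have hvs : volume s = ENNReal.ofReal (|P.det|⁻¹ * ∏ a, (2 * β a)) := by
    rw [hs, Measure.addHaar_preimage_linearMap _ (by rwa [LinearMap.det_toLin']), LinearMap.det_toLin',
      Real.volume_Icc_pi, abs_inv, ENNReal.ofReal_mul (by positivity), ENNReal.ofReal_prod_of_nonneg]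
    · congr 1
      refine Finset.prod_congr rfl fun a _ => ?_
      congr 1; ring
    · intro a _; have := hβ a; positivity
  have hcount : Countable (Submodule.span ℤ (Set.range (Pi.basisFun ℝ κ))).toAddSubgroup := by
    have h1 : Countable (Submodule.span ℤ (Set.range (Pi.basisFun ℝ κ))) := inferInstance
    exact h1
  have hsym : ∀ x ∈ s, -x ∈ s := by
    intro x hx
    simp only [hs, Set.mem_preimage, map_neg] at hx ⊢
    refine ⟨fun a => ?_, fun a => ?_⟩
    · have := hx.2 a; simp only [Pi.neg_apply]; linarith
    · have := hx.1 a; simp only [Pi.neg_apply]; linarith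
  have hcvx : Convex ℝ s := (convex_Icc _ _).linear_preimage (toLin' P)
  have hvol : volume (ZSpan.fundamentalDomain (Pi.basisFun ℝ κ)) * 2 ^ Module.finrank ℝ (κ → ℝ) < volume s := by
    rw [hvF, hvs, one_mul, Module.finrank_fintype_fun_eq_card, Finset.prod_mul_distrib, Finset.prod_const,
      Finset.card_univ]
    rw [show (2 : ℝ≥0∞) ^ Fintype.card κ = ENNReal.ofReal (2 ^ Fintype.card κ) by
        rw [ENNReal.ofReal_pow (by norm_num)]; norm_num]
    have h0 : 0 < |P.det| := abs_pos.2 hP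
    rw [ENNReal.ofReal_lt_ofReal_iff_of_nonneg (by positivity)]
    have : 1 < |P.det|⁻¹ * ∏ a, β a := by
      rw [inv_mul_eq_div, lt_div_iff₀ h0]; linarith
    calc (2:ℝ) ^ Fintype.card κ = 2 ^ Fintype.card κ * 1 := by ring
      _ < 2 ^ Fintype.card κ * (|P.det|⁻¹ * ∏ a, β a) := by gcongr
      _ = _ := by ring
  obtain ⟨x, hx0, hx⟩ := exists_ne_zero_mem_lattice_of_measure_mul_two_pow_lt_measure (s := s) fund
    hsym hcvx hvol
  have hx1 := x.2
  rw [Submodule.mem_toAddSubgroup, Submodule.mem_span_range_iff_exists_fun] at hx1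
  obtain ⟨w, hw⟩ := hx1
  have hw' : (x : κ → ℝ) = vR w := by
    rw [← hw]; ext a; simp [vR, Finset.sum_apply, Pi.single_apply]
  refine ⟨w, ?_, fun a => ?_⟩
  · rintro rfl
    apply hx0
    ext a
    rw [hw']; simp [vR]
  · rw [hw'] at hx
    have h1 := hx.1 a
    have h2 := hx.2 a
    simp only [toLin'_apply] at h1 h2
    exact abs_le.2 ⟨h1, h2⟩

lemma exists_functional {p : Submodule ℝ (κ → ℝ)} (hp : p ≠ ⊤) : ∃ ξ : κ → ℝ, ξ ≠ 0 ∧ ∀ v ∈ p, ξ ⬝ᵥ v = 0 := by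
  obtain ⟨f, hf0, hf⟩ := Submodule.exists_le_ker_of_lt_top p (lt_top_iff_ne_top.2 hp)
  refine ⟨fun a => f (Pi.single a 1), ?_, fun v hv => ?_⟩
  · intro h
    apply hf0
    apply LinearMap.pi_ext'
    intro a
    ext
    simpa using congrFun h a
  · have := hf hv
    rw [LinearMap.mem_ker, pi_eq_sum_univ' v, map_sum] at this
    simp only [map_smul, smul_eq_mul] at this
    rw [← this, dotProduct]
    refine Finset.sum_congr rfl fun a _ => ?_
    rw [mul_comm]

lemma exists_W (g : Matrix κ κ ℝ) (M : ℝ)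
    (h : Submodule.span ℝ {v : κ → ℝ | ∃ w : κ → ℤ, v = vR w ∧ ∀ a, |(g *ᵥ vR w) a| ≤ M} = ⊤) :
    ∃ W : Matrix κ κ ℤ, W.det ≠ 0 ∧ Bd M (g * toR W) := by
  obtain ⟨b, hb, hspan, hli⟩ := exists_linearIndependent ℝ
    {v : κ → ℝ | ∃ w : κ → ℤ, v = vR w ∧ ∀ a, |(g *ᵥ vR w) a| ≤ M}
  rw [h] at hspan
  let bas := Module.Basis.mk hli (by rw [Subtype.range_coe, hspan])
  have hfin : Finite b := Module.Finite.finite_basis bas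
  have : Fintype b := Fintype.ofFinite b
  have hcard : Fintype.card κ = Fintype.card b := by
    rw [← Module.finrank_eq_card_basis bas, Module.finrank_fintype_fun_eq_card]
  let e := Fintype.equivOfCardEq hcard
  choose w hw using fun c : b => hb c.2
  refine ⟨of fun a c => w (e c) a, ?_, ?_⟩
  · intro h0
    have hli2 : LinearIndependent ℝ fun c => (e c : κ → ℝ) := hli.comp e e.injective
    have h1 : (toR (of fun a c => w (e c) a))ᵀ = of fun c => (e c : κ → ℝ) := by
      ext a c
      have := congrFun (hw (e a)).1 c
      simp only [transpose_apply, toR_apply, of_apply]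
      rw [this]; rfl
    have h2 : IsUnit (toR (of fun a c => w (e c) a))ᵀ := by
      rw [← Matrix.linearIndependent_rows_iff_isUnit, h1]
      exact hli2
    rw [Matrix.isUnit_iff_isUnit_det, det_transpose, det_toR, h0] at h2
    simp at h2
  · intro a c
    rw [mul_toR_col]
    exact (hw (e c)).2 a

lemma L5 (D δ : ℝ) (hD : 0 ≤ D) (hδ : 0 < δ) : ∃ M : ℝ, 1 ≤ M ∧ ∀ g : Matrix κ κ ℝ, g.det ≠ 0 → |g.det| ≤ D →
    (∀ w : κ → ℤ, w ≠ 0 → ∃ a, δ < |(g *ᵥ vR w) a|) → ∃ W : Matrix κ κ ℤ, W.det ≠ 0 ∧ Bd M (g * toR W) := by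
  set k : ℝ := (Fintype.card κ : ℝ) with hk
  have hk0 : 0 ≤ k := Nat.cast_nonneg _
  set ε : ℝ := δ / (k + 1) with hε
  have hε0 : 0 < ε := by positivity
  set A : ℝ := (D + 1) / ε ^ (Fintype.card κ - 1) with hA
  have hA0 : 0 < A := by positivity
  refine ⟨A + k * ε + δ + 1, by nlinarith [mul_nonneg hk0 hε0.le], fun g hg hgD hδg => exists_W g _ ?_⟩
  set M := A + k * ε + δ + 1 with hM
  by_contra hcon
  obtain ⟨ξ', hξ'0, hξ'⟩ := exists_functional hcon
  set η : κ → ℝ := ξ' ᵥ* g⁻¹ with hη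
  have hgu : IsUnit g.det := isUnit_iff_ne_zero.2 hg
  have hηg : ∀ v, η ⬝ᵥ (g *ᵥ v) = ξ' ⬝ᵥ v := by
    intro v
    rw [hη, dotProduct_mulVec, vecMul_vecMul, nonsing_inv_mul _ hgu, vecMul_one]
  have hη0 : η ≠ 0 := by
    intro h
    apply hξ'0
    ext a
    have := hηg (Pi.single a 1)
    rw [h] at this
    simpa using this.symm
  obtain ⟨a0, ha0⟩ := Function.ne_iff.1 hη0
  obtain ⟨a, -, ha⟩ := Finset.exists_max_image Finset.univ (fun b => |η b|) ⟨a0, Finset.mem_univ a0⟩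
  have hapos : 0 < |η a| := (abs_pos.2 (by simpa using ha0)).trans_le (ha a0 (Finset.mem_univ _))
  set ξ : κ → ℝ := fun b => η b / η a with hξ
  have hξa : ξ a = 1 := by simp only [hξ]; exact div_self (abs_pos.1 hapos)
  have hξ1 : ∀ b, |ξ b| ≤ 1 := fun b => by
    simp only [hξ]; rw [abs_div, div_le_one hapos]; exact ha b (Finset.mem_univ _)
  have hξg : ∀ v, ξ ⬝ᵥ (g *ᵥ v) = (ξ' ⬝ᵥ v) / η a := by
    intro v
    rw [← hηg]
    simp only [hξ, dotProduct, Finset.sum_div]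
    refine Finset.sum_congr rfl fun b _ => by ring
  set Q : Matrix κ κ ℝ := (1 : Matrix κ κ ℝ).updateRow a ξ with hQ
  have hQdet : Q.det = 1 := by
    have := det_updateRow_sum (1 : Matrix κ κ ℝ) a ξ
    have h2 : ∑ k, ξ k • (1 : Matrix κ κ ℝ) k = ξ := by
      ext b; simp [Finset.sum_apply, Matrix.one_apply]
    rw [h2] at this
    rw [hQ, this, hξa]; simp
  have hQa : ∀ x, (Q *ᵥ x) a = ξ ⬝ᵥ x := by
    intro x; simp [hQ, mulVec]
  have hQb : ∀ x b, b ≠ a → (Q *ᵥ x) b = x b := by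
    intro x b hb
    have : (Q *ᵥ x) b = ((1 : Matrix κ κ ℝ) *ᵥ x) b := by
      simp only [mulVec, hQ]; rw [updateRow_ne hb]
    rw [this, one_mulVec]
  obtain ⟨w, hw0, hw⟩ := minkowski_forms (Q * g) (by rw [det_mul, hQdet, one_mul]; exact hg)
    (fun b => if b = a then A else ε) (fun b => by split_ifs <;> positivity) (by
      rw [det_mul, hQdet, one_mul, ← Finset.mul_prod_erase _ _ (Finset.mem_univ a)]
      rw [if_pos rfl, Finset.prod_congr rfl (g := fun _ => ε) (fun b hb => if_neg (Finset.ne_of_mem_erase hb))]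
      rw [Finset.prod_const, Finset.card_erase_of_mem (Finset.mem_univ a), Finset.card_univ, hA,
        div_mul_cancel₀ _ (by positivity)]
      linarith)
  set x := g *ᵥ vR w with hx
  have hxb : ∀ b, b ≠ a → |x b| ≤ ε := by
    intro b hb
    have := hw b
    rw [← mulVec_mulVec, hQb _ b hb, if_neg hb] at this
    exact this
  have hdot : ξ ⬝ᵥ x = x a + ∑ b ∈ Finset.univ.erase a, ξ b * x b := by
    rw [dotProduct, ← Finset.add_sum_erase _ _ (Finset.mem_univ a), hξa, one_mul]
  have hrest : |∑ b ∈ Finset.univ.erase a, ξ b * x b| ≤ k * ε := by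
    refine (Finset.abs_sum_le_sum_abs _ _).trans ?_
    refine (Finset.sum_le_card_nsmul _ _ ε ?_).trans ?_
    · intro b hb
      rw [abs_mul]
      calc _ ≤ 1 * ε := mul_le_mul (hξ1 b) (hxb b (Finset.ne_of_mem_erase hb)) (abs_nonneg _) (by norm_num)
        _ = ε := one_mul _
    · rw [nsmul_eq_mul]
      gcongr
      rw [hk]
      exact_mod_cast Finset.card_le_univ _
  have hwa : |ξ ⬝ᵥ x| ≤ A := by
    have := hw a
    rwa [← mulVec_mulVec, hQa, if_pos rfl] at this
  have hkε : k * ε + ε = δ := by rw [hε]; field_simp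
  have hεδ : ε ≤ δ := by nlinarith [mul_nonneg hk0 hε0.le]
  have hkεδ : k * ε ≤ δ := by linarith
  have hxa : |x a| ≤ A + k * ε := by
    have : x a = ξ ⬝ᵥ x - ∑ b ∈ Finset.univ.erase a, ξ b * x b := by rw [hdot]; ring
    rw [this]
    exact (abs_sub _ _).trans (add_le_add hwa hrest)
  have hmem : vR w ∈ Submodule.span ℝ {v : κ → ℝ | ∃ w : κ → ℤ, v = vR w ∧ ∀ a, |(g *ᵥ vR w) a| ≤ M} := by
    apply Submodule.subset_span
    refine ⟨w, rfl, fun b => ?_⟩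
    by_cases hb : b = a
    · rw [hb, hM]; linarith [hxa]
    · have := hxb b hb
      rw [hM]; nlinarith [mul_nonneg hk0 hε0.le]
  have hzero : ξ ⬝ᵥ x = 0 := by rw [hx, hξg, hξ' _ hmem, zero_div]
  obtain ⟨b, hb⟩ := hδg w hw0
  by_cases hba : b = a
  · rw [hba] at hb
    have : x a = - ∑ b ∈ Finset.univ.erase a, ξ b * x b := by linarith [hdot]
    have h2 : |x a| ≤ k * ε := by rw [this, abs_neg]; exact hrest
    linarith [hx ▸ hb]
  · have := hxb b hba
    linarith

end L5
end KM

open MeasureTheory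
open scoped ENNReal
namespace KM
set_option linter.unusedSectionVars false
set_option linter.unusedSimpArgs false
set_option linter.unusedVariables false
open Matrix


section avg
variable {J K : Type*} [Fintype J] [DecidableEq J] [Fintype K] [DecidableEq K]

lemma lintegral_smul_comp {q : ℝ} (hq : q ≠ 0) (F : (J → ℝ) → ℝ≥0∞) (hF : Measurable F) :
    ∫⁻ n, F (q • n) = ENNReal.ofReal ((|q|⁻¹) ^ Fintype.card J) * ∫⁻ y, F y := by
  have h := Measure.map_addHaar_smul (volume : Measure (J → ℝ)) hq
  have h2 : ∫⁻ y, F y ∂(Measure.map (fun x => q • x) volume) = ∫⁻ n, F (q • n) :=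
    lintegral_map hF (measurable_const_smul q)
  rw [← h2]
  have h3 : Measure.map (fun x : J → ℝ => q • x) volume =
    ENNReal.ofReal |(q ^ Module.finrank ℝ (J → ℝ))⁻¹| • volume := h
  rw [h3, lintegral_smul_measure, Module.finrank_fintype_fun_eq_card, abs_inv, abs_pow, inv_pow, smul_eq_mul]

lemma count_le {A : Matrix J J ℝ} (hA : A ∈ Om 2) (R : ℕ) (hR : Fintype.card J * (2 * dC J 2 * 1) ≤ R)
    (q : ℤ) (hq : q ≠ 0) (z : J → ℝ) (ind : (J → ℤ) → ℝ≥0∞)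
    (hind : ∀ t, ind t ≤ 1) (hind0 : ∀ t, ind t ≠ 0 → (q : ℝ)⁻¹ • (z - A *ᵥ vR t) ∈ Set.Icc (0 : J → ℝ) 1) :
    ∑' t, ind t ≤ ((2 * R + 1) ^ Fintype.card J : ℕ) * ENNReal.ofReal (|(q : ℝ)| ^ Fintype.card J) := by
  by_cases h : ∃ t0, ind t0 ≠ 0
  swap
  · push Not at h
    simp [h]
  obtain ⟨t0, ht0⟩ := h
  have hqr : (q : ℝ) ≠ 0 := by exact_mod_cast hq
  have hqa : 0 < |(q : ℝ)| := abs_pos.2 hqr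
  set fs : Finset (J → ℤ) := Fintype.piFinset fun a => Finset.Icc (t0 a - R * |q|) (t0 a + R * |q|) with hfs
  have hsub : ∀ t, ind t ≠ 0 → t ∈ fs := by
    intro t ht
    rw [hfs, Fintype.mem_piFinset]
    intro a
    have h1 := hind0 t ht
    have h2 := hind0 t0 ht0
    have hbd : ∀ c, |(A *ᵥ vR (t - t0)) c| ≤ |(q : ℝ)| := by
      intro c
      have e : (A *ᵥ vR (t - t0)) c = q * (((q : ℝ)⁻¹ • (z - A *ᵥ vR t0)) c - ((q : ℝ)⁻¹ • (z - A *ᵥ vR t)) c) := by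
        have : vR (t - t0) = vR t - vR t0 := by ext b; simp [vR]
        rw [this, mulVec_sub]
        simp only [Pi.smul_apply, Pi.sub_apply, smul_eq_mul]
        field_simp
        ring
      rw [e, abs_mul]
      refine mul_le_of_le_one_right (abs_nonneg _) ?_
      have := h1.1 c; have := h1.2 c; have := h2.1 c; have := h2.2 c
      simp only [Pi.zero_apply, Pi.one_apply] at *
      rw [abs_le]; constructor <;> linarith
    have hinv := Om.inv (by norm_num : (1:ℝ) ≤ 2) hA
    have hdC := dC_pos (κ := J) (M := 2) (by norm_num)
    have h3 := hinv.mulVec (by positivity) hbd a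
    rw [mulVec_mulVec, nonsing_inv_mul _ (isUnit_iff_ne_zero.2 (Om.det_ne (by norm_num) hA)), one_mulVec] at h3
    have h4 : |(t a : ℝ) - t0 a| ≤ R * |(q : ℝ)| := by
      have : vR (t - t0) a = (t a : ℝ) - t0 a := by simp [vR]
      rw [this] at h3
      refine h3.trans ?_
      calc _ = (Fintype.card J * (2 * dC J 2 * 1)) * |(q : ℝ)| := by ring
        _ ≤ _ := by gcongr
    have h5 : |t a - t0 a| ≤ R * |q| := by exact_mod_cast h4
    rw [Finset.mem_Icc]
    have := abs_le.1 h5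
    constructor <;> linarith
  rw [tsum_eq_sum (s := fs) (fun t ht => by by_contra h; exact ht (hsub t h))]
  refine (Finset.sum_le_card_nsmul _ _ 1 (fun t _ => hind t)).trans ?_
  rw [nsmul_eq_mul, mul_one, hfs, Fintype.card_piFinset]
  have hc : ∀ a, (Finset.Icc (t0 a - R * |q|) (t0 a + R * |q|)).card = 2 * R * q.natAbs + 1 := by
    intro a
    rw [Int.card_Icc]
    have : (q.natAbs : ℤ) = |q| := by simp
    rw [show t0 a + R * |q| + 1 - (t0 a - R * |q|) = ((2 * R * q.natAbs + 1 : ℕ) : ℤ) by push_cast; ring]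
    exact Int.toNat_natCast _
  simp only [hc, Finset.prod_const, Finset.card_univ]
  have hq1 : 1 ≤ q.natAbs := Int.natAbs_pos.2 hq
  have hle : (2 * R * q.natAbs + 1) ^ Fintype.card J ≤ (2 * R + 1) ^ Fintype.card J * q.natAbs ^ Fintype.card J := by
    rw [← mul_pow]
    gcongr
    nlinarith
  have hqn : ENNReal.ofReal (|(q : ℝ)| ^ Fintype.card J) = ((q.natAbs ^ Fintype.card J : ℕ) : ℝ≥0∞) := by
    rw [← ENNReal.ofReal_natCast]
    congr 1
    push_cast
    rw [Nat.cast_natAbs]; simp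
  rw [hqn]
  exact_mod_cast hle

lemma cnt_avg : ∃ C : ℝ≥0∞, C ≠ ⊤ ∧ ∀ A ∈ (Om 2 : Set (Matrix J J ℝ)), ∀ q : ℤ, q ≠ 0 → ∀ c : J → ℝ,
    ∀ G : (J → ℝ) → ℝ≥0∞, Measurable G →
    ∑' t : J → ℤ, ∫⁻ n, (Set.Icc (0 : J → ℝ) 1).indicator (fun n => G (A *ᵥ vR t + c + (q : ℝ) • n)) n
      ≤ C * ∫⁻ y, G y := by
  obtain ⟨R, hR⟩ := exists_nat_ge ((Fintype.card J : ℝ) * (2 * dC J 2 * 1))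
  refine ⟨((2 * R + 1) ^ Fintype.card J : ℕ), ENNReal.natCast_ne_top _, fun A hA q hq c G hG => ?_⟩
  have hqr : (q : ℝ) ≠ 0 := by exact_mod_cast hq
  set ind : (J → ℤ) → (J → ℝ) → ℝ≥0∞ := fun t y =>
    (Set.Icc (0 : J → ℝ) 1).indicator 1 ((q : ℝ)⁻¹ • (y - (A *ᵥ vR t + c))) with hind
  have hindm : ∀ t, Measurable (ind t) := by
    intro t
    refine (measurable_one.indicator measurableSet_Icc).comp ?_
    exact (Measurable.sub_const (f := fun y : J → ℝ => y) measurable_id _).const_smul ((q : ℝ)⁻¹)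
  have h1 : ∀ t, ∫⁻ n, (Set.Icc (0 : J → ℝ) 1).indicator (fun n => G (A *ᵥ vR t + c + (q : ℝ) • n)) n =
      ENNReal.ofReal ((|(q : ℝ)|⁻¹) ^ Fintype.card J) * ∫⁻ y, ind t y * G y := by
    intro t
    have h2 := lintegral_smul_comp hqr (fun y => ind t ((A *ᵥ vR t + c) + y) * G ((A *ᵥ vR t + c) + y))
      (((hindm t).mul hG).comp (measurable_const_add _))
    rw [lintegral_add_left_eq_self (fun y => ind t y * G y)] at h2
    rw [← h2]
    refine lintegral_congr fun n => ?_
    have : ind t (A *ᵥ vR t + c + (q : ℝ) • n) = (Set.Icc (0 : J → ℝ) 1).indicator 1 n := by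
      simp only [hind]
      congr 1
      rw [add_sub_cancel_left, smul_smul, inv_mul_cancel₀ hqr, one_smul]
    rw [this]
    by_cases hn : n ∈ Set.Icc (0 : J → ℝ) 1
    · simp [Set.indicator_of_mem hn]
    · simp [Set.indicator_of_notMem hn]
  simp_rw [h1]
  rw [ENNReal.tsum_mul_left, ← lintegral_tsum (f := fun t y => ind t y * G y) (fun t => ((hindm t).mul hG).aemeasurable)]
  have h3 : ∀ y, ∑' t, ind t y * G y ≤ ((2 * R + 1) ^ Fintype.card J : ℕ) *
      ENNReal.ofReal (|(q : ℝ)| ^ Fintype.card J) * G y := by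
    intro y
    rw [ENNReal.tsum_mul_right]
    gcongr
    refine count_le hA R hR q hq (y - c) (fun t => ind t y) (fun t => ?_) (fun t ht => ?_)
    · simp only [hind]
      exact Set.indicator_le_self' (fun _ _ => zero_le) _ |>.trans (by simp)
    · simp only [hind] at ht
      have := Set.mem_of_indicator_ne_zero ht
      rwa [show y - c - A *ᵥ vR t = y - (A *ᵥ vR t + c) by abel]
  calc _ ≤ ENNReal.ofReal ((|(q : ℝ)|⁻¹) ^ Fintype.card J) * ∫⁻ y, ((2 * R + 1) ^ Fintype.card J : ℕ) *
      ENNReal.ofReal (|(q : ℝ)| ^ Fintype.card J) * G y := by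
        gcongr with y; exact h3 y
    _ = ((2 * R + 1) ^ Fintype.card J : ℕ) * (ENNReal.ofReal ((|(q : ℝ)|⁻¹) ^ Fintype.card J) *
      ENNReal.ofReal (|(q : ℝ)| ^ Fintype.card J)) * ∫⁻ y, G y := by
        rw [lintegral_const_mul _ hG]; ring
    _ = _ := by
        rw [← ENNReal.ofReal_mul (by positivity), ← mul_pow, inv_mul_cancel₀ (abs_pos.2 hqr).ne']
        simp

lemma meas_mulVec_const {l : Type*} [Fintype l] [DecidableEq l] (v : l → ℝ) : Measurable fun N : Matrix J l ℝ => N *ᵥ v := by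
  rw [measurable_pi_iff]
  intro a
  simp only [mulVec, dotProduct]
  exact Finset.measurable_sum _ fun c _ => ((continuous_elem a c).measurable).mul_const _

lemma avg : ∃ C : ℝ≥0∞, C ≠ ⊤ ∧ ∀ A ∈ (Om 2 : Set (Matrix J J ℝ)), ∀ τ : K → ℤ, τ ≠ 0 →
    ∀ G : (J → ℝ) → ℝ≥0∞, Measurable G →
    ∑' t : J → ℤ, ∫⁻ N : Matrix J K ℝ, {N : Matrix J K ℝ | Bd 1 N}.indicator (fun N => G (A *ᵥ vR t + N *ᵥ vR τ)) N
      ≤ C * ∫⁻ y, G y := by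
  obtain ⟨C, hC, H⟩ := cnt_avg (J := J)
  refine ⟨volume {N : Matrix J K ℝ | Bd 2 N} * C, ENNReal.mul_ne_top (vol_Bd_lt_top 2).ne hC, fun A hA τ hτ G hG => ?_⟩
  obtain ⟨b, hb⟩ := Function.ne_iff.1 hτ
  have hb' : τ b ≠ 0 := by simpa using hb
  have hm2 : MeasurableSet {N : Matrix J K ℝ | Bd 2 N} := (isClosed_Bd 2).measurableSet
  have hmI : MeasurableSet (Set.Icc (0 : J → ℝ) 1) := measurableSet_Icc
  have hGm : ∀ t : J → ℤ, Measurable fun x : (J → ℝ) × Matrix J K ℝ => G (A *ᵥ vR t + x.2 *ᵥ vR τ + (τ b : ℝ) • x.1) := by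
    intro t
    refine hG.comp (Measurable.add (Measurable.add measurable_const ((meas_mulVec_const (vR τ)).comp measurable_snd))
      (measurable_fst.const_smul (τ b : ℝ)))
  have hvI : volume (Set.Icc (0 : J → ℝ) 1) = 1 := by
    rw [Real.volume_Icc_pi]; simp
  set Φ : (J → ℤ) → (J → ℝ) × Matrix J K ℝ → ℝ≥0∞ := fun t x =>
    (Set.Icc (0 : J → ℝ) 1 ×ˢ {N : Matrix J K ℝ | Bd 2 N}).indicator
      (fun x => G (A *ᵥ vR t + x.2 *ᵥ vR τ + (τ b : ℝ) • x.1)) x with hΦ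
  have hΦm : ∀ t, Measurable (Φ t) := fun t => (hGm t).indicator (hmI.prod hm2)
  have step1 : ∀ t : J → ℤ, ∫⁻ N : Matrix J K ℝ, {N : Matrix J K ℝ | Bd 1 N}.indicator (fun N => G (A *ᵥ vR t + N *ᵥ vR τ)) N
      ≤ ∫⁻ n : J → ℝ, ∫⁻ N : Matrix J K ℝ, Φ t (n, N) := by
    intro t
    have h1 : ∀ n ∈ Set.Icc (0 : J → ℝ) 1,
        ∫⁻ N : Matrix J K ℝ, {N : Matrix J K ℝ | Bd 1 N}.indicator (fun N => G (A *ᵥ vR t + N *ᵥ vR τ)) N ≤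
        ∫⁻ N : Matrix J K ℝ, Φ t (n, N) := by
      intro n hn
      set E : Matrix J K ℝ := of fun a c => if c = b then n a else 0 with hE
      rw [← lintegral_add_right_eq_self _ E]
      refine lintegral_mono fun N => ?_
      by_cases hN : N + E ∈ {N : Matrix J K ℝ | Bd 1 N}
      · rw [Set.indicator_of_mem hN]
        have hEB : Bd 1 E := by
          intro a c
          simp only [hE, of_apply]
          split_ifs
          · have h1 := hn.1 a; have h2 := hn.2 a
            simp only [Pi.zero_apply, Pi.one_apply] at h1 h2
            rw [abs_le]; constructor <;> linarith
          · simp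
        have hN2 : (n, N) ∈ (Set.Icc (0 : J → ℝ) 1 ×ˢ {N : Matrix J K ℝ | Bd 2 N}) := by
          refine ⟨hn, fun a c => ?_⟩
          have h1 := abs_le.1 (hN a c)
          have h2 := abs_le.1 (hEB a c)
          rw [Matrix.add_apply] at h1
          rw [abs_le]; constructor <;> linarith
        simp only [hΦ]
        rw [Set.indicator_of_mem hN2]
        apply le_of_eq
        congr 1
        have : E *ᵥ vR τ = (τ b : ℝ) • n := by
          ext a
          simp [hE, mulVec, dotProduct, vR, mul_comm]
        rw [Matrix.add_mulVec, this, add_assoc]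
      · rw [Set.indicator_of_notMem hN]; exact zero_le
    calc _ = ∫⁻ n : J → ℝ, (Set.Icc (0 : J → ℝ) 1).indicator (fun _ => ∫⁻ N : Matrix J K ℝ, {N : Matrix J K ℝ | Bd 1 N}.indicator (fun N => G (A *ᵥ vR t + N *ᵥ vR τ)) N) n := by
          rw [lintegral_indicator_const hmI, hvI, mul_one]
      _ ≤ _ := by
          refine lintegral_mono fun n => ?_
          by_cases hn : n ∈ Set.Icc (0 : J → ℝ) 1
          · rw [Set.indicator_of_mem hn]; exact h1 n hn
          · rw [Set.indicator_of_notMem hn]; exact zero_le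
  calc _ ≤ ∑' t : J → ℤ, ∫⁻ n : J → ℝ, ∫⁻ N : Matrix J K ℝ, Φ t (n, N) := ENNReal.tsum_le_tsum step1
    _ = ∑' t : J → ℤ, ∫⁻ N : Matrix J K ℝ, ∫⁻ n : J → ℝ, Φ t (n, N) := by
        congr 1; ext t
        exact lintegral_lintegral_swap (f := fun n N => Φ t (n, N)) (hΦm t).aemeasurable
    _ = ∫⁻ N : Matrix J K ℝ, ∑' t : J → ℤ, ∫⁻ n : J → ℝ, Φ t (n, N) := by
        rw [lintegral_tsum]
        exact fun t => (hΦm t).lintegral_prod_left'.aemeasurable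
    _ ≤ ∫⁻ N : Matrix J K ℝ, {N : Matrix J K ℝ | Bd 2 N}.indicator (fun _ => C * ∫⁻ y, G y) N := by
        refine lintegral_mono fun N => ?_
        by_cases hN : N ∈ {N : Matrix J K ℝ | Bd 2 N}
        · rw [Set.indicator_of_mem hN]
          refine le_trans (le_of_eq ?_) (H A hA (τ b) hb' (N *ᵥ vR τ) G hG)
          congr 1; ext t
          refine lintegral_congr fun n => ?_
          simp only [hΦ]
          by_cases hn : n ∈ Set.Icc (0 : J → ℝ) 1
          · rw [Set.indicator_of_mem hn, Set.indicator_of_mem (Set.mk_mem_prod hn hN)]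
          · rw [Set.indicator_of_notMem hn, Set.indicator_of_notMem (fun h => hn h.1)]
        · rw [Set.indicator_of_notMem hN]
          have : ∀ t n, Φ t (n, N) = 0 := fun t n => Set.indicator_of_notMem (fun h => hN h.2) _
          simp [this]
    _ = _ := by rw [lintegral_indicator_const hm2]; ring

end avg
end KM

open MeasureTheory
open scoped ENNReal
namespace KM
set_option linter.unusedSectionVars false
set_option linter.unusedSimpArgs false
set_option linter.unusedVariables false
open Matrix

section ee
variable {J K : Type*} [Fintype J] [Fintype K] [DecidableEq J] [DecidableEq K]

/-- parametrisation of matrices whose first columns are short -/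
def Phi (r ρ : ℝ) (p : Matrix J J ℝ × Matrix K J ℝ × Matrix J K ℝ × Matrix K K ℝ) :
    Matrix (J ⊕ K) (J ⊕ K) ℝ :=
  fromBlocks (r • p.1) (r • (p.1 * p.2.2.1)) (r • p.2.1) (r • (p.2.1 * p.2.2.1) + ρ • p.2.2.2)

def PP : Set (Matrix J J ℝ × Matrix K J ℝ × Matrix J K ℝ × Matrix K K ℝ) :=
  (Om 2) ×ˢ ({C | Bd 1 C} ×ˢ ({X | Bd 1 X} ×ˢ (Om 2)))

noncomputable def mu0 : Measure (Matrix J J ℝ × Matrix K J ℝ × Matrix J K ℝ × Matrix K K ℝ) :=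
  (volume.restrict (Om 2)).prod ((volume.restrict {C | Bd 1 C}).prod
    ((volume.restrict {X | Bd 1 X}).prod (volume.restrict (Om 2))))

lemma continuous_Phi (r ρ : ℝ) : Continuous (Phi r ρ : _ → Matrix (J ⊕ K) (J ⊕ K) ℝ) := by
  unfold Phi
  refine Continuous.matrix_fromBlocks ?_ ?_ ?_ ?_
  · exact continuous_fst.const_smul r
  · exact (continuous_fst.matrix_mul (continuous_fst.comp (continuous_snd.comp continuous_snd))).const_smul r
  · exact (continuous_fst.comp continuous_snd).const_smul r
  · exact (((continuous_fst.comp continuous_snd).matrix_mul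
      (continuous_fst.comp (continuous_snd.comp continuous_snd))).const_smul r).add
      ((continuous_snd.comp (continuous_snd.comp continuous_snd)).const_smul ρ)

lemma isCompact_Bd {κ l : Type*} [Fintype κ] [Fintype l] [DecidableEq κ] [DecidableEq l] (M : ℝ) :
    IsCompact {g : Matrix κ l ℝ | Bd M g} := by
  rw [Bd_eq_box]
  have : IsCompact (Set.univ.pi fun (_ : κ) => Set.univ.pi fun (_ : l) => Set.Icc (-M) M) :=
    isCompact_univ_pi fun a => isCompact_univ_pi fun b => isCompact_Icc
  convert! this using 1
  ext g
  simp only [Set.mem_ofPred_eq]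
  exact ⟨fun h a _ b _ => h a b, fun h a b => h a trivial b trivial⟩

lemma isCompact_Om {κ : Type*} [Fintype κ] [DecidableEq κ] (M : ℝ) :
    IsCompact (Om M : Set (Matrix κ κ ℝ)) :=
  (isCompact_Bd M).of_isClosed_subset (isClosed_Om M) fun g hg => hg.1

lemma isCompact_PP : IsCompact (PP : Set (Matrix J J ℝ × Matrix K J ℝ × Matrix J K ℝ × Matrix K K ℝ)) :=
  (isCompact_Om 2).prod ((isCompact_Bd 1).prod ((isCompact_Bd 1).prod (isCompact_Om 2)))

def EE (r ρ : ℝ) : Set (Matrix (J ⊕ K) (J ⊕ K) ℝ) := Phi r ρ '' PP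

lemma measurableSet_EE (r ρ : ℝ) : MeasurableSet (EE r ρ : Set (Matrix (J ⊕ K) (J ⊕ K) ℝ)) :=
  (isCompact_PP.image (continuous_Phi r ρ)).isClosed.measurableSet

lemma mu0_eq : (mu0 : Measure (Matrix J J ℝ × Matrix K J ℝ × Matrix J K ℝ × Matrix K K ℝ)) =
    volume.restrict PP := by
  unfold mu0 PP
  rw [Measure.prod_restrict, Measure.prod_restrict, Measure.prod_restrict]
  rfl

noncomputable def nu (r ρ : ℝ) : Measure (Matrix (J ⊕ K) (J ⊕ K) ℝ) := Measure.map (Phi r ρ) mu0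

lemma nu_apply (r ρ : ℝ) (S : Set (Matrix (J ⊕ K) (J ⊕ K) ℝ)) (hS : MeasurableSet S) :
    nu r ρ S = ∫⁻ A in (Om 2 : Set (Matrix J J ℝ)), ∫⁻ C in {C : Matrix K J ℝ | Bd 1 C},
      ∫⁻ X in {X : Matrix J K ℝ | Bd 1 X}, ∫⁻ Z in (Om 2 : Set (Matrix K K ℝ)),
        S.indicator 1 (Phi r ρ (A, C, X, Z)) := by
  have hm : Measurable (fun p => S.indicator (1 : Matrix (J ⊕ K) (J ⊕ K) ℝ → ℝ≥0∞) (Phi r ρ p)) :=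
    (measurable_one.indicator hS).comp (continuous_Phi r ρ).measurable
  have h1 : nu r ρ S = ∫⁻ p, S.indicator 1 (Phi r ρ p) ∂mu0 := by
    rw [nu, ← lintegral_indicator_one hS, lintegral_map (measurable_one.indicator hS) (continuous_Phi r ρ).measurable]
  rw [h1, mu0, lintegral_prod _ hm.aemeasurable]
  refine lintegral_congr fun A => ?_
  have hm2 := hm.comp (measurable_prodMk_left (x := A))
  simp only [Function.comp_def] at hm2
  rw [lintegral_prod _ hm2.aemeasurable]
  refine lintegral_congr fun C => ?_
  have hm3 := hm2.comp (measurable_prodMk_left (x := C))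
  simp only [Function.comp_def] at hm3
  rw [lintegral_prod _ hm3.aemeasurable]

lemma nu_univ (r ρ : ℝ) : nu r ρ (Set.univ : Set (Matrix (J ⊕ K) (J ⊕ K) ℝ)) =
    volume (Om 2 : Set (Matrix J J ℝ)) * (volume {C : Matrix K J ℝ | Bd 1 C} *
      (volume {X : Matrix J K ℝ | Bd 1 X} * volume (Om 2 : Set (Matrix K K ℝ)))) := by
  rw [nu, Measure.map_apply (continuous_Phi r ρ).measurable MeasurableSet.univ, mu0_eq, Set.preimage_univ, 
    Measure.restrict_apply_univ, PP]
  change (volume.prod (volume.prod (volume.prod volume))) _ = _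
  rw [Measure.prod_prod, Measure.prod_prod, Measure.prod_prod]

lemma nu_EE_compl (r ρ : ℝ) : nu r ρ (EE r ρ : Set (Matrix (J ⊕ K) (J ⊕ K) ℝ))ᶜ = 0 := by
  rw [nu, Measure.map_apply (continuous_Phi r ρ).measurable (measurableSet_EE r ρ).compl, mu0_eq,
    Measure.restrict_apply ((measurableSet_EE r ρ).compl.preimage (continuous_Phi r ρ).measurable)]
  convert! measure_empty (μ := volume)
  ext p
  simp only [Set.mem_inter_iff, Set.mem_preimage, Set.mem_compl_iff, Set.mem_empty_iff_false, iff_false, not_and, EE]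
  intro h1 h2
  exact h1 ⟨p, h2, rfl⟩

lemma lintegral_smul_mat {κ l : Type*} [Fintype κ] [Fintype l] [DecidableEq κ] [DecidableEq l]
    {r : ℝ} (hr : 0 < r) (F : Matrix κ l ℝ → ℝ≥0∞) (hF : Measurable F) :
    ∫⁻ h : Matrix κ l ℝ, F (r • h) = ENNReal.ofReal ((r⁻¹) ^ (Fintype.card κ * Fintype.card l)) *
      ∫⁻ h : Matrix κ l ℝ, F h := by
  have hd : (r • (1 : Matrix κ κ ℝ)).det = r ^ Fintype.card κ := by simp
  have := lintegral_mul_left (l := l) (r • (1 : Matrix κ κ ℝ)) (by rw [hd]; positivity) F hF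
  rw [hd, abs_of_pos (by positivity), ← inv_pow, ← pow_mul] at this
  rw [← this]
  simp

lemma nu_le {r ρ : ℝ} (hr : 0 < r) (hρ : 0 < ρ) (hrρ : r ^ Fintype.card J * ρ ^ Fintype.card K = 1)
    (S : Set (Matrix (J ⊕ K) (J ⊕ K) ℝ)) (hS : MeasurableSet S) :
    ENNReal.ofReal (r ^ (Fintype.card J * Fintype.card (J ⊕ K))) * nu r ρ S ≤ 
      ENNReal.ofReal (2 ^ Fintype.card K) * volume S := by
  set F : Matrix (J ⊕ K) (J ⊕ K) ℝ → ℝ≥0∞ := S.indicator 1 with hF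
  have hFm : Measurable F := measurable_one.indicator hS
  set j := Fintype.card J
  set k := Fintype.card K
  have e1 : volume S = ∫⁻ A : Matrix J J ℝ, ∫⁻ C : Matrix K J ℝ, ∫⁻ N : Matrix J K ℝ, ∫⁻ Z : Matrix K K ℝ,
      F (fromBlocks A N C Z) := by
    rw [← lintegral_blk F hFm, hF, lintegral_indicator_one hS]
  -- measurability of partial integrals
  have m1 : ∀ (A : Matrix J J ℝ) (C : Matrix K J ℝ) (N : Matrix J K ℝ), Measurable fun Z : Matrix K K ℝ => F (fromBlocks A N C Z) :=
    fun A C N => hFm.comp (meas_blk measurable_const measurable_const measurable_const measurable_id)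
  have m2 : ∀ (A : Matrix J J ℝ) (C : Matrix K J ℝ), Measurable fun N : Matrix J K ℝ => ∫⁻ Z : Matrix K K ℝ, F (fromBlocks A N C Z) :=
    fun A C => Measurable.lintegral_prod_right' (f := fun p : Matrix J K ℝ × Matrix K K ℝ => F (fromBlocks A p.1 C p.2)) 
      (hFm.comp (meas_blk measurable_const measurable_fst measurable_const measurable_snd))
  have m3 : ∀ (A : Matrix J J ℝ), Measurable fun C : Matrix K J ℝ => ∫⁻ N : Matrix J K ℝ, ∫⁻ Z : Matrix K K ℝ, F (fromBlocks A N C Z) := by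
    intro A
    refine Measurable.lintegral_prod_right' (f := fun p : Matrix K J ℝ × Matrix J K ℝ => ∫⁻ Z : Matrix K K ℝ, F (fromBlocks A p.2 p.1 Z)) ?_
    exact Measurable.lintegral_prod_right' (f := fun p : (Matrix K J ℝ × Matrix J K ℝ) × Matrix K K ℝ => F (fromBlocks A p.1.2 p.1.1 p.2)) 
      (hFm.comp (meas_blk measurable_const (measurable_snd.comp measurable_fst) (measurable_fst.comp measurable_fst) measurable_snd))
  have m4 : Measurable fun A : Matrix J J ℝ => ∫⁻ C : Matrix K J ℝ, ∫⁻ N : Matrix J K ℝ, ∫⁻ Z : Matrix K K ℝ, F (fromBlocks A N C Z) := by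
    refine Measurable.lintegral_prod_right' (f := fun p : Matrix J J ℝ × Matrix K J ℝ => ∫⁻ N : Matrix J K ℝ, ∫⁻ Z : Matrix K K ℝ, F (fromBlocks p.1 N p.2 Z)) ?_
    refine Measurable.lintegral_prod_right' (f := fun p : (Matrix J J ℝ × Matrix K J ℝ) × Matrix J K ℝ => ∫⁻ Z : Matrix K K ℝ, F (fromBlocks p.1.1 p.2 p.1.2 Z)) ?_
    exact Measurable.lintegral_prod_right' (f := fun p : ((Matrix J J ℝ × Matrix K J ℝ) × Matrix J K ℝ) × Matrix K K ℝ => F (fromBlocks p.1.1.1 p.1.2 p.1.1.2 p.2)) 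
      (hFm.comp (meas_blk (measurable_fst.comp (measurable_fst.comp measurable_fst)) (measurable_snd.comp measurable_fst) (measurable_snd.comp (measurable_fst.comp measurable_fst)) measurable_snd))
  -- innermost
  have s1 : ∀ A C X, ∫⁻ Z in (Om 2 : Set (Matrix K K ℝ)), F (Phi r ρ (A, C, X, Z)) ≤
      ENNReal.ofReal ((ρ⁻¹) ^ (k * k)) * ∫⁻ Z : Matrix K K ℝ, F (fromBlocks (r • A) (r • (A * X)) (r • C) Z) := by
    intro A C X
    refine (setLIntegral_le_lintegral _ _).trans (le_of_eq ?_)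
    rw [← lintegral_add_left_eq_self (fun Z => F (fromBlocks (r • A) (r • (A * X)) (r • C) Z)) (r • (C * X)),
      ← lintegral_smul_mat hρ (fun Z => F (fromBlocks (r • A) (r • (A * X)) (r • C) (r • (C * X) + Z)))]
    · rfl
    · exact (m1 _ _ _).comp (measurable_const_add _)
  have s2 : ∀ A ∈ (Om 2 : Set (Matrix J J ℝ)), ∀ C : Matrix K J ℝ, ∫⁻ X in {X : Matrix J K ℝ | Bd 1 X}, 
      ∫⁻ Z in (Om 2 : Set (Matrix K K ℝ)), F (Phi r ρ (A, C, X, Z)) ≤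
      ENNReal.ofReal ((ρ⁻¹) ^ (k * k)) * (ENNReal.ofReal ((2 * r⁻¹ ^ j) ^ k) * 
        ∫⁻ N : Matrix J K ℝ, ∫⁻ Z : Matrix K K ℝ, F (fromBlocks (r • A) N (r • C) Z)) := by
    intro A hA C
    have hd : (r • A).det ≠ 0 := by
      rw [det_smul]; exact mul_ne_zero (by positivity) (Om.det_ne two_pos hA)
    have := lintegral_mul_left (l := K) (r • A) hd _ (m2 (r • A) (r • C))
    refine (setLIntegral_le_lintegral _ _).trans ?_
    refine (lintegral_mono fun X => s1 A C X).trans ?_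
    rw [lintegral_const_mul' _ _ ENNReal.ofReal_ne_top]
    gcongr
    simp only [Matrix.smul_mul] at this
    rw [this]
    gcongr
    rw [det_smul, abs_mul, mul_inv, abs_of_pos (by positivity), mul_comm, ← inv_pow]
    gcongr
    exact (inv_le_comm₀ (by norm_num) (abs_pos.2 (Om.det_ne two_pos hA))).1 hA.2
  have s3 : ∀ A ∈ (Om 2 : Set (Matrix J J ℝ)), ∫⁻ C in {C : Matrix K J ℝ | Bd 1 C}, ∫⁻ X in {X : Matrix J K ℝ | Bd 1 X}, 
      ∫⁻ Z in (Om 2 : Set (Matrix K K ℝ)), F (Phi r ρ (A, C, X, Z)) ≤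
      ENNReal.ofReal ((ρ⁻¹) ^ (k * k)) * (ENNReal.ofReal ((2 * r⁻¹ ^ j) ^ k) * (ENNReal.ofReal ((r⁻¹) ^ (k * j)) *
        ∫⁻ C : Matrix K J ℝ, ∫⁻ N : Matrix J K ℝ, ∫⁻ Z : Matrix K K ℝ, F (fromBlocks (r • A) N C Z))) := by
    intro A hA
    refine (setLIntegral_le_lintegral _ _).trans ?_
    refine (lintegral_mono fun C => s2 A hA C).trans ?_
    rw [lintegral_const_mul' _ _ ENNReal.ofReal_ne_top, lintegral_const_mul' _ _ ENNReal.ofReal_ne_top,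
      lintegral_smul_mat hr _ (m3 _)]
  have s4 : nu r ρ S ≤ ENNReal.ofReal ((ρ⁻¹) ^ (k * k)) * (ENNReal.ofReal ((2 * r⁻¹ ^ j) ^ k) * (ENNReal.ofReal ((r⁻¹) ^ (k * j)) *
     (ENNReal.ofReal ((r⁻¹) ^ (j * j)) * volume S))) := by
    rw [nu_apply r ρ S hS]
    refine (setLIntegral_mono' (measurableSet_Om 2) fun A hA => s3 A hA).trans ?_
    refine (setLIntegral_le_lintegral _ _).trans ?_
    rw [lintegral_const_mul' _ _ ENNReal.ofReal_ne_top, lintegral_const_mul' _ _ ENNReal.ofReal_ne_top,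
      lintegral_const_mul' _ _ ENNReal.ofReal_ne_top, lintegral_smul_mat hr _ m4, e1]
  refine (mul_le_mul_right s4 _).trans (le_of_eq ?_)
  simp only [← mul_assoc]
  rw [← ENNReal.ofReal_mul (by positivity), ← ENNReal.ofReal_mul (by positivity),
    ← ENNReal.ofReal_mul (by positivity), ← ENNReal.ofReal_mul (by positivity)]
  congr 2
  have hcard : Fintype.card (J ⊕ K) = j + k := Fintype.card_sum
  rw [hcard]
  have hρk : (ρ⁻¹) ^ (k * k) = r ^ (j * k) := by
    rw [pow_mul, pow_mul, inv_pow, eq_comm]; congr 1; exact eq_inv_of_mul_eq_one_left hrρ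
  rw [hρk, mul_pow, ← pow_mul]
  have h1 : r ^ (j * (j + k)) * r ^ (j * k) * (2 ^ k * r⁻¹ ^ (j * k)) * r⁻¹ ^ (k * j) * r⁻¹ ^ (j * j) =
    2 ^ k * ((r * r⁻¹) ^ (j * j) * (r * r⁻¹) ^ (j * k) * (r * r⁻¹) ^ (j * k)) := by
    simp only [mul_pow]; ring
  rw [h1, mul_inv_cancel₀ hr.ne']; simp
end ee
end KM

open MeasureTheory
open scoped ENNReal
namespace KM
set_option linter.unusedSectionVars false
set_option linter.unusedSimpArgs false
set_option linter.unusedVariables false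
open Matrix

section bad2
variable {J K : Type*} [Fintype J] [Fintype K] [DecidableEq J] [DecidableEq K]

def badS {κ : Type*} [Fintype κ] (β : κ → ℝ) : Set (Matrix κ κ ℝ) :=
  {h | ∃ w : κ → ℤ, w ≠ 0 ∧ ∀ a, |(h *ᵥ vR w) a| ≤ β a}

lemma measurableSet_one {κ : Type*} [Fintype κ] [DecidableEq κ] (β : κ → ℝ) (w : κ → ℤ) :
    MeasurableSet {h : Matrix κ κ ℝ | ∀ a, |(h *ᵥ vR w) a| ≤ β a} := by
  rw [Set.ofPred_forall]
  exact (isClosed_iInter fun a => isClosed_le (continuous_mulVec _ a).abs continuous_const).measurableSet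

lemma measurableSet_exone {κ : Type*} [Fintype κ] [DecidableEq κ] (β : κ → ℝ) (P : (κ → ℤ) → Prop) :
    MeasurableSet {h : Matrix κ κ ℝ | ∃ w : κ → ℤ, P w ∧ ∀ a, |(h *ᵥ vR w) a| ≤ β a} := by
  have : {h : Matrix κ κ ℝ | ∃ w : κ → ℤ, P w ∧ ∀ a, |(h *ᵥ vR w) a| ≤ β a} =
      ⋃ w : {w : κ → ℤ // P w}, {h | ∀ a, |(h *ᵥ vR w.1) a| ≤ β a} := by
    ext h; simp
  rw [this]
  exact MeasurableSet.iUnion fun w => measurableSet_one β w.1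

lemma measurableSet_badS {κ : Type*} [Fintype κ] [DecidableEq κ] (β : κ → ℝ) : MeasurableSet (badS β) :=
  measurableSet_exone β _

lemma vR_elim (t : J → ℤ) (τ : K → ℤ) : vR (Sum.elim t τ) = Sum.elim (vR t) (vR τ) := by
  ext a; rcases a with a | a <;> rfl

lemma Phi_mulVec (r ρ : ℝ) (A : Matrix J J ℝ) (C : Matrix K J ℝ) (X : Matrix J K ℝ) (Z : Matrix K K ℝ)
    (t : J → ℤ) (τ : K → ℤ) : Phi r ρ (A, C, X, Z) *ᵥ vR (Sum.elim t τ) =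
      Sum.elim (r • (A *ᵥ (vR t + X *ᵥ vR τ))) (r • (C *ᵥ (vR t + X *ᵥ vR τ)) + ρ • (Z *ᵥ vR τ)) := by
  rw [vR_elim, Phi, fromBlocks_mulVec]
  congr 1
  · simp [smul_mulVec, mulVec_add, mulVec_mulVec]
  · simp [smul_mulVec, mulVec_add, mulVec_mulVec, add_mulVec, add_assoc]

lemma vol_preim (A : Matrix J J ℝ) (hA : A ∈ Om 2) {r : ℝ} (hr : 0 < r) (β : J → ℝ) (hβ : ∀ a, 0 ≤ β a) :
    volume {x : J → ℝ | ∀ a, |(r • (A *ᵥ x)) a| ≤ β a} ≤ ENNReal.ofReal (2 * ∏ a, (2 * β a / r)) := by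
  have hd : LinearMap.det (toLin' A) ≠ 0 := by rw [LinearMap.det_toLin']; exact Om.det_ne two_pos hA
  have h1 : {x : J → ℝ | ∀ a, |(r • (A *ᵥ x)) a| ≤ β a} = (toLin' A) ⁻¹' (Set.univ.pi fun a => Set.Icc (-(β a / r)) (β a / r)) := by
    ext x
    simp only [Set.mem_ofPred_eq, Set.mem_preimage, Set.mem_pi, Set.mem_univ, true_imp_iff, toLin'_apply, Set.mem_Icc, ← abs_le,
      Pi.smul_apply, smul_eq_mul, abs_mul, abs_of_pos hr]
    refine forall_congr' fun a => ?_
    rw [le_div_iff₀ hr, mul_comm]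
  rw [h1, Measure.addHaar_preimage_linearMap volume hd, volume_pi_pi, LinearMap.det_toLin', 
    ENNReal.ofReal_mul (by norm_num), ENNReal.ofReal_prod_of_nonneg (fun a _ => by have := hβ a; positivity)]
  gcongr with a
  · rw [abs_inv]
    exact (inv_le_comm₀ (by norm_num) (abs_pos.2 (Om.det_ne two_pos hA))).1 hA.2
  · rw [Real.volume_Icc]; apply le_of_eq; congr 1; ring

def bad2 (β : J ⊕ K → ℝ) : Set (Matrix (J ⊕ K) (J ⊕ K) ℝ) :=
  {h | ∃ w : J ⊕ K → ℤ, w ∘ Sum.inr ≠ 0 ∧ ∀ a, |(h *ᵥ vR w) a| ≤ β a}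

lemma nu_bad2 : ∃ Cst : ℝ, 0 ≤ Cst ∧ ∀ r ρ : ℝ, 0 < r → 0 < ρ → r ^ Fintype.card J * ρ ^ Fintype.card K = 1 →
    ∀ β : J ⊕ K → ℝ, (∀ a, 0 ≤ β a) → nu r ρ (bad2 β) ≤ ENNReal.ofReal (Cst * ∏ a, β a) := by
  obtain ⟨C1, hC1, havg⟩ := avg (J := J) (K := K)
  obtain ⟨C3, hC3, hL3⟩ := L3' (κ := K) (2 : ℝ) (by norm_num)
  set V1 := volume (Om 2 : Set (Matrix J J ℝ))
  set V2 := volume {C : Matrix K J ℝ | Bd 1 C}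
  have hV1 : V1 ≠ ⊤ := (vol_Om_lt_top 2).ne
  have hV2 : V2 ≠ ⊤ := (vol_Bd_lt_top 1).ne
  refine ⟨V2.toReal * V1.toReal * (C1.toReal * (C3 * (2 * 2 ^ Fintype.card J))), by positivity, ?_⟩
  intro r ρ hr hρ hrρ β hβ
  have hm := measurableSet_exone β (fun w : J ⊕ K → ℤ => w ∘ Sum.inr ≠ 0)
  change MeasurableSet (bad2 β) at hm
  have key : ∀ A ∈ (Om 2 : Set (Matrix J J ℝ)), ∀ C : Matrix K J ℝ,
      ∫⁻ X in {X : Matrix J K ℝ | Bd 1 X}, ∫⁻ Z in (Om 2 : Set (Matrix K K ℝ)),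
        (bad2 β).indicator 1 (Phi r ρ (A, C, X, Z)) ≤ C1 * ENNReal.ofReal (C3 * (2 * 2 ^ Fintype.card J) * ∏ a, β a) := by
    intro A hA C
    set S : (K → ℤ) → Set ((J → ℝ) × Matrix K K ℝ) := fun τ => {p | (∀ a, |(r • (A *ᵥ p.1)) a| ≤ β (Sum.inl a)) ∧
      ∀ b, |(r • (C *ᵥ p.1) + ρ • (p.2 *ᵥ vR τ)) b| ≤ β (Sum.inr b)} with hS
    have hSm : ∀ τ, MeasurableSet (S τ) := by
      intro τ
      have hA' : Continuous fun p : (J → ℝ) × Matrix K K ℝ => r • (A *ᵥ p.1) :=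
        (Continuous.matrix_mulVec continuous_const continuous_fst).const_smul r
      have hC' : Continuous fun p : (J → ℝ) × Matrix K K ℝ => r • (C *ᵥ p.1) + ρ • (p.2 *ᵥ vR τ) :=
        ((Continuous.matrix_mulVec continuous_const continuous_fst).const_smul r).add
          ((Continuous.matrix_mulVec continuous_snd continuous_const).const_smul ρ)
      have h1 : IsClosed {p : (J → ℝ) × Matrix K K ℝ | ∀ a, |(r • (A *ᵥ p.1)) a| ≤ β (Sum.inl a)} := by
        rw [Set.ofPred_forall]
        exact isClosed_iInter fun a => isClosed_le ((continuous_apply a).comp hA').abs continuous_const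
      have h2 : IsClosed {p : (J → ℝ) × Matrix K K ℝ | ∀ b, |(r • (C *ᵥ p.1) + ρ • (p.2 *ᵥ vR τ)) b| ≤ β (Sum.inr b)} := by
        rw [Set.ofPred_forall]
        exact isClosed_iInter fun a => isClosed_le ((continuous_apply a).comp hC').abs continuous_const
      exact (h1.inter h2).measurableSet
    set H : (K → ℤ) → (J → ℝ) × Matrix K K ℝ → ℝ≥0∞ := fun τ => (S τ).indicator 1 with hH
    have hHm : ∀ τ, Measurable (H τ) := fun τ => measurable_one.indicator (hSm τ)
    set G : (K → ℤ) → (J → ℝ) → ℝ≥0∞ := fun τ x => ∫⁻ Z in (Om 2 : Set (Matrix K K ℝ)), H τ (x, Z) with hG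
    have hGm : ∀ τ, Measurable (G τ) := fun τ => (hHm τ).lintegral_prod_right'
    have hBm : MeasurableSet {X : Matrix J K ℝ | Bd 1 X} := (isCompact_Bd 1).isClosed.measurableSet
    have st1 : ∀ X Z, (bad2 β).indicator (1 : Matrix (J ⊕ K) (J ⊕ K) ℝ → ℝ≥0∞) (Phi r ρ (A, C, X, Z)) ≤
        ∑' τ : {τ : K → ℤ // τ ≠ 0}, ∑' t : J → ℤ, H τ.1 ((1 : Matrix J J ℝ) *ᵥ vR t + X *ᵥ vR τ.1, Z) := by
      intro X Z
      by_cases hb : Phi r ρ (A, C, X, Z) ∈ bad2 β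
      · rw [Set.indicator_of_mem hb, Pi.one_apply]
        obtain ⟨w, hw, hw2⟩ := hb
        have hwe : w = Sum.elim (w ∘ Sum.inl) (w ∘ Sum.inr) := by simp
        rw [hwe, Phi_mulVec] at hw2
        refine le_trans ?_ (ENNReal.le_tsum (⟨w ∘ Sum.inr, hw⟩ : {τ : K → ℤ // τ ≠ 0}))
        refine le_trans ?_ (ENNReal.le_tsum (w ∘ Sum.inl))
        simp only [hH, one_mulVec]
        rw [Set.indicator_of_mem, Pi.one_apply]
        exact ⟨fun a => hw2 (Sum.inl a), fun b => hw2 (Sum.inr b)⟩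
      · rw [Set.indicator_of_notMem hb]; exact zero_le
    have hmX : ∀ (τ : K → ℤ) (t : J → ℤ), Measurable fun X : Matrix J K ℝ => (1 : Matrix J J ℝ) *ᵥ vR t + X *ᵥ vR τ :=
      fun τ t => (meas_mulVec_const _).const_add _
    calc _ ≤ ∫⁻ X in {X : Matrix J K ℝ | Bd 1 X}, ∫⁻ Z in (Om 2 : Set (Matrix K K ℝ)), 
          ∑' τ : {τ : K → ℤ // τ ≠ 0}, ∑' t : J → ℤ, H τ.1 ((1 : Matrix J J ℝ) *ᵥ vR t + X *ᵥ vR τ.1, Z) :=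
          lintegral_mono fun X => lintegral_mono fun Z => st1 X Z
      _ = ∫⁻ X in {X : Matrix J K ℝ | Bd 1 X}, 
          ∑' τ : {τ : K → ℤ // τ ≠ 0}, ∑' t : J → ℤ, G τ.1 ((1 : Matrix J J ℝ) *ᵥ vR t + X *ᵥ vR τ.1) := by
          refine lintegral_congr fun X => ?_
          have hz : ∀ (τ : K → ℤ) (t : J → ℤ), Measurable fun Z => H τ ((1 : Matrix J J ℝ) *ᵥ vR t + X *ᵥ vR τ, Z) :=
            fun τ t => (hHm τ).comp measurable_prodMk_left
          rw [lintegral_tsum]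
          · congr 1; ext τ
            rw [lintegral_tsum]
            exact fun t => (hz _ t).aemeasurable
          · exact fun τ => (Measurable.tsum fun t => hz _ t).aemeasurable
      _ = ∑' τ : {τ : K → ℤ // τ ≠ 0}, ∑' t : J → ℤ, ∫⁻ X in {X : Matrix J K ℝ | Bd 1 X}, G τ.1 ((1 : Matrix J J ℝ) *ᵥ vR t + X *ᵥ vR τ.1) := by
          rw [lintegral_tsum]
          · congr 1; ext τ
            rw [lintegral_tsum]
            exact fun t => ((hGm _).comp (hmX _ t)).aemeasurable
          · exact fun τ => (Measurable.tsum fun t => (hGm _).comp (hmX _ t)).aemeasurable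
      _ ≤ ∑' τ : {τ : K → ℤ // τ ≠ 0}, C1 * ∫⁻ x, G τ.1 x := by
          refine ENNReal.tsum_le_tsum fun τ => ?_
          refine le_trans (le_of_eq ?_) (havg 1 ?_ τ.1 τ.2 (G τ.1) (hGm _))
          · congr 1; ext t
            rw [lintegral_indicator hBm]
          · refine ⟨fun a b => ?_, by norm_num⟩
            rw [one_apply]; split_ifs <;> norm_num
      _ = C1 * ∫⁻ x, ∑' τ : {τ : K → ℤ // τ ≠ 0}, G τ.1 x := by
          rw [ENNReal.tsum_mul_left, lintegral_tsum]
          exact fun τ => (hGm _).aemeasurable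
      _ ≤ C1 * ∫⁻ x, {x : J → ℝ | ∀ a, |(r • (A *ᵥ x)) a| ≤ β (Sum.inl a)}.indicator 
            (fun _ => ENNReal.ofReal (C3 * ∏ b, (β (Sum.inr b) / ρ))) x := by
          gcongr with x
          by_cases hx : x ∈ {x : J → ℝ | ∀ a, |(r • (A *ᵥ x)) a| ≤ β (Sum.inl a)}
          · rw [Set.indicator_of_mem hx]
            refine le_trans (ENNReal.tsum_le_tsum fun τ => ?_) (hL3 (fun b => (r / ρ) * (C *ᵥ x) b) (fun b => β (Sum.inr b) / ρ) 
              (fun b => by have := hβ (Sum.inr b); positivity))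
            simp only [hG, hH]
            have : ∀ Z : Matrix K K ℝ, (S τ.1).indicator (1 : (J → ℝ) × Matrix K K ℝ → ℝ≥0∞) (x, Z) ≤ 
                ({Z | Z ∈ Om 2 ∧ ∀ a, |(r / ρ) * (C *ᵥ x) a + (Z *ᵥ vR τ.1) a| ≤ β (Sum.inr a) / ρ} ∪ (Om 2)ᶜ).indicator 1 Z := by
              intro Z
              by_cases hz : (x, Z) ∈ S τ.1
              · rw [Set.indicator_of_mem hz, Set.indicator_of_mem]
                · simp
                by_cases hzo : Z ∈ Om 2
                · left
                  refine ⟨hzo, fun b => ?_⟩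
                  have := hz.2 b
                  simp only [Pi.add_apply, Pi.smul_apply, smul_eq_mul] at this
                  have he : r * (C *ᵥ x) b + ρ * (Z *ᵥ vR τ.1) b = ρ * (r / ρ * (C *ᵥ x) b + (Z *ᵥ vR τ.1) b) := by
                    field_simp
                  rw [he, abs_mul, abs_of_pos hρ] at this
                  exact (le_div_iff₀' hρ).2 this
                · right; exact hzo
              · rw [Set.indicator_of_notMem hz]; exact zero_le
            refine (setLIntegral_mono' (measurableSet_Om 2) (g := fun Z => {Z | Z ∈ Om 2 ∧ ∀ a, |(r / ρ) * (C *ᵥ x) a + (Z *ᵥ vR τ.1) a| ≤ β (Sum.inr a) / ρ}.indicator 1 Z) fun Z hZ => ?_).trans ?_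
            · refine (this Z).trans (le_of_eq ?_)
              by_cases hz : Z ∈ {Z | Z ∈ Om 2 ∧ ∀ a, |(r / ρ) * (C *ᵥ x) a + (Z *ᵥ vR τ.1) a| ≤ β (Sum.inr a) / ρ}
              · rw [Set.indicator_of_mem hz, Set.indicator_of_mem (Set.mem_union_left _ hz)]
              · rw [Set.indicator_of_notMem hz, Set.indicator_of_notMem]
                rintro (h | h)
                · exact hz h
                · exact h hZ
            · refine (setLIntegral_le_lintegral _ _).trans ?_
              exact lintegral_indicator_one_le _
          · rw [Set.indicator_of_notMem hx]
            apply le_of_eq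
            rw [ENNReal.tsum_eq_zero]
            intro τ
            simp only [hG, hH]
            have : ∀ Z, (S τ.1).indicator (1 : (J → ℝ) × Matrix K K ℝ → ℝ≥0∞) (x, Z) = 0 := fun Z => Set.indicator_of_notMem (fun h => hx h.1) _
            simp [this]
      _ ≤ C1 * (ENNReal.ofReal (C3 * ∏ b, (β (Sum.inr b) / ρ)) * ENNReal.ofReal (2 * ∏ a, (2 * β (Sum.inl a) / r))) := by
          gcongr
          refine (lintegral_indicator_const_le _ _).trans ?_
          exact mul_le_mul_right (vol_preim A hA hr _ fun a => hβ _) _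
      _ = _ := by
          have : 0 ≤ ∏ b, (β (Sum.inr b) / ρ) := Finset.prod_nonneg fun b _ => by have := hβ (Sum.inr b); positivity
          rw [← ENNReal.ofReal_mul (by positivity)]
          congr 2
          rw [Fintype.prod_sum_type, Finset.prod_div_distrib, Finset.prod_div_distrib, Finset.prod_mul_distrib,
            Finset.prod_const, Finset.prod_const, Finset.prod_const, Finset.card_univ, Finset.card_univ]
          have h2 : (∏ x, β (Sum.inr x : J ⊕ K)) * (∏ x, β (Sum.inl x)) / (r ^ Fintype.card J * ρ ^ Fintype.card K) = 
             (∏ x, β (Sum.inr x)) * (∏ x, β (Sum.inl x)) := by rw [hrρ, div_one]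
          rw [mul_comm (∏ x, β (Sum.inl x)) (∏ x, β (Sum.inr x)), ← h2]
          field_simp
  rw [nu_apply r ρ _ hm]
  set T := C1 * ENNReal.ofReal (C3 * (2 * 2 ^ Fintype.card J) * ∏ a, β a) with hT
  have hP : 0 ≤ ∏ a, β a := Finset.prod_nonneg fun a _ => hβ a
  calc _ ≤ ∫⁻ A in (Om 2 : Set (Matrix J J ℝ)), ∫⁻ C in {C : Matrix K J ℝ | Bd 1 C}, T :=
        setLIntegral_mono' (measurableSet_Om 2) fun A hA => lintegral_mono fun C => key A hA C
    _ = T * V2 * V1 := by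
        rw [setLIntegral_const, setLIntegral_const]
    _ = _ := by
        rw [hT, ← ENNReal.ofReal_toReal hC1, ← ENNReal.ofReal_toReal hV1, ← ENNReal.ofReal_toReal hV2,
          ← ENNReal.ofReal_mul (by positivity), ← ENNReal.ofReal_mul (by positivity), ← ENNReal.ofReal_mul (by positivity)]
        congr 1
        rw [ENNReal.ofReal_toReal hC1, ENNReal.ofReal_toReal hV1, ENNReal.ofReal_toReal hV2]
        ring
end bad2
end KM

open MeasureTheory
open scoped ENNReal
namespace KM
set_option linter.unusedSectionVars false
set_option linter.unusedSimpArgs false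
set_option linter.unusedVariables false
open Matrix

section bad1
variable {J K : Type*} [Fintype J] [Fintype K] [DecidableEq J] [DecidableEq K]

lemma summable_gen1 {J : Type*} [Fintype J] (L : Submodule ℤ (J → ℝ)) [DiscreteTopology L] (s : ℝ) (hs : s < -(Module.finrank ℤ L : ℝ))
    : Summable fun t : L => ‖t‖ ^ s := by
  exact ZLattice.summable_norm_rpow L s hs

lemma summable_gen2 {J : Type*} [Fintype J] (L : Submodule ℤ (J → ℝ)) (s : ℝ) 
    (h : Summable fun t : L => ‖t‖ ^ s) (g : (J → ℤ) → L) (hinj : Function.Injective g) :  Summable fun t : J → ℤ => ‖g t‖ ^ s := by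
  exact h.comp_injective hinj

lemma vR_inj {J : Type*} : Function.Injective (vR : (J → ℤ) → J → ℝ) := by
  intro t t' htt
  ext i
  have h3 := congrFun htt i
  simpa [vR] using h3

lemma summable_gen {J : Type*} [Fintype J] (L : Submodule ℤ (J → ℝ)) [DiscreteTopology L] (s : ℝ) (hs : s < -(Module.finrank ℤ L : ℝ))
    (hmem : ∀ t : J → ℤ, vR t ∈ L) : Summable fun t : J → ℤ => ‖vR t‖ ^ s :=
  summable_gen2 L s (summable_gen1 L s hs) (fun t => ⟨vR t, hmem t⟩) 
    (fun t t' h => vR_inj (congrArg Subtype.val h))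

lemma summable_vR (s : ℝ) (hs : s < -(Fintype.card J : ℝ)) : Summable fun t : J → ℤ => ‖vR t‖ ^ s := by
  have hr : Module.finrank ℤ (Submodule.span ℤ (Set.range (Pi.basisFun ℝ J))) = Fintype.card J := by
    rw [ZLattice.rank ℝ]; simp
  refine summable_gen (Submodule.span ℤ (Set.range (Pi.basisFun ℝ J))) s (by rw [hr]; exact hs) fun t => ?_
  rw [(Pi.basisFun ℝ J).mem_span_iff_repr_mem ℤ]
  intro i
  exact ⟨t i, by simp [vR]⟩

lemma row_le {r : ℝ} (hr : 0 < r) (t : J → ℤ) (ht : t ≠ 0) {β : ℝ} (hβ : 0 < β) :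
    volume {y : J → ℝ | (∀ c, |y c| ≤ 2) ∧ |r * (y ⬝ᵥ vR t)| ≤ β} ≤
      ENNReal.ofReal (4 ^ Fintype.card J * min 1 (β / (r * ‖vR t‖))) := by
  have hne : Nonempty J := by
    by_contra h; rw [not_nonempty_iff] at h; exact ht (Subsingleton.elim _ _)
  obtain ⟨b, hb⟩ : ∃ b, |vR t b| = ‖vR t‖ := by
    obtain ⟨b, -, hb⟩ := Finset.exists_mem_eq_sup' (Finset.univ_nonempty (α := J)) (fun c => ‖vR t c‖)
    refine ⟨b, ?_⟩
    apply le_antisymm (norm_le_pi_norm (vR t) b)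
    refine (pi_norm_le_iff_of_nonneg (abs_nonneg _)).2 fun c => ?_
    rw [← Real.norm_eq_abs, ← hb]
    exact Finset.le_sup' (fun c => ‖vR t c‖) (Finset.mem_univ c)
  have hvne : vR t ≠ 0 := by
    intro h; apply ht; ext c; have := congrFun h c; simpa [vR] using this
  have hpos : 0 < ‖vR t‖ := norm_pos_iff.2 hvne
  rw [mul_min_of_nonneg _ _ (by positivity), mul_one, ENNReal.ofReal_min]
  apply le_min
  · calc _ ≤ volume (Set.univ.pi fun _ : J => Set.Icc (-2 : ℝ) 2) := by
          apply measure_mono; intro y hy c _; exact abs_le.1 (hy.1 c)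
      _ = _ := by
          rw [volume_pi_pi]; simp only [Real.volume_Icc, Finset.prod_const, Finset.card_univ]
          rw [← ENNReal.ofReal_pow (by norm_num)]; norm_num
  · set Q : Matrix J J ℝ := (1 : Matrix J J ℝ).updateRow b (vR t) with hQ
    have hQdet : Q.det = vR t b := by
      have := det_updateRow_sum (1 : Matrix J J ℝ) b (vR t)
      have h2 : ∑ k, vR t k • (1 : Matrix J J ℝ) k = vR t := by
        ext b; simp [Finset.sum_apply, Matrix.one_apply]
      rw [h2] at this
      rw [hQ, this]; simp
    have hQ0 : vR t b ≠ 0 := by rw [← abs_pos, hb]; exact hpos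
    have hQb : ∀ y, (Q *ᵥ y) b = y ⬝ᵥ vR t := by
      intro y; simp only [mulVec, hQ]; rw [updateRow_self, dotProduct_comm]
    have hQc : ∀ y c, c ≠ b → (Q *ᵥ y) c = y c := by
      intro y c hc
      have : (Q *ᵥ y) c = ((1 : Matrix J J ℝ) *ᵥ y) c := by
        simp only [mulVec, hQ]; rw [updateRow_ne hc]
      rw [this, one_mulVec]
    calc _ ≤ volume ((toLin' Q) ⁻¹' (Set.univ.pi fun c => Set.Icc (-(if c = b then β / r else 2)) (if c = b then β / r else 2))) := by
          apply measure_mono; intro y hy c _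
          rw [Set.mem_Icc, ← abs_le, toLin'_apply]
          by_cases hc : c = b
          · subst hc
            rw [if_pos rfl, hQb, le_div_iff₀ hr, mul_comm]
            have := hy.2
            rwa [abs_mul, abs_of_pos hr] at this
          · rw [if_neg hc, hQc _ _ hc]; exact hy.1 c
      _ = ENNReal.ofReal (‖vR t‖⁻¹) * ∏ c, ENNReal.ofReal (2 * (if c = b then β / r else 2)) := by
          rw [Measure.addHaar_preimage_linearMap volume (by rw [LinearMap.det_toLin', hQdet]; exact hQ0), volume_pi_pi,
            LinearMap.det_toLin', hQdet, abs_inv, hb]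
          simp only [Real.volume_Icc]
          congr 1; refine Finset.prod_congr rfl fun c _ => ?_
          congr 1; ring
      _ ≤ _ := by
          rw [← ENNReal.ofReal_prod_of_nonneg (fun c _ => by split_ifs <;> positivity), ← ENNReal.ofReal_mul (by positivity)]
          apply ENNReal.ofReal_le_ofReal
          rw [← Finset.mul_prod_erase _ _ (Finset.mem_univ b), if_pos rfl]
          have : ∏ x ∈ Finset.univ.erase b, 2 * (if x = b then β / r else (2 : ℝ)) = 4 ^ (Fintype.card J - 1) := by
            rw [Finset.prod_congr rfl (g := fun _ => (4 : ℝ)), Finset.prod_const, Finset.card_erase_of_mem (Finset.mem_univ b), Finset.card_univ]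
            intro x hx; rw [if_neg (Finset.ne_of_mem_erase hx)]; norm_num
          rw [this]
          have h4 : (4 : ℝ) ^ Fintype.card J = 4 * 4 ^ (Fintype.card J - 1) := by
            rw [← pow_succ']; congr 1; have := Fintype.card_pos (α := J); omega
          rw [h4]
          have : 0 ≤ β / (r * ‖vR t‖) * 4 ^ (Fintype.card J - 1) := by positivity
          calc _ = 2 * (β / (r * ‖vR t‖) * 4 ^ (Fintype.card J - 1)) := by field_simp
            _ ≤ _ := by nlinarith

lemma rows_le {κ : Type*} [Fintype κ] [DecidableEq κ] {r : ℝ} (hr : 0 < r) (t : J → ℤ) (ht : t ≠ 0) (β : κ → ℝ) (hβ : ∀ a, 0 < β a) :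
    volume {L : Matrix κ J ℝ | Bd 2 L ∧ ∀ a, |r * (L *ᵥ vR t) a| ≤ β a} ≤
      ENNReal.ofReal (∏ a, (4 ^ Fintype.card J * min 1 (β a / (r * ‖vR t‖)))) := by
  have h1 : {L : Matrix κ J ℝ | Bd 2 L ∧ ∀ a, |r * (L *ᵥ vR t) a| ≤ β a} ⊆
      (Set.univ.pi fun a => {y : J → ℝ | (∀ c, |y c| ≤ 2) ∧ |r * (y ⬝ᵥ vR t)| ≤ β a} : Set (κ → J → ℝ)) := by
    intro L hL a _
    exact ⟨hL.1 a, hL.2 a⟩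
  have h2 : volume (Set.univ.pi fun a => {y : J → ℝ | (∀ c, |y c| ≤ 2) ∧ |r * (y ⬝ᵥ vR t)| ≤ β a} : Set (κ → J → ℝ))
      = ∏ a, volume {y : J → ℝ | (∀ c, |y c| ≤ 2) ∧ |r * (y ⬝ᵥ vR t)| ≤ β a} := volume_pi_pi _
  refine (measure_mono h1).trans ?_
  change (volume : Measure (κ → J → ℝ)) _ ≤ _
  rw [h2, ENNReal.ofReal_prod_of_nonneg]
  · exact Finset.prod_le_prod' fun a _ => row_le hr t ht (hβ a)
  · intro a _
    have := (hβ a).le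
    positivity

lemma rows_meas {κ : Type*} [Fintype κ] [DecidableEq κ] (r : ℝ) (γ : κ → ℝ) (t : J → ℤ) :
    MeasurableSet {L : Matrix κ J ℝ | Bd 2 L ∧ ∀ a, |r * (L *ᵥ vR t) a| ≤ γ a} := by
  have h2 : IsClosed {L : Matrix κ J ℝ | ∀ a, |r * (L *ᵥ vR t) a| ≤ γ a} := by
    rw [Set.ofPred_forall]
    refine isClosed_iInter fun a => isClosed_le ?_ continuous_const
    exact (((continuous_apply a).comp (Continuous.matrix_mulVec continuous_id continuous_const)).const_mul r).abs
  exact ((isCompact_Bd 2).isClosed.inter h2).measurableSet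

lemma prod_min_le {κ : Type*} [Fintype κ] [DecidableEq κ] (x : κ → ℝ) (hx : ∀ a, 0 < x a) (a0 : κ) :
    ∏ a, min 1 (x a) ≤ (∏ a, x a) * x a0 ^ (-(1/2) : ℝ) := by
  rw [← Finset.mul_prod_erase _ _ (Finset.mem_univ a0), ← Finset.mul_prod_erase _ x (Finset.mem_univ a0)]
  have h1 : ∏ x_1 ∈ Finset.univ.erase a0, min 1 (x x_1) ≤ ∏ a ∈ Finset.univ.erase a0, x a :=
    Finset.prod_le_prod (fun a _ => le_min zero_le_one (hx a).le) fun a _ => min_le_right _ _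
  have h2 : min 1 (x a0) ≤ x a0 * x a0 ^ (-(1/2) : ℝ) := by
    nth_rewrite 2 [← Real.rpow_one (x a0)]
    rw [← Real.rpow_add (hx a0)]
    norm_num
    rcases le_total 1 (x a0) with h | h
    · left; exact Real.one_le_rpow h (by norm_num)
    · right
      nth_rewrite 1 [← Real.rpow_one (x a0)]
      exact Real.rpow_le_rpow_of_exponent_ge (hx a0) h (by norm_num)
  calc _ ≤ (x a0 * x a0 ^ (-(1/2) : ℝ)) * ∏ a ∈ Finset.univ.erase a0, x a := by
        apply mul_le_mul h2 h1 (Finset.prod_nonneg fun a _ => le_min zero_le_one (hx a).le)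
        have := hx a0; positivity
    _ = _ := by ring

def bad1 (β : J ⊕ K → ℝ) : Set (Matrix (J ⊕ K) (J ⊕ K) ℝ) :=
  {h | ∃ w : J ⊕ K → ℤ, (w ∘ Sum.inr = 0 ∧ w ≠ 0) ∧ ∀ a, |(h *ᵥ vR w) a| ≤ β a}

lemma nu_bad1 [Nonempty K] : ∃ Cst : ℝ, 0 ≤ Cst ∧ ∀ r ρ : ℝ, 0 < r → r ≤ 1 →
    ∀ β : J ⊕ K → ℝ, (∀ a, 0 < β a) → ∀ a0, nu r ρ (bad1 β) ≤ 
      ENNReal.ofReal (Cst * (∏ a, β a) * (r⁻¹ ^ Fintype.card (J ⊕ K) * β a0 ^ (-(1/2) : ℝ))) := by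
  set d := Fintype.card (J ⊕ K) with hd
  have hdJ : d = Fintype.card J + Fintype.card K := Fintype.card_sum
  have hK : 1 ≤ Fintype.card K := Fintype.card_pos
  have hsum := summable_vR (J := J) (1 / 2 - d) (by
    have : (d : ℝ) = Fintype.card J + Fintype.card K := by rw [hdJ]; push_cast; rfl
    have h2 : (1 : ℝ) ≤ Fintype.card K := by exact_mod_cast hK
    linarith)
  set St := ∑' t : J → ℤ, ‖vR t‖ ^ ((1 / 2 : ℝ) - d) with hSt
  have hSt0 : 0 ≤ St := tsum_nonneg fun t => by positivity
  set V1 := volume {C : Matrix J K ℝ | Bd 1 C}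
  set V2 := volume (Om 2 : Set (Matrix K K ℝ))
  have hV1 : V1 ≠ ⊤ := (vol_Bd_lt_top 1).ne
  have hV2 : V2 ≠ ⊤ := (vol_Om_lt_top 2).ne
  refine ⟨V2.toReal * V1.toReal * ((4 ^ Fintype.card J) ^ d * St), by positivity, ?_⟩
  intro r ρ hr hr1 β hβ a0
  have hm := measurableSet_exone β (fun w : J ⊕ K → ℤ => w ∘ Sum.inr = 0 ∧ w ≠ 0)
  change MeasurableSet (bad1 β) at hm
  set SA : (J → ℤ) → Set (Matrix J J ℝ) := fun t => {A | Bd 2 A ∧ ∀ a, |r * (A *ᵥ vR t) a| ≤ β (Sum.inl a)} with hSA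
  set SC : (J → ℤ) → Set (Matrix K J ℝ) := fun t => {C | Bd 2 C ∧ ∀ a, |r * (C *ᵥ vR t) a| ≤ β (Sum.inr a)} with hSC
  have hSAm : ∀ t, MeasurableSet (SA t) := fun t => rows_meas r _ t
  have hSCm : ∀ t, MeasurableSet (SC t) := fun t => rows_meas r _ t
  have key : ∀ A ∈ (Om 2 : Set (Matrix J J ℝ)), ∀ C ∈ {C : Matrix K J ℝ | Bd 1 C}, ∀ X Z,
      (bad1 β).indicator (1 : Matrix (J ⊕ K) (J ⊕ K) ℝ → ℝ≥0∞) (Phi r ρ (A, C, X, Z)) ≤ 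
        ∑' t : {t : J → ℤ // t ≠ 0}, (SA t.1).indicator 1 A * (SC t.1).indicator 1 C := by
    intro A hA C hC X Z
    by_cases hb : Phi r ρ (A, C, X, Z) ∈ bad1 β
    · rw [Set.indicator_of_mem hb, Pi.one_apply]
      obtain ⟨w, ⟨hw0, hw1⟩, hw2⟩ := hb
      have hwe : w = Sum.elim (w ∘ Sum.inl) 0 := by
        conv_lhs => rw [← Sum.elim_comp_inl_inr w]
        rw [hw0]
      have hvr0 : vR (0 : K → ℤ) = 0 := by ext; simp [vR]
      rw [hwe, Phi_mulVec, hvr0] at hw2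
      simp only [mulVec_zero, add_zero, smul_zero] at hw2
      have ht : w ∘ Sum.inl ≠ 0 := by
        intro h; apply hw1; rw [hwe, h]; ext a; rcases a with a | a <;> rfl
      refine le_trans ?_ (ENNReal.le_tsum (⟨w ∘ Sum.inl, ht⟩ : {t : J → ℤ // t ≠ 0}))
      rw [Set.indicator_of_mem, Set.indicator_of_mem]
      · simp
      · exact ⟨hC.mono (by norm_num), fun a => hw2 (Sum.inr a)⟩
      · exact ⟨hA.1, fun a => hw2 (Sum.inl a)⟩
    · rw [Set.indicator_of_notMem hb]; exact zero_le
  set T : Matrix J J ℝ → Matrix K J ℝ → ℝ≥0∞ := fun A C => ∑' t : {t : J → ℤ // t ≠ 0}, (SA t.1).indicator 1 A * (SC t.1).indicator 1 C with hT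
  have hP : 0 ≤ ∏ a, β a := Finset.prod_nonneg fun a _ => (hβ a).le
  have tbound : ∀ t : {t : J → ℤ // t ≠ 0}, volume (SA t.1) * volume (SC t.1) ≤ 
      ENNReal.ofReal (((4 ^ Fintype.card J) ^ d * ((∏ a, β a) * (r⁻¹ ^ d * β a0 ^ (-(1/2) : ℝ)))) * ‖vR t.1‖ ^ ((1 / 2 : ℝ) - d)) := by
    intro t
    have hvne : vR t.1 ≠ 0 := by
      intro h; apply t.2; ext c; have := congrFun h c; simpa [vR] using this
    have hpos : 0 < ‖vR t.1‖ := norm_pos_iff.2 hvne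
    refine (mul_le_mul' (rows_le hr t.1 t.2 (fun a => β (Sum.inl a)) fun a => hβ _) 
      (rows_le hr t.1 t.2 (fun a => β (Sum.inr a)) fun a => hβ _)).trans ?_
    rw [← ENNReal.ofReal_mul (Finset.prod_nonneg fun a _ => by have := (hβ (Sum.inl a)).le; positivity)]
    apply ENNReal.ofReal_le_ofReal
    have e1 := Fintype.prod_sum_type (fun a : J ⊕ K => (4 : ℝ) ^ Fintype.card J * min 1 (β a / (r * ‖vR t.1‖)))
    rw [← e1, Finset.prod_mul_distrib, Finset.prod_const, Finset.card_univ, mul_assoc]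
    refine mul_le_mul_of_nonneg_left ?_ (by positivity)
    refine (prod_min_le (fun a => β a / (r * ‖vR t.1‖)) (fun a => by have := hβ a; positivity) a0).trans ?_
    rw [Finset.prod_div_distrib, Finset.prod_const, Finset.card_univ, Real.div_rpow (hβ a0).le (by positivity), 
      Real.mul_rpow hr.le hpos.le, mul_assoc]
    have e2 : ‖vR t.1‖ ^ ((1 / 2 : ℝ) - d) = ‖vR t.1‖ ^ (1 / 2 : ℝ) / ‖vR t.1‖ ^ d := by
      rw [Real.rpow_sub hpos, Real.rpow_natCast]
    rw [e2]
    have e3 : ‖vR t.1‖ ^ (-(1 / 2) : ℝ) = (‖vR t.1‖ ^ (1 / 2 : ℝ))⁻¹ := Real.rpow_neg hpos.le _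
    have e4 : r ^ (-(1 / 2) : ℝ) = (r ^ (1 / 2 : ℝ))⁻¹ := Real.rpow_neg hr.le _
    have e5 : r ^ (1 / 2 : ℝ) ≤ 1 := Real.rpow_le_one hr.le hr1 (by norm_num)
    rw [e3, e4, ← hd]
    have h6 : 0 < ‖vR t.1‖ ^ (1 / 2 : ℝ) := by positivity
    have h7 : 0 < r ^ (1 / 2 : ℝ) := by positivity
    have h8 : 0 < β a0 ^ (-(1/2) : ℝ) := Real.rpow_pos_of_pos (hβ a0) _
    calc _ = ((∏ a, β a) * (r⁻¹ ^ d * β a0 ^ (-(1/2) : ℝ) * (‖vR t.1‖ ^ (1 / 2 : ℝ) / ‖vR t.1‖ ^ d))) * r ^ (1 / 2 : ℝ) := by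
          rw [mul_pow, inv_pow]; field_simp
      _ ≤ ((∏ a, β a) * (r⁻¹ ^ d * β a0 ^ (-(1/2) : ℝ) * (‖vR t.1‖ ^ (1 / 2 : ℝ) / ‖vR t.1‖ ^ d))) * 1 := by
          apply mul_le_mul_of_nonneg_left e5; positivity
      _ = _ := by ring
  have hb0 : 0 < β a0 ^ (-(1/2) : ℝ) := Real.rpow_pos_of_pos (hβ a0) _
  have hTint : ∫⁻ A, ∫⁻ C, T A C ≤ ENNReal.ofReal (((4 ^ Fintype.card J) ^ d * ((∏ a, β a) * (r⁻¹ ^ d * β a0 ^ (-(1/2) : ℝ)))) * St) := by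
    calc _ = ∑' t : {t : J → ℤ // t ≠ 0}, volume (SA t.1) * volume (SC t.1) := by
          have : ∀ A, ∫⁻ C, T A C = ∑' t : {t : J → ℤ // t ≠ 0}, (SA t.1).indicator 1 A * volume (SC t.1) := by
            intro A
            simp only [hT]
            rw [lintegral_tsum]
            · congr 1; ext t
              rw [lintegral_const_mul _ (measurable_one.indicator (hSCm _)), lintegral_indicator_one (hSCm _)]
            · exact fun t => ((measurable_one.indicator (hSCm _)).const_mul _).aemeasurable
          rw [lintegral_congr this, lintegral_tsum]
          · congr 1; ext t
            rw [lintegral_mul_const _ (measurable_one.indicator (hSAm _)), lintegral_indicator_one (hSAm _)]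
          · exact fun t => ((measurable_one.indicator (hSAm _)).mul_const _).aemeasurable
      _ ≤ ∑' t : {t : J → ℤ // t ≠ 0}, _ := ENNReal.tsum_le_tsum tbound
      _ ≤ ∑' t : J → ℤ, ENNReal.ofReal (((4 ^ Fintype.card J) ^ d * ((∏ a, β a) * (r⁻¹ ^ d * β a0 ^ (-(1/2) : ℝ)))) * ‖vR t‖ ^ ((1 / 2 : ℝ) - d)) :=
          ENNReal.tsum_comp_le_tsum_of_injective Subtype.val_injective _
      _ = _ := by
          rw [← ENNReal.ofReal_tsum_of_nonneg (fun t => by positivity) (hsum.mul_left _), tsum_mul_left]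
  rw [nu_apply r ρ _ hm]
  have hBm : MeasurableSet {X : Matrix K J ℝ | Bd 1 X} := (isCompact_Bd 1).isClosed.measurableSet
  calc _ ≤ ∫⁻ A in (Om 2 : Set (Matrix J J ℝ)), ∫⁻ C in {C : Matrix K J ℝ | Bd 1 C},
      ∫⁻ X in {X : Matrix J K ℝ | Bd 1 X}, ∫⁻ Z in (Om 2 : Set (Matrix K K ℝ)), T A C :=
        setLIntegral_mono' (measurableSet_Om 2) fun A hA => setLIntegral_mono' hBm fun C hC => 
          lintegral_mono fun X => lintegral_mono fun Z => key A hA C hC X Z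
    _ = ∫⁻ A in (Om 2 : Set (Matrix J J ℝ)), ∫⁻ C in {C : Matrix K J ℝ | Bd 1 C}, T A C * (V2 * V1) := by
        simp only [setLIntegral_const, mul_assoc]
        rfl
    _ = (∫⁻ A in (Om 2 : Set (Matrix J J ℝ)), ∫⁻ C in {C : Matrix K J ℝ | Bd 1 C}, T A C) * (V2 * V1) := by
        have hfin : V2 * V1 ≠ ⊤ := ENNReal.mul_ne_top hV2 hV1
        rw [← lintegral_mul_const' _ _ hfin]
        refine lintegral_congr fun A => ?_
        rw [← lintegral_mul_const' _ _ hfin]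
    _ ≤ (∫⁻ A, ∫⁻ C, T A C) * (V2 * V1) := by
        refine mul_le_mul_left ?_ _
        exact (setLIntegral_le_lintegral _ _).trans (lintegral_mono fun A => setLIntegral_le_lintegral _ _)
    _ ≤ ENNReal.ofReal (((4 ^ Fintype.card J) ^ d * ((∏ a, β a) * (r⁻¹ ^ d * β a0 ^ (-(1/2) : ℝ)))) * St) * (V2 * V1) := by
        gcongr
    _ = _ := by
        rw [← ENNReal.ofReal_toReal hV1, ← ENNReal.ofReal_toReal hV2,
          ← ENNReal.ofReal_mul (by positivity), ← ENNReal.ofReal_mul (by positivity)]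
        congr 1
        rw [ENNReal.ofReal_toReal hV1, ENNReal.ofReal_toReal hV2]
        ring

lemma nu_bad [Nonempty K] : ∃ Cst : ℝ, 0 ≤ Cst ∧ ∀ r ρ : ℝ, 0 < r → r ≤ 1 → 0 < ρ → r ^ Fintype.card J * ρ ^ Fintype.card K = 1 →
    ∀ β : J ⊕ K → ℝ, (∀ a, 0 < β a) → ∀ a0, nu r ρ (badS β) ≤ 
      ENNReal.ofReal (Cst * (∏ a, β a) * (1 + r⁻¹ ^ Fintype.card (J ⊕ K) * β a0 ^ (-(1/2) : ℝ))) := by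
  obtain ⟨C1, hC1, h1⟩ := nu_bad1 (J := J) (K := K)
  obtain ⟨C2, hC2, h2⟩ := nu_bad2 (J := J) (K := K)
  refine ⟨C1 + C2, by positivity, fun r ρ hr hr1 hρ hrρ β hβ a0 => ?_⟩
  have hsub : badS β ⊆ bad1 β ∪ bad2 β := by
    rintro h ⟨w, hw0, hw⟩
    by_cases hz : w ∘ Sum.inr = 0
    · left; exact ⟨w, ⟨hz, hw0⟩, hw⟩
    · right; exact ⟨w, hz, hw⟩
  refine (measure_mono hsub).trans ((measure_union_le _ _).trans ?_)
  have hP : 0 ≤ ∏ a, β a := Finset.prod_nonneg fun a _ => (hβ a).le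
  have hb0 : 0 < β a0 ^ (-(1/2) : ℝ) := Real.rpow_pos_of_pos (hβ a0) _
  refine (add_le_add (h1 r ρ hr hr1 β hβ a0) (h2 r ρ hr hρ hrρ β fun a => (hβ a).le)).trans ?_
  rw [← ENNReal.ofReal_add (by positivity) (by positivity)]
  apply ENNReal.ofReal_le_ofReal
  have a1 : 0 ≤ C1 * ∏ a, β a := by positivity
  have a2 : 0 ≤ C2 * (∏ a, β a) * (r⁻¹ ^ Fintype.card (J ⊕ K) * β a0 ^ (-(1/2) : ℝ)) := by positivity
  nlinarith
end bad1
end KM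

open MeasureTheory
open scoped ENNReal
namespace KM
set_option linter.unusedSectionVars false
set_option linter.unusedSimpArgs false
set_option linter.unusedVariables false
open Matrix

section pk
variable {J K : Type*} [Fintype J] [Fintype K] [DecidableEq J] [DecidableEq K]

lemma Phi_factor (r ρ : ℝ) (p : Matrix J J ℝ × Matrix K J ℝ × Matrix J K ℝ × Matrix K K ℝ) :
    Phi r ρ p = fromBlocks p.1 0 p.2.1 p.2.2.2 * fromBlocks (r • (1 : Matrix J J ℝ)) (r • p.2.2.1) 0 (ρ • (1 : Matrix K K ℝ)) := by
  rw [fromBlocks_multiply, Phi]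
  simp

lemma det_Phi {r ρ : ℝ} (hrρ : r ^ Fintype.card J * ρ ^ Fintype.card K = 1)
    (p : Matrix J J ℝ × Matrix K J ℝ × Matrix J K ℝ × Matrix K K ℝ) :
    (Phi r ρ p).det = p.1.det * p.2.2.2.det := by
  rw [Phi_factor, det_mul, det_fromBlocks_zero₁₂, det_fromBlocks_zero₂₁, det_smul, det_smul, det_one, det_one,
    mul_one, mul_one, hrρ, mul_one]

lemma EE_quot : ∃ M : ℝ, 1 ≤ M ∧ ∀ r ρ : ℝ, 0 < r → r ≤ ρ → r ^ Fintype.card J * ρ ^ Fintype.card K = 1 →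
    ∀ h0 ∈ (EE r ρ : Set (Matrix (J ⊕ K) (J ⊕ K) ℝ)), ∀ h ∈ (EE r ρ : Set (Matrix (J ⊕ K) (J ⊕ K) ℝ)),
      Bd M (h0⁻¹ * h) := by
  set cJ : ℝ := (Fintype.card J : ℝ) with hcJ
  set cK : ℝ := (Fintype.card K : ℝ) with hcK
  have hJ0 : 0 ≤ cJ := by positivity
  have hK0 : 0 ≤ cK := by positivity
  set IJ : ℝ := 2 * dC J 2 with hIJ
  set IK : ℝ := 2 * dC K 2 with hIK
  have hIJ0 : 0 ≤ IJ := by have := dC_pos (κ := J) 2 (by norm_num); positivity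
  have hIK0 : 0 ≤ IK := by have := dC_pos (κ := K) 2 (by norm_num); positivity
  set M1 : ℝ := cJ * (IJ * 2) with hM1
  set M3 : ℝ := cK * (IK * 2) with hM3
  set M2 : ℝ := cK * (IK * (1 + cJ * (1 * M1))) with hM2
  have h1 : 0 ≤ M1 := by positivity
  have h3 : 0 ≤ M3 := by positivity
  have h2 : 0 ≤ M2 := by positivity
  set N : ℝ := 1 + M1 + M2 + M3 with hN
  have hN0 : 0 ≤ N := by positivity
  set c : ℝ := (Fintype.card (J ⊕ K) : ℝ) with hc
  refine ⟨1 + c * ((c * (N * N)) * N), by have : 0 ≤ c := by positivity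
                                          nlinarith [show 0 ≤ c * ((c * (N * N)) * N) by positivity], ?_⟩
  rintro r ρ hr hrr hrρ _ ⟨⟨A0, C0, X0, Z0⟩, ⟨hA0, hC0, hX0, hZ0⟩, rfl⟩ _ ⟨⟨A, C, X, Z⟩, ⟨hA, hC, hX, hZ⟩, rfl⟩
  simp only [Set.mem_ofPred_eq] at hA0 hC0 hX0 hZ0 hA hC hX hZ
  have hρ : 0 < ρ := by linarith
  have uA : IsUnit A0.det := (Om.det_ne (by norm_num) hA0).isUnit
  have uZ : IsUnit Z0.det := (Om.det_ne (by norm_num) hZ0).isUnit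
  set P1 := A0⁻¹ * A with hP1
  set P3 := Z0⁻¹ * Z with hP3
  set P2 := Z0⁻¹ * (C + -(C0 * P1)) with hP2
  have b1 : Bd M1 P1 := (Om.inv (by norm_num) hA0).mul hIJ0 hA.1
  have b3 : Bd M3 P3 := (Om.inv (by norm_num) hZ0).mul hIK0 hZ.1
  have b2 : Bd M2 P2 := (Om.inv (by norm_num) hZ0).mul hIK0 (hC.add (hC0.mul zero_le_one b1).neg)
  have e1 : A0 * P1 = A := by rw [hP1, mul_nonsing_inv_cancel_left _ _ uA]
  have e3 : Z0 * P3 = Z := by rw [hP3, mul_nonsing_inv_cancel_left _ _ uZ]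
  have e2 : Z0 * P2 = C + -(C0 * P1) := by rw [hP2, mul_nonsing_inv_cancel_left _ _ uZ]
  have hfac : Phi r ρ (A, C, X, Z) = Phi r ρ (A0, C0, X0, Z0) * 
      (fromBlocks 1 (-X0) 0 1 * fromBlocks P1 0 ((r/ρ) • P2) P3 * fromBlocks 1 X 0 1) := by
    rw [← mul_assoc, ← mul_assoc]
    simp only [Phi]
    rw [fromBlocks_multiply, fromBlocks_multiply, fromBlocks_multiply]
    have hrr : r / ρ * ρ = r := by field_simp
    simp [e1, e2, e3, Matrix.mul_assoc, smul_smul, hrr]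
  have hu : IsUnit (Phi r ρ (A0, C0, X0, Z0)).det := by
    rw [det_Phi hrρ]; exact uA.mul uZ
  rw [hfac, nonsing_inv_mul_cancel_left _ _ hu]
  have hN1 : 1 ≤ N := by rw [hN]; linarith
  have f1 : Bd N (fromBlocks (1 : Matrix J J ℝ) (-X0) 0 (1 : Matrix K K ℝ)) :=
    Bd_blk (Bd_one.mono hN1) (hX0.neg.mono hN1) (Bd_zero hN0) (Bd_one.mono hN1)
  have f3 : Bd N (fromBlocks (1 : Matrix J J ℝ) X 0 (1 : Matrix K K ℝ)) :=
    Bd_blk (Bd_one.mono hN1) (hX.mono hN1) (Bd_zero hN0) (Bd_one.mono hN1)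
  have f2 : Bd N (fromBlocks P1 0 ((r/ρ) • P2) P3) := by
    refine Bd_blk (b1.mono (by rw [hN]; linarith)) (Bd_zero hN0) ((b2.smul (r/ρ)).mono ?_) (b3.mono (by rw [hN]; linarith))
    have : |r/ρ| ≤ 1 := by rw [abs_of_pos (by positivity)]; exact (div_le_one hρ).mpr hrr
    nlinarith
  exact (((f1.mul hN0 f2).mul (by positivity) f3)).mono (by linarith)

lemma EE_facts : ∃ D : ℝ, 1 ≤ D ∧ ∀ r ρ : ℝ, 0 < r → r ^ Fintype.card J * ρ ^ Fintype.card K = 1 →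
    ∀ h ∈ (EE r ρ : Set (Matrix (J ⊕ K) (J ⊕ K) ℝ)), (∀ a c, |h a (Sum.inl c)| ≤ 2 * r) ∧ D⁻¹ ≤ |h.det| ∧ |h.det| ≤ D ∧
      r ^ Fintype.card J / 2 ≤ |(h.submatrix Sum.inl Sum.inl).det| := by
  have p1 := dC_pos (κ := J) 2 (by norm_num)
  have p2 := dC_pos (κ := K) 2 (by norm_num)
  have p3 := mul_pos p1 p2
  refine ⟨4 + dC J 2 * dC K 2, by linarith, ?_⟩
  rintro r ρ hr hrρ _ ⟨⟨A, C, X, Z⟩, ⟨hA, hC, hX, hZ⟩, rfl⟩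
  simp only [Set.mem_ofPred_eq] at hA hC hX hZ
  refine ⟨?_, ?_, ?_, ?_⟩
  · rintro (a | a) c
    · simp only [Phi, fromBlocks_apply₁₁, Matrix.smul_apply, smul_eq_mul, abs_mul, abs_of_pos hr]
      nlinarith [hA.1 a c]
    · simp only [Phi, fromBlocks_apply₂₁, Matrix.smul_apply, smul_eq_mul, abs_mul, abs_of_pos hr]
      nlinarith [hC a c]
  · rw [det_Phi hrρ, abs_mul]
    have a1 := hA.2
    have a2 := hZ.2
    calc (4 + dC J 2 * dC K 2)⁻¹ ≤ 4⁻¹ := inv_anti₀ (by norm_num) (by linarith)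
      _ = 2⁻¹ * 2⁻¹ := by norm_num
      _ ≤ _ := mul_le_mul a1 a2 (by norm_num) (abs_nonneg _)
  · rw [det_Phi hrρ, abs_mul]
    calc |A.det| * |Z.det| ≤ dC J 2 * dC K 2 := mul_le_mul hA.1.det_le hZ.1.det_le (abs_nonneg _) p1.le
      _ ≤ _ := by linarith
  · have : (Phi r ρ (A, C, X, Z)).submatrix Sum.inl Sum.inl = r • A := by
      ext a b; simp [Phi]
    rw [this, det_smul, abs_mul, abs_pow, abs_of_pos hr, div_eq_mul_inv]
    exact mul_le_mul_of_nonneg_left hA.2 (by positivity)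

lemma EE_vol [Nonempty K] : ∃ c : ℝ, 0 < c ∧ ∃ Cst : ℝ, 0 ≤ Cst ∧ ∀ r ρ : ℝ, 0 < r → r ≤ 1 → 0 < ρ → 
    r ^ Fintype.card J * ρ ^ Fintype.card K = 1 → ∀ β1 β2 : J ⊕ K → ℝ, (∀ a, 0 < β1 a) → (∀ a, 0 < β2 a) → 
    ∀ a1 a2, Cst * (∏ a, β1 a) * (1 + r⁻¹ ^ Fintype.card (J ⊕ K) * β1 a1 ^ (-(1/2) : ℝ)) ≤ 1 → 
      Cst * (∏ a, β2 a) * (1 + r⁻¹ ^ Fintype.card (J ⊕ K) * β2 a2 ^ (-(1/2) : ℝ)) ≤ 1 → 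
      ENNReal.ofReal (c * r ^ (Fintype.card J * Fintype.card (J ⊕ K))) ≤ 
        volume ((EE r ρ \ badS β1) \ badS β2 : Set (Matrix (J ⊕ K) (J ⊕ K) ℝ)) := by
  obtain ⟨C0, hC0, hbad⟩ := nu_bad (J := J) (K := K)
  set V : ℝ≥0∞ := volume (Om 2 : Set (Matrix J J ℝ)) * (volume {C : Matrix K J ℝ | Bd 1 C} *
      (volume {X : Matrix J K ℝ | Bd 1 X} * volume (Om 2 : Set (Matrix K K ℝ)))) with hV
  have hVt : V ≠ ⊤ := by
    have a1 := (vol_Om_lt_top (κ := J) 2).ne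
    have a2 := (vol_Om_lt_top (κ := K) 2).ne
    have a3 := (vol_Bd_lt_top (κ := J) (l := K) 1).ne
    have a4 := (vol_Bd_lt_top (κ := K) (l := J) 1).ne
    exact ENNReal.mul_ne_top a1 (ENNReal.mul_ne_top a4 (ENNReal.mul_ne_top a3 a2))
  have hV0 : V ≠ 0 := by
    have a1 := (vol_Om_pos (κ := J) (M := 2) (by norm_num)).ne'
    have a2 := (vol_Om_pos (κ := K) (M := 2) (by norm_num)).ne'
    have a3 := (vol_Bd_pos (κ := J) (l := K) (M := 1) (by norm_num)).ne'
    have a4 := (vol_Bd_pos (κ := K) (l := J) (M := 1) (by norm_num)).ne'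
    exact mul_ne_zero a1 (mul_ne_zero a4 (mul_ne_zero a3 a2))
  set v := V.toReal with hv
  have hv0 : 0 < v := ENNReal.toReal_pos hV0 hVt
  have hVv : V = ENNReal.ofReal v := (ENNReal.ofReal_toReal hVt).symm
  refine ⟨v / 2 / 2 ^ Fintype.card K, by positivity, C0 * 4 / v, by positivity, ?_⟩
  intro r ρ hr hr1 hρ hrρ β1 β2 hβ1 hβ2 a1 a2 h1 h2
  set G : Set (Matrix (J ⊕ K) (J ⊕ K) ℝ) := (EE r ρ \ badS β1) \ badS β2 with hG
  have hGm : MeasurableSet G := ((measurableSet_EE r ρ).diff (measurableSet_badS _)).diff (measurableSet_badS _)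
  have key : ∀ β : J ⊕ K → ℝ, (∀ a, 0 < β a) → ∀ a, C0 * 4 / v * (∏ a, β a) * (1 + r⁻¹ ^ Fintype.card (J ⊕ K) * β a ^ (-(1/2) : ℝ)) ≤ 1 →
      nu r ρ (badS β) ≤ ENNReal.ofReal (v / 4) := by
    intro β hβ a hh
    refine (hbad r ρ hr hr1 hρ hrρ β hβ a).trans (ENNReal.ofReal_le_ofReal ?_)
    have : C0 * (∏ a, β a) * (1 + r⁻¹ ^ Fintype.card (J ⊕ K) * β a ^ (-(1/2) : ℝ)) = v / 4 * 
      (C0 * 4 / v * (∏ a, β a) * (1 + r⁻¹ ^ Fintype.card (J ⊕ K) * β a ^ (-(1/2) : ℝ))) := by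
      field_simp
    rw [this]
    nlinarith
  have k1 := key β1 hβ1 a1 h1
  have k2 := key β2 hβ2 a2 h2
  have hcov : V ≤ nu r ρ G + (ENNReal.ofReal (v/4) + ENNReal.ofReal (v/4)) := by
    rw [hV, ← nu_univ r ρ]
    have hs : (Set.univ : Set (Matrix (J ⊕ K) (J ⊕ K) ℝ)) ⊆ (G ∪ (EE r ρ)ᶜ) ∪ (badS β1 ∪ badS β2) := by
      intro x _
      by_cases x1 : x ∈ badS β1
      · exact Set.mem_union_right _ (Set.mem_union_left _ x1)
      by_cases x2 : x ∈ badS β2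
      · exact Set.mem_union_right _ (Set.mem_union_right _ x2)
      by_cases x3 : x ∈ (EE r ρ : Set (Matrix (J ⊕ K) (J ⊕ K) ℝ))
      · exact Set.mem_union_left _ (Set.mem_union_left _ ⟨⟨x3, x1⟩, x2⟩)
      · exact Set.mem_union_left _ (Set.mem_union_right _ x3)
    refine (measure_mono hs).trans ((measure_union_le _ _).trans (add_le_add ?_ ?_))
    · refine (measure_union_le _ _).trans ?_
      rw [nu_EE_compl, add_zero]
    · exact (measure_union_le _ _).trans (add_le_add k1 k2)
  have hG2 : ENNReal.ofReal (v/2) ≤ nu r ρ G := by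
    rw [← ENNReal.ofReal_add (by positivity) (by positivity), hVv] at hcov
    have : ENNReal.ofReal v = ENNReal.ofReal (v/2) + ENNReal.ofReal (v/4 + v/4) := by
      rw [← ENNReal.ofReal_add (by positivity) (by positivity)]; congr 1; ring
    rw [this] at hcov
    exact (ENNReal.add_le_add_iff_right ENNReal.ofReal_ne_top).mp hcov
  have h3 := nu_le hr hρ hrρ G hGm
  have h4 : ENNReal.ofReal (r ^ (Fintype.card J * Fintype.card (J ⊕ K))) * ENNReal.ofReal (v/2) ≤ 
      ENNReal.ofReal (2 ^ Fintype.card K) * volume G := le_trans (by gcongr) h3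
  rw [← ENNReal.ofReal_mul (by positivity)] at h4
  have h5 : ENNReal.ofReal (r ^ (Fintype.card J * Fintype.card (J ⊕ K)) * (v/2)) = ENNReal.ofReal (2 ^ Fintype.card K) * 
     ENNReal.ofReal (v / 2 / 2 ^ Fintype.card K * r ^ (Fintype.card J * Fintype.card (J ⊕ K))) := by
    rw [← ENNReal.ofReal_mul (by positivity)]; congr 1; field_simp
  rw [h5] at h4
  exact (ENNReal.mul_le_mul_iff_right (by simp) ENNReal.ofReal_ne_top).mp h4

lemma submatrix_mulVec' {κ : Type*} [Fintype κ] [DecidableEq κ] (e : J ⊕ K ≃ κ) (h : Matrix κ κ ℝ) (w : κ → ℤ) (a : J ⊕ K) :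
    (h.submatrix e e *ᵥ vR (w ∘ e)) a = (h *ᵥ vR w) (e a) := by
  simp only [mulVec, dotProduct, submatrix_apply]
  exact Fintype.sum_equiv e _ _ fun x => rfl

lemma badS_reindex {κ : Type*} [Fintype κ] [DecidableEq κ] (e : J ⊕ K ≃ κ) (h : Matrix κ κ ℝ) (β : κ → ℝ) :
    h ∈ badS β ↔ h.submatrix e e ∈ badS (β ∘ e) := by
  constructor
  · rintro ⟨w, hw, h1⟩
    refine ⟨w ∘ e, fun h0 => hw ?_, fun a => ?_⟩
    · ext x; have := congrFun h0 (e.symm x); simpa using this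
    · rw [submatrix_mulVec']; exact h1 _
  · rintro ⟨w, hw, h1⟩
    refine ⟨w ∘ e.symm, fun h0 => hw ?_, fun a => ?_⟩
    · ext x; have := congrFun h0 (e x); simpa using this
    · have := h1 (e.symm a)
      have h2 := submatrix_mulVec' e h (w ∘ e.symm) (e.symm a)
      have h3 : (w ∘ e.symm) ∘ e = w := by ext; simp
      rw [h3] at h2
      rw [h2] at this
      simpa using this

/-- The package of facts about the family of matrices with `|J|` short columns. -/
theorem pack {κ : Type*} [Fintype κ] [DecidableEq κ] [Nonempty K] (e : J ⊕ K ≃ κ) : 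
    ∃ H : ℝ → Set (Matrix κ κ ℝ), ∃ c : ℝ, 0 < c ∧ ∃ Cst : ℝ, 0 ≤ Cst ∧ ∃ D : ℝ, 1 ≤ D ∧
    ∀ r : ℝ, 0 < r → r ≤ 1 → MeasurableSet (H r) ∧
      (∀ h ∈ H r, (∀ a c, |h a (e (Sum.inl c))| ≤ 2 * r) ∧ D⁻¹ ≤ |h.det| ∧ |h.det| ≤ D ∧
        r ^ Fintype.card J / 2 ≤ |(h.submatrix (e ∘ Sum.inl) (e ∘ Sum.inl)).det|) ∧
      (∀ h0 ∈ H r, ∀ h ∈ H r, Bd D (h0⁻¹ * h)) ∧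
      (∀ β1 β2 : κ → ℝ, (∀ a, 0 < β1 a) → (∀ a, 0 < β2 a) → ∀ a1 a2, 
        Cst * (∏ a, β1 a) * (1 + r⁻¹ ^ Fintype.card κ * β1 a1 ^ (-(1/2) : ℝ)) ≤ 1 → 
        Cst * (∏ a, β2 a) * (1 + r⁻¹ ^ Fintype.card κ * β2 a2 ^ (-(1/2) : ℝ)) ≤ 1 → 
        ENNReal.ofReal (c * r ^ (Fintype.card J * Fintype.card κ)) ≤ volume ((H r \ badS β1) \ badS β2)) := by
  obtain ⟨M, hM, hquot⟩ := EE_quot (J := J) (K := K)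
  obtain ⟨D, hD, hfacts⟩ := EE_facts (J := J) (K := K)
  obtain ⟨c, hc, Cst, hCst, hvol⟩ := EE_vol (J := J) (K := K)
  set ρ : ℝ → ℝ := fun r => r ^ (-((Fintype.card J : ℝ) / Fintype.card K)) with hρdef
  have hcK : (0 : ℝ) < Fintype.card K := by exact_mod_cast Fintype.card_pos
  have hcard : Fintype.card (J ⊕ K) = Fintype.card κ := Fintype.card_congr e
  have hρ : ∀ r : ℝ, 0 < r → r ≤ 1 → 0 < ρ r ∧ r ≤ ρ r ∧ r ^ Fintype.card J * (ρ r) ^ Fintype.card K = 1 := by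
    intro r hr hr1
    have h1 : 1 ≤ ρ r := Real.one_le_rpow_of_pos_of_le_one_of_nonpos hr hr1 (by
      rw [neg_nonpos]; positivity)
    refine ⟨by linarith, by linarith, ?_⟩
    simp only [hρdef]
    rw [← Real.rpow_natCast (r ^ _) (Fintype.card K), ← Real.rpow_mul hr.le, ← Real.rpow_natCast r, ← Real.rpow_add hr]
    have : (Fintype.card J : ℝ) + -((Fintype.card J : ℝ) / Fintype.card K) * Fintype.card K = 0 := by
      field_simp; ring
    rw [this, Real.rpow_zero]
  have hmp := mp_reindex e
  refine ⟨fun r => {h | h.submatrix e e ∈ EE r (ρ r)}, c, hc, Cst, hCst, M + D, by linarith, ?_⟩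
  intro r hr hr1
  obtain ⟨hρ0, hrρ, hrel⟩ := hρ r hr hr1
  have hEm := measurableSet_EE (J := J) (K := K) r (ρ r)
  refine ⟨hmp.measurable hEm, ?_, ?_, ?_⟩
  · intro h hh
    obtain ⟨q1, q2, q3, q4⟩ := hfacts r (ρ r) hr hrel _ hh
    rw [det_submatrix_equiv_self] at q2 q3
    refine ⟨fun a c => ?_, ?_, by linarith, ?_⟩
    · have := q1 (e.symm a) c
      simpa using this
    · refine le_trans (inv_anti₀ (by linarith) (by linarith)) q2
    · rw [submatrix_submatrix] at q4
      exact q4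
  · intro h0 hh0 h hh
    have := hquot r (ρ r) hr hrρ hrel _ hh0 _ hh
    rw [inv_submatrix_equiv, submatrix_mul_equiv] at this
    intro a b
    have h2 := this (e.symm a) (e.symm b)
    simp only [submatrix_apply, Equiv.apply_symm_apply] at h2
    linarith
  · intro β1 β2 hβ1 hβ2 a1 a2 k1 k2
    have hp : ∀ β : κ → ℝ, ∏ a, (β ∘ e) a = ∏ a, β a := fun β => Fintype.prod_equiv e _ _ fun x => rfl
    have := hvol r (ρ r) hr hr1 hρ0 hrel (β1 ∘ e) (β2 ∘ e) (fun a => hβ1 _) (fun a => hβ2 _) (e.symm a1) (e.symm a2) 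
      (by rw [hp, hcard]; simpa using k1) (by rw [hp, hcard]; simpa using k2)
    rw [hcard] at this
    refine this.trans (le_of_eq ?_)
    rw [← hmp.measure_preimage ((hEm.diff (measurableSet_badS _)).diff (measurableSet_badS _)).nullMeasurableSet]
    congr 1
    ext h
    simp only [Set.mem_preimage, Set.mem_sdiff, Set.mem_ofPred_eq]
    rw [badS_reindex e h β1, badS_reindex e h β2]
end pk
end KM

open MeasureTheory
open scoped ENNReal
namespace KM
set_option linter.unusedSectionVars false
set_option linter.unusedSimpArgs false
set_option linter.unusedVariables false
open Matrix

section l7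
variable {κ : Type*} [Fintype κ] [DecidableEq κ]

lemma vol_mul_left {l : Type*} [Fintype l] [DecidableEq l] (V : Matrix κ κ ℝ) (hV : V.det = 1) (S : Set (Matrix κ l ℝ)) (hS : MeasurableSet S) :
    volume {h : Matrix κ l ℝ | V * h ∈ S} = volume S := by
  have hm : MeasurableSet {h : Matrix κ l ℝ | V * h ∈ S} := (meas_mul_left V) hS
  have := lintegral_mul_left (l := l) V (by rw [hV]; norm_num) (S.indicator 1) (measurable_one.indicator hS)
  rw [hV] at this
  simp only [abs_one, inv_one, one_pow, ENNReal.ofReal_one, one_mul] at this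
  rw [lintegral_indicator_one hS] at this
  rw [← this, ← lintegral_indicator_one hm]
  rfl

def GG (ω : κ → ℝ) (M k : ℝ) (E : Set (Matrix κ κ ℝ)) : Set (Matrix κ κ ℝ) :=
  {g | g ∈ Om M ∧ ∃ W : Matrix κ κ ℤ, W.det ≠ 0 ∧ ∃ h ∈ E, fl ω k * g = h * toR W}

def GW (ω : κ → ℝ) (M k : ℝ) (E : Set (Matrix κ κ ℝ)) (W : Matrix κ κ ℤ) : Set (Matrix κ κ ℝ) :=
  {g | g ∈ Om M ∧ fl ω k * g * (toR W)⁻¹ ∈ E}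

lemma measurableSet_GW (ω : κ → ℝ) (M k : ℝ) {E : Set (Matrix κ κ ℝ)} (hE : MeasurableSet E) (W : Matrix κ κ ℤ) :
    MeasurableSet (GW ω M k E W) := by
  have h1 : MeasurableSet {g : Matrix κ κ ℝ | fl ω k * g * (toR W)⁻¹ ∈ E} :=
    ((meas_mul_right (toR W)⁻¹).comp (meas_mul_left (fl ω k))) hE
  exact (measurableSet_Om M).inter h1

lemma GG_eq (ω : κ → ℝ) (M k : ℝ) (E : Set (Matrix κ κ ℝ)) :
    GG ω M k E = ⋃ W : {W : Matrix κ κ ℤ // W.det ≠ 0}, GW ω M k E W.1 := by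
  ext g
  simp only [GG, GW, Set.mem_iUnion, Set.mem_ofPred_eq]
  constructor
  · rintro ⟨h1, W, hW, h, hh, he⟩
    refine ⟨⟨W, hW⟩, h1, ?_⟩
    rw [he, mul_nonsing_inv_cancel_right _ _ (det_toR_ne W hW).isUnit]
    exact hh
  · rintro ⟨⟨W, hW⟩, h1, h2⟩
    exact ⟨h1, W, hW, _, h2, by rw [nonsing_inv_mul_cancel_right _ _ (det_toR_ne W hW).isUnit]⟩

lemma measurableSet_GG (ω : κ → ℝ) (M k : ℝ) {E : Set (Matrix κ κ ℝ)} (hE : MeasurableSet E) :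
    MeasurableSet (GG ω M k E) := by
  rw [GG_eq]; exact MeasurableSet.iUnion fun W => measurableSet_GW _ _ _ hE _

lemma vol_EW (ω : κ → ℝ) (hω : ∑ a, ω a = 0) (M k : ℝ) {E : Set (Matrix κ κ ℝ)} (hE : MeasurableSet E) 
    (W : Matrix κ κ ℤ) (hW : W.det ≠ 0) :
    volume {h : Matrix κ κ ℝ | h ∈ E ∧ fl ω (-k) * h * toR W ∈ Om M} ≤ volume (GW ω M k E W) := by
  have hS := measurableSet_GW ω M k hE W
  have h1 := vol_mul_right (κ := κ) (toR W) (det_toR_ne W hW) _ hS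
  have h2 := vol_mul_left (l := κ) (fl ω (-k)) (det_fl ω (-k) hω) {h | h * toR W ∈ GW ω M k E W} ((meas_mul_right (toR W)) hS)
  have hsub : {h : Matrix κ κ ℝ | h ∈ E ∧ fl ω (-k) * h * toR W ∈ Om M} ⊆ {h : Matrix κ κ ℝ | fl ω (-k) * h ∈ {h : Matrix κ κ ℝ | h * toR W ∈ GW ω M k E W}} := by
    rintro h ⟨hh, h3⟩
    refine ⟨h3, ?_⟩
    rw [mul_assoc (fl ω k), mul_nonsing_inv_cancel_right _ _ (det_toR_ne W hW).isUnit, ← mul_assoc, fl_mul_neg, one_mul]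
    exact hh
  refine (measure_mono hsub).trans ?_
  rw [h2, h1]
  calc _ ≤ 1 * volume (GW ω M k E W) := by
        refine mul_le_mul_left ?_ _
        rw [ENNReal.ofReal_le_one]
        exact pow_le_one₀ (by positivity) (inv_le_one_of_one_le₀ (one_le_abs_det W hW))
    _ = _ := one_mul _

lemma toR_inj : Function.Injective (toR : Matrix κ κ ℤ → Matrix κ κ ℝ) := by
  intro A B h
  ext a b
  have := congrFun (congrFun h a) b
  simpa [toR_apply] using this

lemma mult_bound (D D0 : ℝ) : ∃ N : ℕ, ∀ S : Set (Matrix κ κ ℤ), (∀ W ∈ S, W.det ≠ 0 ∧ |(W.det : ℝ)| ≤ D0) →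
    (∀ W0 ∈ S, ∀ W ∈ S, Bd D (toR W0 * (toR W)⁻¹)) → S.encard ≤ N := by
  obtain ⟨R, hR⟩ := exists_nat_ge D0
  obtain ⟨R2, hR2⟩ := exists_nat_ge (|D0| * |D|)
  set F : Finset (ℤ × (κ → κ → ℤ)) := Finset.Icc (-(R:ℤ)) R ×ˢ Fintype.piFinset fun _ => Fintype.piFinset fun _ => Finset.Icc (-(R2:ℤ)) R2 with hF
  refine ⟨F.card, fun S h1 h2 => ?_⟩
  rcases S.eq_empty_or_nonempty with rfl | ⟨W0, hW0⟩
  · simp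
  have hinj : Set.InjOn (fun W : Matrix κ κ ℤ => ((W.det, W0 * W.adjugate) : ℤ × (κ → κ → ℤ))) S := by
    intro W hW W' hW' he
    have e1 : W.det = W'.det := congrArg Prod.fst he
    have e2' : W0 * W.adjugate = W0 * W'.adjugate := congrArg Prod.snd he
    have hd := (h1 W hW).1
    have hY : (W0 * W.adjugate).det ≠ 0 := by
      rw [det_mul]
      refine mul_ne_zero (h1 _ hW0).1 ?_
      intro h0
      have := congrArg det (mul_adjugate W)
      rw [det_mul, h0, mul_zero, det_smul, det_one, mul_one] at this
      exact pow_ne_zero _ hd this.symm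
    have k1 : (W0 * W.adjugate) * W = (W0 * W.adjugate) * W' := by
      conv_rhs => rw [e2']
      rw [mul_assoc, mul_assoc, adjugate_mul, adjugate_mul, e1]
    have k2 : toR (W0 * W.adjugate) * toR W = toR (W0 * W.adjugate) * toR W' := by
      rw [← toR_mul, ← toR_mul, k1]
    have hu := (det_toR_ne _ hY).isUnit
    apply toR_inj
    rw [← nonsing_inv_mul_cancel_left _ (toR W) hu, k2, nonsing_inv_mul_cancel_left _ _ hu]
  have hmaps : Set.MapsTo (fun W : Matrix κ κ ℤ => ((W.det, W0 * W.adjugate) : ℤ × (κ → κ → ℤ))) S F := by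
    intro W hW
    obtain ⟨hd, hd2⟩ := h1 W hW
    refine Finset.mem_coe.2 (Finset.mem_product.2 ⟨Finset.mem_Icc.2 ?_, Fintype.mem_piFinset.2 fun a => Fintype.mem_piFinset.2 fun b => Finset.mem_Icc.2 ?_⟩)
    · change -(R:ℤ) ≤ W.det ∧ W.det ≤ R
      rw [← abs_le]
      have : (|W.det| : ℝ) ≤ R := hd2.trans hR
      exact_mod_cast this
    · change -(R2:ℤ) ≤ (W0 * W.adjugate) a b ∧ (W0 * W.adjugate) a b ≤ R2
      rw [← abs_le]
      have hb := h2 W0 hW0 W hW a b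
      have e : toR (W0 * W.adjugate) = (W.det : ℝ) • (toR W0 * (toR W)⁻¹) := by
        have hu := (det_toR_ne W hd).isUnit
        have : toR W.adjugate = (W.det : ℝ) • (toR W)⁻¹ := by
          rw [← nonsing_inv_mul_cancel_left _ (toR W.adjugate) hu, toR_adj, Matrix.mul_smul, mul_one]
        rw [toR_mul, this, Matrix.mul_smul]
      have e' := congrFun (congrFun e a) b
      rw [toR_apply, Matrix.smul_apply, smul_eq_mul] at e'
      have : |(((W0 * W.adjugate) a b : ℤ) : ℝ)| ≤ R2 := by
        rw [e', abs_mul]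
        refine le_trans (mul_le_mul (hd2.trans (le_abs_self _)) (hb.trans (le_abs_self _)) (abs_nonneg _) (abs_nonneg _)) hR2
      exact_mod_cast this
  calc S.encard ≤ (F : Set (ℤ × (κ → κ → ℤ))).encard := Set.encard_le_encard_of_injOn hmaps hinj
    _ = F.card := Set.encard_coe_eq_coe_finsetCard F

lemma L7 (D δ : ℝ) (hD : 1 ≤ D) (hδ : 0 < δ) : ∃ M : ℝ, 1 ≤ M ∧ ∃ c : ℝ, 0 < c ∧ ∀ ω : κ → ℝ, ∑ a, ω a = 0 → ∀ k : ℝ, 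
    ∀ E : Set (Matrix κ κ ℝ), MeasurableSet E → (∀ h ∈ E, D⁻¹ ≤ |h.det| ∧ |h.det| ≤ D) → 
    (∀ h0 ∈ E, ∀ h ∈ E, Bd D (h0⁻¹ * h)) → 
    (∀ h ∈ E, ∀ w : κ → ℤ, w ≠ 0 → ∃ a, δ < |((fl ω (-k) * h) *ᵥ vR w) a|) → 
    ENNReal.ofReal c * volume E ≤ volume (GG ω M k E) := by
  obtain ⟨M0, hM0, h5⟩ := L5 (κ := κ) D δ (by linarith) hδ
  set M := M0 + D with hM
  obtain ⟨N, hN⟩ := mult_bound (κ := κ) D (dC κ M * D)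
  refine ⟨M, by linarith, ((N : ℝ) + 1)⁻¹, by positivity, fun ω hω k E hE hdet hquot hδE => ?_⟩
  have hdne : ∀ h ∈ E, h.det ≠ 0 := by
    intro h hh h0
    have := (hdet h hh).1
    rw [h0, abs_zero] at this
    have : 0 < D⁻¹ := by positivity
    linarith
  have hcov : E ⊆ ⋃ W : {W : Matrix κ κ ℤ // W.det ≠ 0}, {h : Matrix κ κ ℝ | h ∈ E ∧ fl ω (-k) * h * toR W.1 ∈ Om M} := by
    intro h hh
    have hd : (fl ω (-k) * h).det = h.det := by rw [det_mul, det_fl ω _ hω, one_mul]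
    obtain ⟨W, hW, hb⟩ := h5 (fl ω (-k) * h) (by rw [hd]; exact hdne h hh) (by rw [hd]; exact (hdet h hh).2) (hδE h hh)
    refine Set.mem_iUnion.mpr ⟨⟨W, hW⟩, hh, hb.mono (by linarith), ?_⟩
    rw [det_mul, hd, abs_mul]
    calc M⁻¹ ≤ D⁻¹ := inv_anti₀ (by linarith) (by linarith)
      _ ≤ |h.det| := (hdet h hh).1
      _ ≤ _ := le_mul_of_one_le_right (abs_nonneg _) (one_le_abs_det W hW)
  have h1 : volume E ≤ ∑' W : {W : Matrix κ κ ℤ // W.det ≠ 0}, volume (GW ω M k E W.1) :=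
    (measure_mono hcov).trans ((measure_iUnion_le _).trans (ENNReal.tsum_le_tsum fun W => vol_EW ω hω M k hE W.1 W.2))
  have hGm := measurableSet_GG ω M k hE
  have h2 : ∑' W : {W : Matrix κ κ ℤ // W.det ≠ 0}, volume (GW ω M k E W.1) ≤ N * volume (GG ω M k E) := by
    have e1 : ∀ W : {W : Matrix κ κ ℤ // W.det ≠ 0}, volume (GW ω M k E W.1) = ∫⁻ g, (GW ω M k E W.1).indicator (1 : Matrix κ κ ℝ → ℝ≥0∞) g := 
      fun W => (lintegral_indicator_one (measurableSet_GW _ _ _ hE _)).symm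
    simp_rw [e1]
    rw [← lintegral_tsum (fun W => (measurable_one.indicator (measurableSet_GW _ _ _ hE _)).aemeasurable)]
    rw [← lintegral_indicator_one hGm, ← lintegral_const_mul _ (measurable_one.indicator hGm)]
    refine lintegral_mono fun g => ?_
    by_cases hg : g ∈ GG ω M k E
    · rw [Set.indicator_of_mem hg, Pi.one_apply, mul_one]
      set S : Set (Matrix κ κ ℤ) := {W | W.det ≠ 0 ∧ g ∈ GW ω M k E W} with hS
      have hSN : S.encard ≤ N := by
        have fac : ∀ W ∈ S, fl ω k * g = (fl ω k * g * (toR W)⁻¹) * toR W := by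
          intro W hW
          rw [nonsing_inv_mul_cancel_right _ _ (det_toR_ne W hW.1).isUnit]
        refine hN S (fun W hW => ⟨hW.1, ?_⟩) ?_
        · have h3 := hW.2.2
          have h4 := congrArg det (fac W hW)
          rw [det_mul, det_mul, det_fl ω k hω, one_mul, det_toR] at h4
          have h5 := (hdet _ h3).1
          have h6 := hW.2.1.1.det_le
          rw [h4, abs_mul] at h6
          have hD0 : 0 < D := by linarith
          have : D⁻¹ * |(W.det : ℝ)| ≤ dC κ M := le_trans (mul_le_mul_of_nonneg_right h5 (abs_nonneg _)) h6
          rw [inv_mul_le_iff₀ hD0] at this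
          linarith
        · intro W0 hW0 W hW
          have h3 := hquot _ hW0.2.2 _ hW.2.2
          have e : toR W0 * (toR W)⁻¹ = (fl ω k * g * (toR W0)⁻¹)⁻¹ * (fl ω k * g * (toR W)⁻¹) := by
            have hu := (hdne _ hW0.2.2).isUnit
            have : fl ω k * g * (toR W)⁻¹ = (fl ω k * g * (toR W0)⁻¹) * (toR W0 * (toR W)⁻¹) := by
              rw [← mul_assoc, ← fac W0 hW0]
            rw [this, nonsing_inv_mul_cancel_left _ _ hu]
          rw [e]; exact h3
      have hle : ∑' W : {W : Matrix κ κ ℤ // W.det ≠ 0}, (GW ω M k E W.1).indicator (1 : Matrix κ κ ℝ → ℝ≥0∞) g ≤ ∑' W : Matrix κ κ ℤ, S.indicator (fun _ => (1 : ℝ≥0∞)) W := by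
        refine (ENNReal.tsum_le_tsum fun W => ?_).trans (ENNReal.tsum_comp_le_tsum_of_injective Subtype.val_injective _)
        by_cases hw : g ∈ GW ω M k E W.1
        · have : W.1 ∈ S := ⟨W.2, hw⟩
          rw [Set.indicator_of_mem hw, Set.indicator_of_mem this]; rfl
        · rw [Set.indicator_of_notMem hw]; exact zero_le
      refine hle.trans ?_
      rw [← tsum_subtype, ENNReal.tsum_set_one]
      exact_mod_cast hSN
    · rw [Set.indicator_of_notMem hg, mul_zero]
      refine le_of_eq (ENNReal.tsum_eq_zero.mpr fun W => Set.indicator_of_notMem (fun hh => hg ?_) _)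
      rw [GG_eq]; exact Set.mem_iUnion.mpr ⟨W, hh⟩
  calc ENNReal.ofReal ((N : ℝ) + 1)⁻¹ * volume E ≤ ENNReal.ofReal ((N : ℝ) + 1)⁻¹ * (N * volume (GG ω M k E)) := by
        exact mul_le_mul_right (h1.trans h2) _
    _ = (ENNReal.ofReal ((N : ℝ) + 1)⁻¹ * N) * volume (GG ω M k E) := by rw [mul_assoc]
    _ ≤ 1 * volume (GG ω M k E) := by
        refine mul_le_mul_left ?_ _
        rw [← ENNReal.ofReal_natCast, ← ENNReal.ofReal_mul (by positivity), ENNReal.ofReal_le_one, inv_mul_le_iff₀ (by positivity)]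
        linarith
    _ = _ := one_mul _
end l7
end KM

open MeasureTheory
open scoped ENNReal
namespace KM
set_option linter.unusedSectionVars false
set_option linter.unusedSimpArgs false
set_option linter.unusedVariables false
open Matrix

section l8
variable {κ : Type*} [Fintype κ] [DecidableEq κ]
variable {J K : Type*} [Fintype J] [Fintype K] [DecidableEq J] [DecidableEq K]

def HE (e : J ⊕ K ≃ κ) (D r : ℝ) (E : Set (Matrix κ κ ℝ)) : Prop :=
  ∀ h ∈ E, (∀ a c, |h a (e (Sum.inl c))| ≤ 2 * r) ∧ D⁻¹ ≤ |h.det| ∧ |h.det| ≤ D ∧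
    r ^ Fintype.card J / 2 ≤ |(h.submatrix (e ∘ Sum.inl) (e ∘ Sum.inl)).det|

lemma GG_det {ω : κ → ℝ} (hω : ∑ a, ω a = 0) {M D k : ℝ} (hD : 1 ≤ D) {g h : Matrix κ κ ℝ} {W : Matrix κ κ ℤ} (hg : g ∈ Om M)
    (hh : D⁻¹ ≤ |h.det|) (he : fl ω k * g = h * toR W) : |(W.det : ℝ)| ≤ dC κ M * D := by
  have h4 := congrArg det he
  rw [det_mul, det_mul, det_fl ω k hω, one_mul, det_toR] at h4
  have h6 := hg.1.det_le
  rw [h4, abs_mul] at h6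
  have hD0 : 0 < D := by linarith
  have : D⁻¹ * |(W.det : ℝ)| ≤ dC κ M := le_trans (mul_le_mul_of_nonneg_right hh (abs_nonneg _)) h6
  rw [inv_mul_le_iff₀ hD0] at this
  linarith

lemma adj_col {ω : κ → ℝ} {k : ℝ} {g h : Matrix κ κ ℝ} {W : Matrix κ κ ℤ} (he : fl ω k * g = h * toR W) (a b : κ) :
    ((fl ω k * g) *ᵥ vR (W.adjugate.col b)) a = W.det * h a b := by
  rw [← mul_toR_col, he, mul_assoc, toR_adj, Matrix.mul_smul, mul_one, Matrix.smul_apply, smul_eq_mul]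

lemma fl_mulVec_inv (ω : κ → ℝ) (k : ℝ) (g : Matrix κ κ ℝ) (v : κ → ℝ) (a : κ) :
    (g *ᵥ v) a = Real.exp (-k * ω a) * ((fl ω k * g) *ᵥ v) a := by
  rw [← mulVec_mulVec, fl_mulVec, ← mul_assoc, ← Real.exp_add]
  simp

lemma W_adj_col (W : Matrix κ κ ℤ) (b : κ) : W *ᵥ (W.adjugate.col b) = W.det • Pi.single b 1 := by
  have : W *ᵥ (W.adjugate.col b) = (W * W.adjugate).col b := by
    ext a; simp [mulVec, dotProduct, mul_apply]
  rw [this, mul_adjugate]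
  ext a
  change (W.det • (1 : Matrix κ κ ℤ)) a b = _
  rw [Matrix.smul_apply]
  simp [one_apply, Pi.single_apply]

lemma adj_linInd (W : Matrix κ κ ℤ) (hW : W.det ≠ 0) (φ : J → κ) (hφ : Function.Injective φ) :
    LinearIndependent ℝ (fun c => vR (W.adjugate.col (φ c))) := by
  rw [← linInd_mulVec_iff (toR W) (det_toR_ne W hW)]
  simp_rw [← vR_mulVec, W_adj_col]
  have e : (fun c => vR (W.det • (Pi.single (φ c) 1 : κ → ℤ))) = fun c => ((Units.mk0 (W.det : ℝ) (by exact_mod_cast hW)) • (Pi.single (φ c) (1:ℝ) : κ → ℝ)) := by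
    ext c a
    by_cases h : a = φ c
    · subst h; simp [vR]
    · simp [vR, Pi.single_apply, h]
  rw [e]
  have h1 : LinearIndependent ℝ (fun c => (Pi.single (φ c) (1:ℝ) : κ → ℝ)) := by
    have := (Pi.basisFun ℝ κ).linearIndependent.comp φ hφ
    convert this using 2
    simp
  exact h1.units_smul (fun _ => Units.mk0 (W.det : ℝ) (by exact_mod_cast hW))

/-- members of `GG` have `|J|` short independent vectors -/
lemma GG_small {ω : κ → ℝ} (hω : ∑ a, ω a = 0) {e : J ⊕ K ≃ κ} {M D k r : ℝ} (hD : 1 ≤ D) (hr : 0 < r) {E : Set (Matrix κ κ ℝ)} (hE : HE e D r E)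
    {g : Matrix κ κ ℝ} (hg : g ∈ GG ω M k E) : Small J (fl ω k * g) (dC κ M * D * (2 * r)) := by
  obtain ⟨h1, W, hW, h, hh, he⟩ := hg
  obtain ⟨q1, q2, q3, q4⟩ := hE h hh
  have hd := GG_det hω hD h1 q2 he
  refine ⟨fun c => W.adjugate.col (e (Sum.inl c)), adj_linInd W hW _ (e.injective.comp Sum.inl_injective), fun c a => ?_⟩
  rw [adj_col he, abs_mul]
  exact mul_le_mul hd (q1 a c) (abs_nonneg _) (le_trans (abs_nonneg _) hd)

lemma L8 (e : J ⊕ K ≃ κ) (ω : κ → ℝ) (hω : ∑ a, ω a = 0) (hσ : 0 < ∑ c : J, ω (e (Sum.inl c))) (M D : ℝ) (hM : 1 ≤ M) (hD : 1 ≤ D) :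
    ∃ s0 : ℝ, 0 < s0 ∧ ∃ C : ℝ, 0 ≤ C ∧ ∀ k l r r' : ℝ, k + s0 ≤ l → 0 < r' → r' ≤ r → ∀ E E' : Set (Matrix κ κ ℝ),
      HE e D r E → HE e D r' E' → volume (GG ω M k E ∩ GG ω M l E') ≤ 
        ENNReal.ofReal (C * (r ^ (Fintype.card J * Fintype.card κ) * r' ^ Fintype.card κ)) := by
  set σ := ∑ c : J, ω (e (Sum.inl c)) with hσdef
  set D0 := dC κ M * D with hD0
  have hD0p : 0 < D0 := mul_pos (dC_pos M (by linarith)) (by linarith)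
  obtain ⟨C, hC, h3⟩ := L3 (κ := κ) (Option J) M hM
  set Y : ℝ := 2 * (D0 ^ Fintype.card J * dC J 2) with hY
  have hYp : 0 < Y := by have := dC_pos (κ := J) 2 (by norm_num); positivity
  refine ⟨(Y + 1) / σ, by positivity, C * (D0 * 2) ^ (Fintype.card (Option J) * Fintype.card κ), by positivity, ?_⟩
  intro k l r r' hkl hr' hrr E E' hE hE'
  have hr : 0 < r := by linarith
  set β : κ → Option J → ℝ := fun a c => Option.elim c (Real.exp (-l * ω a) * (D0 * (2 * r'))) (fun _ => Real.exp (-k * ω a) * (D0 * (2 * r))) with hβ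
  have hβ0 : ∀ a c, 0 ≤ β a c := by
    intro a c
    cases c <;> simp only [hβ, Option.elim] <;> positivity
  have hprod : ∀ s x : ℝ, ∏ a, Real.exp (-s * ω a) * x = x ^ Fintype.card κ := by
    intro s x
    rw [Finset.prod_mul_distrib, ← Real.exp_sum, ← Finset.mul_sum, hω]; simp
  have hβp : ∏ c, ∏ a, β a c = (D0 * 2) ^ (Fintype.card (Option J) * Fintype.card κ) * (r ^ (Fintype.card J * Fintype.card κ) * r' ^ Fintype.card κ) := by
    rw [Fintype.prod_option]
    simp only [hβ, Option.elim, hprod, Finset.prod_const, Finset.card_univ, Fintype.card_option]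
    ring
  refine le_trans (measure_mono ?_) ((h3 β hβ0).trans (ENNReal.ofReal_le_ofReal (by rw [hβp]; linarith)))
  rintro g ⟨⟨hg, W, hW, h, hh, he⟩, ⟨_, W', hW', h', hh', he'⟩⟩
  refine ⟨hg, ?_⟩
  obtain ⟨q1, q2, q3, q4⟩ := hE h hh
  obtain ⟨q1', q2', q3', q4'⟩ := hE' h' hh'
  have hd := GG_det hω hD hg q2 he
  have hd' := GG_det hω hD hg q2' he'
  set u : J → κ → ℤ := fun c => W.adjugate.col (e (Sum.inl c)) with hu
  set u' : J → κ → ℤ := fun c => W'.adjugate.col (e (Sum.inl c)) with hu'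
  have hinj : Function.Injective (fun c : J => e (Sum.inl c)) := e.injective.comp Sum.inl_injective
  by_cases hP : ∀ j (b : K), (W *ᵥ u' j) (e (Sum.inr b)) = 0
  · exfalso
    set T : Matrix J J ℤ := of fun c j => (W *ᵥ u' j) (e (Sum.inl c)) with hT
    set hJ := h.submatrix (e ∘ Sum.inl) (e ∘ Sum.inl) with hhJ
    set hJ' := h'.submatrix (e ∘ Sum.inl) (e ∘ Sum.inl) with hhJ'
    have key : (W'.det : ℝ) • hJ' = diagonal (fun c : J => Real.exp ((l - k) * ω (e (Sum.inl c)))) * (hJ * toR T) := by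
      ext c j
      rw [Matrix.smul_apply, smul_eq_mul, diagonal_mul]
      have h1 := adj_col he' (e (Sum.inl c)) (e (Sum.inl j))
      have h2 : (fl ω l * g) = fl ω (l - k) * (h * toR W) := by
        rw [← he, ← mul_assoc, fl_add]; congr 2; ring
      rw [h2, ← mulVec_mulVec, fl_mulVec, ← mulVec_mulVec, ← vR_mulVec] at h1
      change (W'.det : ℝ) * h' (e (Sum.inl c)) (e (Sum.inl j)) = _
      rw [← h1]
      congr 1
      have h4 : ∀ b : K, vR (W *ᵥ W'.adjugate.col (e (Sum.inl j))) (e (Sum.inr b)) = 0 := by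
        intro b
        have := hP j b
        simp only [vR]
        exact_mod_cast this
      rw [mulVec, dotProduct, ← e.sum_comp, Fintype.sum_sum_type, mul_apply]
      simp only [h4, mul_zero, Finset.sum_const_zero, add_zero]
      rfl
    have kd := congrArg det key
    rw [det_smul, det_mul, det_mul, det_diagonal, ← Real.exp_sum, ← Finset.mul_sum, ← hσdef, det_toR] at kd
    have ka := congrArg abs kd
    simp only [abs_mul, abs_pow, Real.abs_exp] at ka
    have hTne : T.det ≠ 0 := by
      intro h0
      rw [h0] at ka
      simp only [Int.cast_zero, abs_zero, mul_zero] at ka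
      have : 0 < |(W'.det : ℝ)| ^ Fintype.card J := pow_pos (abs_pos.2 (by exact_mod_cast hW')) _
      have : 0 < |hJ'.det| := lt_of_lt_of_le (by positivity) q4'
      have := mul_pos ‹0 < |(W'.det : ℝ)| ^ Fintype.card J› this
      linarith
    have hT1 : 1 ≤ |(T.det : ℝ)| := by exact_mod_cast Int.one_le_abs hTne
    have hup : |(W'.det : ℝ)| ^ Fintype.card J * |hJ'.det| ≤ D0 ^ Fintype.card J * (dC J 2 * r' ^ Fintype.card J) := by
      refine mul_le_mul (pow_le_pow_left₀ (abs_nonneg _) hd' _) ?_ (abs_nonneg _) (by positivity)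
      have : Bd (2 * r') hJ' := fun a c => q1' _ c
      refine this.det_le.trans (le_of_eq ?_)
      rw [dC, dC, mul_pow, mul_assoc]
    have hlow : Real.exp ((l - k) * σ) * (r ^ Fintype.card J / 2) ≤ Real.exp ((l - k) * σ) * (|hJ.det| * |(T.det : ℝ)|) := by
      refine mul_le_mul_of_nonneg_left ?_ (Real.exp_pos _).le
      exact q4.trans (le_mul_of_one_le_right (abs_nonneg _) hT1)
    rw [← ka] at hlow
    have hpow : r' ^ Fintype.card J ≤ r ^ Fintype.card J := pow_le_pow_left₀ hr'.le hrr _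
    have hexp : Y + 1 < Real.exp ((l - k) * σ) := by
      have : Y + 1 ≤ (l - k) * σ := by
        rw [← div_le_iff₀ hσ]; linarith
      have := Real.add_one_le_exp ((l - k) * σ)
      linarith
    have hrp : 0 < r ^ Fintype.card J := by positivity
    have h9 : Real.exp ((l - k) * σ) * (r ^ Fintype.card J / 2) ≤ D0 ^ Fintype.card J * (dC J 2 * r ^ Fintype.card J) := by
      refine (hlow.trans hup).trans ?_
      have := dC_pos (κ := J) 2 (by norm_num)
      gcongr
    have h10 : (Y + 1) * (r ^ Fintype.card J / 2) < Real.exp ((l - k) * σ) * (r ^ Fintype.card J / 2) := 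
      mul_lt_mul_of_pos_right hexp (by positivity)
    have h11 : (Y + 1) * (r ^ Fintype.card J / 2) = D0 ^ Fintype.card J * (dC J 2 * r ^ Fintype.card J) + r ^ Fintype.card J / 2 := by
      rw [hY]; ring
    linarith
  · push Not at hP
    obtain ⟨j0, b, hb⟩ := hP
    refine ⟨fun o => Option.elim o (u' j0) u, ?_, ?_⟩
    · have h1 := adj_linInd W hW _ hinj
      have h2 : vR (u' j0) ∉ Submodule.span ℝ (Set.range fun c => vR (u c)) := by
        intro hmem
        have hle : Submodule.span ℝ (Set.range fun c => vR (u c)) ≤ LinearMap.ker ((LinearMap.proj (e (Sum.inr b))).comp (toLin' (toR W))) := by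
          rw [Submodule.span_le]
          rintro _ ⟨c, rfl⟩
          simp only [SetLike.mem_coe, LinearMap.mem_ker, LinearMap.comp_apply, toLin'_apply, LinearMap.proj_apply]
          rw [← vR_mulVec, W_adj_col]
          simp [vR, Pi.single_apply]
        have := hle hmem
        simp only [LinearMap.mem_ker, LinearMap.comp_apply, toLin'_apply, LinearMap.proj_apply] at this
        rw [← vR_mulVec] at this
        simp only [vR] at this
        exact hb (by exact_mod_cast this)
      have h3 := LinearIndependent.option h1 h2
      have h4 : (fun o => vR (Option.elim o (u' j0) u)) = (fun o => Option.casesOn' o (vR (u' j0)) fun c => vR (u c)) := by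
        ext o a
        cases o <;> rfl
      rw [h4]
      exact h3
    · intro o a
      cases o with
      | none =>
        simp only [hβ, Option.elim]
        rw [fl_mulVec_inv ω l, adj_col he', abs_mul, Real.abs_exp, abs_mul]
        exact mul_le_mul_of_nonneg_left (mul_le_mul hd' (q1' a j0) (abs_nonneg _) hD0p.le) (Real.exp_pos _).le
      | some c =>
        simp only [hβ, Option.elim]
        rw [fl_mulVec_inv ω k, adj_col he, abs_mul, Real.abs_exp, abs_mul]
        exact mul_le_mul_of_nonneg_left (mul_le_mul hd (q1 a c) (abs_nonneg _) hD0p.le) (Real.exp_pos _).le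
end l8
end KM

open MeasureTheory
open scoped ENNReal
namespace KM
set_option linter.unusedSectionVars false
set_option linter.unusedSimpArgs false
set_option linter.unusedVariables false
open Matrix

section l9
variable {T B : Type*} [Fintype T] [DecidableEq T] [Fintype B] [DecidableEq B]

lemma avg_ub {S A : Set (Matrix (T ⊕ B) (T ⊕ B) ℝ)} (hS : MeasurableSet S) (hA : MeasurableSet A) (η : ℝ) (c : ℝ≥0∞)
    (h : ∀ g b0, Bd (1/2) b0 → ub (η • b0) * g ∈ S → g ∈ A ∧ 
      volume {b : Matrix B T ℝ | Bd (1/2) b ∧ ub (η • b) * g ∈ S} ≤ c) :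
    volume {b : Matrix B T ℝ | Bd (1/2) b} * volume S ≤ c * volume A := by
  have hBm : MeasurableSet {b : Matrix B T ℝ | Bd (1/2) b} := (isClosed_Bd _).measurableSet
  have hc : Continuous fun x : Matrix B T ℝ × Matrix (T ⊕ B) (T ⊕ B) ℝ => ub (η • x.1) * x.2 := by
    unfold ub
    exact (Continuous.matrix_fromBlocks continuous_const continuous_const (continuous_fst.const_smul η) continuous_const).matrix_mul continuous_snd
  have hm : MeasurableSet {x : Matrix B T ℝ × Matrix (T ⊕ B) (T ⊕ B) ℝ | Bd (1/2) x.1 ∧ ub (η • x.1) * x.2 ∈ S} :=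
    (measurable_fst hBm).inter (hc.measurable hS)
  set Q := {x : Matrix B T ℝ × Matrix (T ⊕ B) (T ⊕ B) ℝ | Bd (1/2) x.1 ∧ ub (η • x.1) * x.2 ∈ S} with hQ
  have e1 := Measure.prod_apply (μ := (volume : Measure (Matrix B T ℝ))) (ν := (volume : Measure (Matrix (T ⊕ B) (T ⊕ B) ℝ))) hm
  have e2 := Measure.prod_apply_symm (μ := (volume : Measure (Matrix B T ℝ))) (ν := (volume : Measure (Matrix (T ⊕ B) (T ⊕ B) ℝ))) hm
  have h1 : volume {b : Matrix B T ℝ | Bd (1/2) b} * volume S ≤ ∫⁻ b : Matrix B T ℝ, volume (Prod.mk b ⁻¹' Q) := by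
    rw [mul_comm, ← lintegral_indicator_const hBm]
    refine lintegral_mono fun b => ?_
    by_cases hb : b ∈ {b : Matrix B T ℝ | Bd (1/2) b}
    · rw [Set.indicator_of_mem hb, ← vol_mul_left (ub (η • b)) (det_ub _) S hS]
      exact measure_mono fun g hg => ⟨hb, hg⟩
    · rw [Set.indicator_of_notMem hb]; exact zero_le
  have h2 : ∫⁻ g : Matrix (T ⊕ B) (T ⊕ B) ℝ, volume ((fun b => (b, g)) ⁻¹' Q) ≤ c * volume A := by
    rw [← lintegral_indicator_const hA]
    refine lintegral_mono fun g => ?_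
    by_cases hg : ∃ b0, Bd (1/2) b0 ∧ ub (η • b0) * g ∈ S
    · obtain ⟨b0, hb0, hb1⟩ := hg
      obtain ⟨h3, h4⟩ := h g b0 hb0 hb1
      rw [Set.indicator_of_mem h3]
      exact h4
    · have : (fun b => (b, g)) ⁻¹' Q = ∅ := by
        ext b
        simp only [Set.mem_preimage, Set.mem_empty_iff_false, iff_false]
        exact fun hb => hg ⟨b, hb⟩
      rw [this, measure_empty]; exact zero_le
  rw [← e1, e2] at h1
  exact h1.trans h2

variable {J K : Type*} [Fintype J] [Fintype K] [DecidableEq J] [DecidableEq K]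

lemma L9 (e : J ⊕ K ≃ T ⊕ B) {p q : ℝ} (hp : 0 ≤ p) (hq : 0 ≤ q) (hpq : Fintype.card T * p = Fintype.card B * q) 
    (M D δ : ℝ) (hM : 1 ≤ M) (hD : 1 ≤ D) (hδ : 0 < δ) :
    ∃ C : ℝ, 0 ≤ C ∧ ∀ k s l r r' : ℝ, 0 ≤ k → 0 ≤ s → k + s ≤ l → 0 < r → 0 < r' → ∀ E E' : Set (Matrix (T ⊕ B) (T ⊕ B) ℝ),
      MeasurableSet E → MeasurableSet E' → HE e D r E → HE e D r' E' → 
      (∀ h ∈ E, ∀ w : T ⊕ B → ℤ, w ≠ 0 → ∃ a, δ < |((fl (om p q) s * h) *ᵥ vR w) a|) →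
      volume (GG (om p q) M k E ∩ GG (om p q) M l E') ≤ 
        ENNReal.ofReal (C * (r ^ (Fintype.card J * Fintype.card (T ⊕ B)) * r' ^ (Fintype.card J * Fintype.card (T ⊕ B)))) := by
  set ω : T ⊕ B → ℝ := om p q with hωd
  have hω : ∑ a, ω a = 0 := sum_om hpq
  set d : ℝ := (Fintype.card (T ⊕ B) : ℝ) with hd
  have hd0 : 0 ≤ d := Nat.cast_nonneg _
  set N : ℕ := Fintype.card J * Fintype.card (T ⊕ B) with hN
  have hN' : Fintype.card (T ⊕ B) * Fintype.card J = N := mul_comm _ _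
  set D0 := dC (T ⊕ B) M * D with hD0
  have hD0p : 0 < D0 := mul_pos (dC_pos M (by linarith)) (by linarith)
  set M' := d * (1 * M) + M with hM'
  have hM'M : M ≤ M' := by have : 0 ≤ d * (1 * M) := by positivity
                           linarith
  obtain ⟨C3, hC3, h3⟩ := L3 (κ := T ⊕ B) J M' (by linarith)
  obtain ⟨M5, hM5, h5⟩ := L5 (κ := T ⊕ B) D δ (by linarith) hδ
  set M'' := M5 + D with hM''
  obtain ⟨C4, hC4, h4⟩ := L4 (T := T) (B := B) J hp hq hpq (M := M'') (by linarith)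
  set V := volume {b : Matrix B T ℝ | Bd (1/2) b} with hV
  have hV0 : V ≠ 0 := (vol_Bd_pos (by norm_num)).ne'
  have hVt : V ≠ ⊤ := (vol_Bd_lt_top _).ne
  set v := V.toReal with hv
  have hv0 : 0 < v := ENNReal.toReal_pos hV0 hVt
  have hVv : V = ENNReal.ofReal v := (ENNReal.ofReal_toReal hVt).symm
  set D5 := dC (T ⊕ B) M'' * D with hD5
  have hD5p : 0 < D5 := mul_pos (dC_pos _ (by linarith)) (by linarith)
  refine ⟨v⁻¹ * ((C4 * (D5 * (D0 * 2)) ^ N) * (C3 * (d * (1 * (D0 * 2))) ^ N)), by positivity, ?_⟩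
  intro k s l r r' hk hs hl hr hr' E E' hEm hE'm hE hE' hδE
  set S := GG ω M k E ∩ GG ω M l E' with hS
  have hSm : MeasurableSet S := (measurableSet_GG _ _ _ hEm).inter (measurableSet_GG _ _ _ hE'm)
  set η := Real.exp (-((k + s) * (p + q))) with hη
  have hη0 : 0 < η := Real.exp_pos _
  have hη1 : η ≤ 1 := Real.exp_le_one_iff.mpr (by have : 0 ≤ (k+s)*(p+q) := by positivity
                                                  linarith)
  set A : Set (Matrix (T ⊕ B) (T ⊕ B) ℝ) := {g | g ∈ Om M' ∧ ∃ w : J → T ⊕ B → ℤ,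
      LinearIndependent ℝ (fun c => vR (w c)) ∧ ∀ c a, |(g *ᵥ vR (w c)) a| ≤ Real.exp (-k * ω a) * (d * (1 * (D0 * (2 * r))))} with hA
  have hAm : MeasurableSet A :=
    (measurableSet_Om M').inter (measurableSet_exBd (fun a (c : J) => Real.exp (-k * ω a) * (d * (1 * (D0 * (2 * r))))) _)
  have hAv : volume A ≤ ENNReal.ofReal (C3 * (d * (1 * (D0 * (2 * r)))) ^ N) := by
    refine (h3 (fun a (c : J) => Real.exp (-k * ω a) * (d * (1 * (D0 * (2 * r))))) (fun a c => by positivity)).trans (ENNReal.ofReal_le_ofReal ?_)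
    refine le_of_eq ?_
    congr 1
    simp only [Finset.prod_const, Finset.card_univ]
    rw [Finset.prod_mul_distrib, ← Real.exp_sum, ← Finset.mul_sum, hω]
    simp only [mul_zero, Real.exp_zero, one_mul, Finset.prod_const, Finset.card_univ]
    rw [← pow_mul, hN']
  have hbeta : ∀ b : Matrix B T ℝ, fl ω (k + s) * ub (η • b) = ub b * fl ω (k + s) := by
    intro b
    rw [hωd, fl_ub, smul_smul, hη, ← Real.exp_add, add_neg_cancel, Real.exp_zero, one_smul]
  have main := avg_ub hSm hAm η (ENNReal.ofReal (C4 * (D5 * (D0 * (2 * r'))) ^ N)) (by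
    intro g b0 hb0 hg0
    have hub : Bd 1 (ub (-(η • b0))) := by
      refine Bd_ub le_rfl ?_
      refine (hb0.smul η).neg.mono ?_
      rw [abs_of_pos hη0]; linarith
    have hgg : g = ub (-(η • b0)) * (ub (η • b0) * g) := by
      rw [← mul_assoc, ← ub_add, neg_add_cancel, ub_zero, one_mul]
    set g0 := ub (η • b0) * g with hg0d
    refine ⟨⟨?_, ?_⟩, ?_⟩
    · have h1 := hg0.1.1
      rw [hgg]
      refine ⟨(hub.mul zero_le_one h1.1).mono (by linarith), ?_⟩
      rw [det_mul, det_ub, one_mul]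
      exact (inv_anti₀ (by linarith) hM'M).trans h1.2
    · have hsm := GG_small hω hD hr hE hg0.1
      have hc : fl ω k * ub (-(η • b0)) = ub (-(Real.exp (k * (p + q)) * η) • b0) * fl ω k := by
        rw [hωd, fl_ub]; simp [smul_smul]
      have hub2 : Bd 1 (ub (-(Real.exp (k * (p + q)) * η) • b0)) := by
        refine Bd_ub le_rfl ((hb0.smul _).mono ?_)
        rw [abs_neg, abs_of_pos (by positivity), hη, ← Real.exp_add]
        have : Real.exp (k * (p + q) + -((k + s) * (p + q))) ≤ 1 := Real.exp_le_one_iff.mpr (by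
          have : 0 ≤ s * (p + q) := by positivity
          linarith)
        linarith
      have h2 := hsm.left zero_le_one hub2
      rw [← mul_assoc, ← hc, mul_assoc, ← hgg] at h2
      obtain ⟨w, w1, w2⟩ := h2
      refine ⟨w, w1, fun c a => ?_⟩
      rw [fl_mulVec_inv ω k, abs_mul, Real.abs_exp]
      exact mul_le_mul_of_nonneg_left (w2 c a) (Real.exp_pos _).le
    · obtain ⟨⟨hgM, W, hW, h, hh, he⟩, -⟩ := hg0
      obtain ⟨q1, q2, q3, q4⟩ := hE h hh
      have hhne : h.det ≠ 0 := by
        intro h0; rw [h0, abs_zero] at q2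
        have : 0 < D⁻¹ := by positivity
        linarith
      have hdet : (fl ω s * h).det = h.det := by rw [det_mul, det_fl ω _ hω, one_mul]
      obtain ⟨X, hX, hXb⟩ := h5 (fl ω s * h) (by rw [hdet]; exact hhne) (by rw [hdet]; exact q3) (hδE h hh)
      set h'' := fl ω s * h * toR X with hh''
      have hO : h'' ∈ Om M'' := by
        refine ⟨hXb.mono (by linarith), ?_⟩
        rw [det_mul, hdet, abs_mul]
        calc M''⁻¹ ≤ D⁻¹ := inv_anti₀ (by linarith) (by linarith)
          _ ≤ |h.det| := q2
          _ ≤ _ := le_mul_of_one_le_right (abs_nonneg _) (one_le_abs_det X hX)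
      have hXd : |(X.det : ℝ)| ≤ D5 := by
        have h6 := hO.1.det_le
        rw [det_mul, hdet, det_toR, abs_mul] at h6
        have : D⁻¹ * |(X.det : ℝ)| ≤ dC (T ⊕ B) M'' := le_trans (mul_le_mul_of_nonneg_right q2 (abs_nonneg _)) h6
        rw [inv_mul_le_iff₀ (by linarith)] at this
        linarith
      have hfin := h4 h'' hO (l - (k + s)) (by linarith) (D5 * (D0 * (2 * r'))) (by positivity)
      rw [hN'] at hfin
      refine le_trans ?_ hfin
      have ht := measure_preimage_add_right (volume : Measure (Matrix B T ℝ)) (-b0) {b : Matrix B T ℝ | Bd 1 b ∧ Small J (fl ω (l - (k + s)) * ub b * h'') (D5 * (D0 * (2 * r')))}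
      rw [← ht]
      refine measure_mono ?_
      rintro b ⟨hb, hbS⟩
      refine ⟨(hb.add hb0.neg).mono (by norm_num), ?_⟩
      have hsm := GG_small hω hD hr' hE' hbS.2
      have hc : fl ω l * (ub (η • b) * g) = fl ω (l - (k + s)) * ub (b + -b0) * (fl ω s * h) * toR W := by
        have e1 : ub (η • b) * g = ub (η • (b + -b0)) * g0 := by
          rw [hg0d, ← mul_assoc, ← ub_add, ← smul_add, neg_add_cancel_right]
        have e2 : fl ω l = fl ω (l - (k + s)) * fl ω (k + s) := by rw [fl_add, sub_add_cancel]
        have e3 : fl ω (k + s) = fl ω s * fl ω k := by rw [fl_add, add_comm]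
        rw [e1, e2, mul_assoc, ← mul_assoc (fl ω (k+s)), hbeta, e3]
        simp only [mul_assoc]
        rw [he]
      rw [hc] at hsm
      have h7 := (Small.of_mul hW hsm).adj hX
      rw [mul_assoc _ (fl ω s * h)] at h7
      refine h7.mono ?_
      rw [det_toR]
      exact mul_le_mul_of_nonneg_right hXd (by positivity))
  have h6 : V * volume S ≤ ENNReal.ofReal (C4 * (D5 * (D0 * (2 * r'))) ^ N) * ENNReal.ofReal (C3 * (d * (1 * (D0 * (2 * r)))) ^ N) :=
    main.trans (mul_le_mul_right hAv _)
  rw [← ENNReal.ofReal_mul (by positivity)] at h6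
  have h7 : ENNReal.ofReal (C4 * (D5 * (D0 * (2 * r'))) ^ N * (C3 * (d * (1 * (D0 * (2 * r)))) ^ N)) = V * 
      ENNReal.ofReal (v⁻¹ * ((C4 * (D5 * (D0 * 2)) ^ N) * (C3 * (d * (1 * (D0 * 2))) ^ N)) * (r ^ N * r' ^ N)) := by
    rw [hVv, ← ENNReal.ofReal_mul hv0.le]
    congr 1
    have : v * v⁻¹ = 1 := mul_inv_cancel₀ hv0.ne'
    calc _ = (v * v⁻¹) * (C4 * (D5 * (D0 * (2 * r'))) ^ N * (C3 * (d * (1 * (D0 * (2 * r)))) ^ N)) := by rw [this]; exact (one_mul _).symm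
      _ = _ := by simp only [mul_pow]; ring
  rw [h7] at h6
  exact (ENNReal.mul_le_mul_iff_right hV0 hVt).mp h6
end l9
end KM

open MeasureTheory
open scoped ENNReal
namespace KM
set_option linter.unusedSectionVars false
set_option linter.unusedSimpArgs false
set_option linter.unusedVariables false
open Matrix

section ks

lemma cs_sq {Ω : Type*} [MeasurableSpace Ω] (μ : Measure Ω) {X : Ω → ℝ≥0∞} (hX : Measurable X) {U : Set Ω} (hU : MeasurableSet U)
    (h0 : ∀ x, x ∉ U → X x = 0) : (∫⁻ x, X x ∂μ) ^ 2 ≤ (∫⁻ x, X x ^ 2 ∂μ) * μ U := by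
  have hc : Real.HolderConjugate 2 2 := by constructor <;> norm_num
  have h := ENNReal.lintegral_mul_le_Lp_mul_Lq μ hc hX.aemeasurable 
    (measurable_one.indicator hU : Measurable (U.indicator (1 : Ω → ℝ≥0∞))).aemeasurable
  have e1 : ∫⁻ x, (X * U.indicator (1 : Ω → ℝ≥0∞)) x ∂μ = ∫⁻ x, X x ∂μ := by
    refine lintegral_congr fun x => ?_
    by_cases hx : x ∈ U
    · simp [hx]
    · simp [hx, h0 x hx]
  have e2 : ∫⁻ x, (U.indicator (1 : Ω → ℝ≥0∞)) x ^ (2:ℝ) ∂μ = μ U := by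
    rw [← lintegral_indicator_one hU]
    refine lintegral_congr fun x => ?_
    by_cases hx : x ∈ U <;> simp [hx]
  have e3 : ∫⁻ x, X x ^ (2:ℝ) ∂μ = ∫⁻ x, X x ^ 2 ∂μ := by
    refine lintegral_congr fun x => ?_
    exact ENNReal.rpow_ofNat _ 2
  rw [e1, e2, e3] at h
  calc _ ≤ ((∫⁻ x, X x ^ 2 ∂μ) ^ (1/2 : ℝ) * (μ U) ^ (1/2:ℝ)) ^ 2 := by gcongr
    _ = _ := by
      rw [mul_pow, ← ENNReal.rpow_ofNat, ← ENNReal.rpow_ofNat, ← ENNReal.rpow_mul, ← ENNReal.rpow_mul]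
      norm_num

lemma KS {Ω : Type*} [MeasurableSpace Ω] (μ : Measure Ω) (G : ℕ → Set Ω) (hG : ∀ p, MeasurableSet (G p)) (q : ℕ → ℝ) (hq : ∀ p, 0 ≤ q p)
    (hns : ¬ Summable q) (a : ℕ → ℕ → ℝ) (ha : ∀ p l, 0 ≤ a p l) (c C A : ℝ) (hc : 0 < c) (hC : 0 < C) (hA : 0 ≤ A) (P0 : ℕ)
    (h1 : ∀ p ≥ P0, ENNReal.ofReal (c * q p) ≤ μ (G p)) (h2 : ∀ p ≥ P0, μ (G p) ≤ ENNReal.ofReal (C * q p))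
    (h3 : ∀ p ≥ P0, ∀ l > p, μ (G p ∩ G l) ≤ ENNReal.ofReal (C * (q p * (q l + a p l))))
    (h4 : ∀ p N, P0 ≤ p → ∑ l ∈ Finset.Ioo p N, a p l ≤ A) (P : ℕ) (hP : P0 ≤ P) :
    ENNReal.ofReal (c ^ 2 / (2 * (C * (2 + 2 * A)))) ≤ μ (⋃ p ∈ Set.Ici P, G p) := by
  -- choose N with a large partial sum
  obtain ⟨N, hN⟩ : ∃ N, 1 ≤ ∑ p ∈ Finset.Ico P N, q p := by
    have h5 := (not_summable_iff_tendsto_nat_atTop_of_nonneg hq).mp hns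
    obtain ⟨N, hN, hPN⟩ := ((h5.eventually_ge_atTop (1 + ∑ p ∈ Finset.range P, q p)).and (Filter.eventually_ge_atTop P)).exists
    refine ⟨N, ?_⟩
    rw [Finset.sum_Ico_eq_sub _ hPN]; linarith
  set F := Finset.Ico P N with hF
  set S := ∑ p ∈ F, q p with hS
  have hFP : ∀ p ∈ F, P0 ≤ p := fun p hp => hP.trans (Finset.mem_Ico.mp hp).1
  set U := ⋃ p ∈ Set.Ici P, G p with hU
  have hUm : MeasurableSet U := MeasurableSet.biUnion (Set.to_countable _) fun p _ => hG p
  set X : Ω → ℝ≥0∞ := fun x => ∑ p ∈ F, (G p).indicator 1 x with hX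
  have hXm : Measurable X := Finset.measurable_sum _ fun p _ => measurable_one.indicator (hG p)
  have h0 : ∀ x, x ∉ U → X x = 0 := by
    intro x hx
    refine Finset.sum_eq_zero fun p hp => Set.indicator_of_notMem (fun hxp => hx ?_) _
    exact Set.mem_biUnion (Finset.mem_Ico.mp hp).1 hxp
  have hcs := cs_sq μ hXm hUm h0
  have hl : ENNReal.ofReal (c * S) ≤ ∫⁻ x, X x ∂μ := by
    simp only [hX]
    rw [lintegral_finsetSum _ fun p _ => measurable_one.indicator (hG p), hS, Finset.mul_sum,
      ENNReal.ofReal_sum_of_nonneg fun p _ => mul_nonneg hc.le (hq p)]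
    refine Finset.sum_le_sum fun p hp => ?_
    rw [lintegral_indicator_one (hG p)]
    exact h1 p (hFP p hp)
  set b : ℕ → ℕ → ℝ := fun p l => if p < l then C * (q p * (q l + a p l)) else 0 with hb
  have hb0 : ∀ p l, 0 ≤ b p l := by
    intro p l
    simp only [hb]
    split_ifs
    · exact mul_nonneg hC.le (mul_nonneg (hq p) (add_nonneg (hq l) (ha p l)))
    · exact le_rfl
  set dg : ℕ → ℕ → ℝ := fun p l => if p = l then C * q p else 0 with hdg
  have hdg0 : ∀ p l, 0 ≤ dg p l := by
    intro p l
    simp only [hdg]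
    split_ifs
    · exact mul_nonneg hC.le (hq p)
    · exact le_rfl
  have hpair : ∀ p ∈ F, ∀ l ∈ F, μ (G p ∩ G l) ≤ ENNReal.ofReal (b p l + b l p + dg p l) := by
    intro p hp l hl
    rcases lt_trichotomy p l with h | h | h
    · refine (h3 p (hFP p hp) l h).trans (ENNReal.ofReal_le_ofReal ?_)
      have : b p l = C * (q p * (q l + a p l)) := by simp [hb, h]
      linarith [hb0 l p, hdg0 p l]
    · subst h
      rw [Set.inter_self]
      refine (h2 p (hFP p hp)).trans (ENNReal.ofReal_le_ofReal ?_)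
      have : dg p p = C * q p := by simp [hdg]
      linarith [hb0 p p]
    · rw [Set.inter_comm]
      refine (h3 l (hFP l hl) p h).trans (ENNReal.ofReal_le_ofReal ?_)
      have : b l p = C * (q l * (q p + a l p)) := by simp [hb, h]
      linarith [hb0 p l, hdg0 p l]
  have hbs : ∑ p ∈ F, ∑ l ∈ F, b p l ≤ C * (S * S + A * S) := by
    have : ∀ p ∈ F, ∑ l ∈ F, b p l ≤ C * (q p * (S + A)) := by
      intro p hp
      have e1 : ∑ l ∈ F, b p l = ∑ l ∈ F.filter (p < ·), C * (q p * (q l + a p l)) := by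
        rw [Finset.sum_filter]
      rw [e1, ← Finset.mul_sum, ← Finset.mul_sum, Finset.sum_add_distrib]
      refine mul_le_mul_of_nonneg_left (mul_le_mul_of_nonneg_left (add_le_add ?_ ?_) (hq p)) hC.le
      · exact Finset.sum_le_sum_of_subset_of_nonneg (Finset.filter_subset _ _) fun l _ _ => hq l
      · refine le_trans (Finset.sum_le_sum_of_subset_of_nonneg ?_ fun l _ _ => ha p l) (h4 p N (hFP p hp))
        intro l hl
        rw [Finset.mem_filter, hF, Finset.mem_Ico] at hl
        exact Finset.mem_Ioo.mpr ⟨hl.2, hl.1.2⟩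
    refine (Finset.sum_le_sum this).trans (le_of_eq ?_)
    rw [← Finset.mul_sum, ← Finset.sum_mul]
    ring
  have hds : ∑ p ∈ F, ∑ l ∈ F, dg p l = C * S := by
    rw [hS, Finset.mul_sum]
    refine Finset.sum_congr rfl fun p hp => ?_
    simp only [hdg]
    rw [Finset.sum_ite_eq, if_pos hp]
  have hu : ∫⁻ x, X x ^ 2 ∂μ ≤ ENNReal.ofReal (C * (2 + 2 * A) * (2 * S ^ 2)) := by
    have e1 : ∀ x, X x ^ 2 = ∑ p ∈ F, ∑ l ∈ F, (G p ∩ G l).indicator (1 : Ω → ℝ≥0∞) x := by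
      intro x
      simp only [hX]
      rw [sq, Finset.sum_mul_sum]
      refine Finset.sum_congr rfl fun p _ => Finset.sum_congr rfl fun l _ => ?_
      rw [Set.inter_indicator_one]; rfl
    simp_rw [e1]
    rw [lintegral_finsetSum _ fun p _ => Finset.measurable_sum _ fun l _ => measurable_one.indicator ((hG p).inter (hG l))]
    calc _ ≤ ∑ p ∈ F, ∑ l ∈ F, ENNReal.ofReal (b p l + b l p + dg p l) := by
          refine Finset.sum_le_sum fun p hp => ?_
          rw [lintegral_finsetSum _ fun l _ => measurable_one.indicator ((hG p).inter (hG l))]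
          refine Finset.sum_le_sum fun l hl => ?_
          rw [lintegral_indicator_one ((hG p).inter (hG l))]
          exact hpair p hp l hl
      _ = ENNReal.ofReal (∑ p ∈ F, ∑ l ∈ F, (b p l + b l p + dg p l)) := by
          have hn : ∀ p l, 0 ≤ b p l + b l p + dg p l := fun p l => by linarith [hb0 p l, hb0 l p, hdg0 p l]
          rw [ENNReal.ofReal_sum_of_nonneg fun p _ => Finset.sum_nonneg fun l _ => hn p l]
          refine Finset.sum_congr rfl fun p _ => ?_
          rw [ENNReal.ofReal_sum_of_nonneg fun l _ => hn p l]
      _ ≤ _ := by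
          refine ENNReal.ofReal_le_ofReal ?_
          simp only [Finset.sum_add_distrib]
          have hcomm : ∑ p ∈ F, ∑ l ∈ F, b l p = ∑ p ∈ F, ∑ l ∈ F, b p l := Finset.sum_comm
          rw [hcomm, hds]
          have hSS : S ≤ S ^ 2 := by nlinarith
          have : C * (S * S + A * S) ≤ C * ((1 + A) * S ^ 2) := by
            refine mul_le_mul_of_nonneg_left ?_ hC.le
            nlinarith
          have h7 : C * S ≤ C * S ^ 2 := mul_le_mul_of_nonneg_left hSS hC.le
          have h8 : 0 ≤ C * A * S ^ 2 := by positivity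
          have h9 : 0 ≤ C * S ^ 2 := by positivity
          nlinarith
  have h10 : ENNReal.ofReal ((c * S) ^ 2) ≤ ENNReal.ofReal (C * (2 + 2 * A) * (2 * S ^ 2)) * μ U := by
    rw [ENNReal.ofReal_pow (by positivity)]
    calc _ ≤ (∫⁻ x, X x ∂μ) ^ 2 := by gcongr
      _ ≤ _ := hcs
      _ ≤ _ := mul_le_mul_left hu _
  have hpos : 0 < C * (2 + 2 * A) * (2 * S ^ 2) := by positivity
  have h11 : ENNReal.ofReal ((c * S) ^ 2) = ENNReal.ofReal (C * (2 + 2 * A) * (2 * S ^ 2)) * ENNReal.ofReal (c ^ 2 / (2 * (C * (2 + 2 * A)))) := by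
    rw [← ENNReal.ofReal_mul hpos.le]
    congr 1
    have : S ≠ 0 := by linarith
    field_simp
  rw [h11] at h10
  exact (ENNReal.mul_le_mul_iff_right (by simpa using hpos) ENNReal.ofReal_ne_top).mp h10

lemma KS_limsup {Ω : Type*} [MeasurableSpace Ω] (μ : Measure Ω) (G : ℕ → Set Ω) (hG : ∀ p, MeasurableSet (G p)) (Z : Set Ω) (hZ : μ Z ≠ ⊤)
    (hGZ : ∀ p, G p ⊆ Z) (x : ℝ≥0∞) (P0 : ℕ) (h : ∀ P ≥ P0, x ≤ μ (⋃ p ∈ Set.Ici P, G p)) :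
    x ≤ μ {g | ∃ᶠ p in Filter.atTop, g ∈ G p} := by
  have e : {g | ∃ᶠ p in Filter.atTop, g ∈ G p} = ⋂ P : ℕ, ⋃ p ∈ Set.Ici P, G p := by
    ext g
    simp only [Set.mem_ofPred_eq, Filter.frequently_atTop, Set.mem_iInter, Set.mem_iUnion, Set.mem_Ici, exists_prop]
  have hm : ∀ P : ℕ, MeasurableSet (⋃ p ∈ Set.Ici P, G p) := fun P => MeasurableSet.biUnion (Set.to_countable _) fun p _ => hG p
  have hanti : Antitone fun P : ℕ => ⋃ p ∈ Set.Ici P, G p := fun P Q hPQ =>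
    Set.biUnion_subset_biUnion_left (Set.Ici_subset_Ici.mpr hPQ)
  rw [e, hanti.measure_iInter (fun P => (hm P).nullMeasurableSet) ⟨0, ?_⟩]
  · refine le_iInf fun P => ?_
    exact (h (max P P0) (le_max_right _ _)).trans (measure_mono (hanti (le_max_left _ _)))
  · exact ((measure_mono (Set.iUnion₂_subset fun p _ => hGZ p)).trans_lt hZ.lt_top).ne
end ks
end KM

open MeasureTheory
open scoped ENNReal
namespace KM
set_option linter.unusedSectionVars false
set_option linter.unusedSimpArgs false
set_option linter.unusedVariables false
open Matrix

section ser
lemma ser_dil (a : ℕ → ℝ) (ha : ∀ p, 0 ≤ a p) (hmono : ∀ ⦃p l : ℕ⦄, 0 < p → p ≤ l → a l ≤ a p) (t : ℕ) (hns : ¬ Summable a) :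
    ¬ Summable fun p => a (2 ^ t * p) := by
  intro h
  apply hns
  rw [← summable_condensed_iff_of_nonneg ha hmono]
  rw [← summable_condensed_iff_of_nonneg (fun p => ha _) (fun p l hp hl => hmono (by positivity) (Nat.mul_le_mul_left _ hl))] at h
  rw [← summable_nat_add_iff t]
  convert! h.mul_left ((2 : ℝ) ^ t) using 2 with k
  rw [← pow_add, pow_add, add_comm t k]; ring_nf

lemma ser_min (a : ℕ → ℝ) (ha : ∀ p, 0 ≤ a p) (hmono : ∀ ⦃p l : ℕ⦄, 0 < p → p ≤ l → a l ≤ a p) (hns : ¬ Summable a) :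
    ¬ Summable fun p : ℕ => min (a p) (1 / (p : ℝ)) := by
  intro h
  apply hns
  rw [← summable_condensed_iff_of_nonneg ha hmono]
  rw [← summable_condensed_iff_of_nonneg (fun p => le_min (ha _) (by positivity)) (fun p l hp hl => 
    min_le_min (hmono hp hl) (one_div_le_one_div_of_le (by exact_mod_cast hp) (by exact_mod_cast hl)))] at h
  have h1 := h.tendsto_atTop_zero.eventually (gt_mem_nhds (show (0 : ℝ) < 1 by norm_num))
  refine (summable_congr_atTop ?_).mpr h
  filter_upwards [h1] with k hk
  rcases le_total (a (2 ^ k)) (1 / ((2 ^ k : ℕ) : ℝ)) with h2 | h2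
  · rw [min_eq_left h2]
  · rw [min_eq_right h2] at hk
    push_cast at hk
    rw [mul_one_div_cancel (by positivity)] at hk
    exact absurd hk (lt_irrefl _)

/-- The truncated sequence. -/
noncomputable def qq (F : ℕ → ℝ) (p : ℕ) : ℝ := if 1 ≤ p ∧ F p ≤ (p : ℝ) ^ 2 then min (1 / F p) (1 / (p : ℝ)) else 0

lemma qq_nonneg {F : ℕ → ℝ} (hF : ∀ p, 1 ≤ p → 0 < F p) (p : ℕ) : 0 ≤ qq F p := by
  unfold qq
  split_ifs with h
  · have := hF p h.1
    positivity
  · exact le_rfl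

lemma qq_ne {F : ℕ → ℝ} (hF : ∀ p, 1 ≤ p → 0 < F p) {p : ℕ} (h : qq F p ≠ 0) :
    1 ≤ p ∧ 1 / (p : ℝ) ^ 2 ≤ qq F p ∧ qq F p ≤ 1 / p ∧ qq F p ≤ 1 / F p := by
  unfold qq at *
  split_ifs at * with h1
  · have h2 : (1 : ℝ) ≤ p := by exact_mod_cast h1.1
    refine ⟨h1.1, le_min (one_div_le_one_div_of_le (hF p h1.1) h1.2) (one_div_le_one_div_of_le (by linarith) (by nlinarith)), min_le_right _ _, min_le_left _ _⟩
  · exact absurd rfl h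

lemma qq_anti {F : ℕ → ℝ} (hF : ∀ p, 1 ≤ p → 0 < F p) (hmono : ∀ p l, 1 ≤ p → p ≤ l → F p ≤ F l) {p l : ℕ} (hpl : p ≤ l)
    (h : qq F p ≠ 0) : qq F l ≤ qq F p := by
  unfold qq at *
  split_ifs at * with h1 h2 h2
  · have h3 : (1 : ℝ) ≤ p := by exact_mod_cast h2.1
    exact min_le_min (one_div_le_one_div_of_le (hF p h2.1) (hmono p l h2.1 hpl)) (one_div_le_one_div_of_le (by linarith) (by exact_mod_cast hpl))
  · exact absurd rfl h
  · have := hF p h2.1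
    positivity
  · exact le_rfl

lemma qq_ns {F : ℕ → ℝ} (hF : ∀ p, 1 ≤ p → 0 < F p) (hmono : ∀ p l, 1 ≤ p → p ≤ l → F p ≤ F l) 
    (hns : ¬ Summable fun p => if p = 0 then 0 else 1 / F p) : ¬ Summable (qq F) := by
  have h1 := ser_min (fun p => if p = 0 then 0 else 1 / F p) (fun p => by
    split_ifs with h
    · exact le_rfl
    · have := hF p (Nat.one_le_iff_ne_zero.mpr h); positivity) (fun p l hp hl => by
      rw [if_neg (by omega), if_neg (by omega)]
      exact one_div_le_one_div_of_le (hF p hp) (hmono p l hp hl)) hns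
  intro h
  apply h1
  have h2 : Summable fun p : ℕ => 1 / (p : ℝ) ^ 2 := Real.summable_one_div_nat_pow.mpr (by norm_num)
  refine Summable.of_nonneg_of_le (fun p => ?_) (fun p => ?_) (h.add h2)
  · refine le_min ?_ (by positivity)
    split_ifs with h
    · exact le_rfl
    · have := hF p (Nat.one_le_iff_ne_zero.mpr h); positivity
  · rcases Nat.eq_zero_or_pos p with rfl | hp
    · simp [qq]
    · rw [if_neg (by omega)]
      unfold qq
      have h3 := hF p hp
      have h4 : (0 : ℝ) < p := by exact_mod_cast hp
      split_ifs with h5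
      · have : 0 ≤ 1 / (p : ℝ) ^ 2 := by positivity
        linarith
      · push Not at h5
        rw [zero_add]
        exact (min_le_left _ _).trans (one_div_le_one_div_of_le (by positivity) (h5 hp).le)

lemma near_sum (C1 j s0 : ℝ) (hC1 : 0 ≤ C1) (hj : 0 < j) (hs0 : 1 ≤ s0) (p N : ℕ) (hp : 1 ≤ p) : 
    ∑ l ∈ Finset.Ioo p N, (if s0 * (l : ℝ) < s0 * p + C1 * Real.log p then (p : ℝ) ^ (-(1 / j)) else 0) ≤ C1 * j := by
  have hp1 : (1 : ℝ) ≤ p := by exact_mod_cast hp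
  have hlog : 0 ≤ Real.log p := Real.log_nonneg hp1
  set x := C1 * Real.log p with hx
  have hx0 : 0 ≤ x := by positivity
  rw [← Finset.sum_filter, Finset.sum_const, nsmul_eq_mul]
  have hcard : ((Finset.filter (fun l : ℕ => s0 * (l : ℝ) < s0 * p + x) (Finset.Ioo p N)).card : ℝ) ≤ x := by
    have h1 : Finset.filter (fun l : ℕ => s0 * (l : ℝ) < s0 * p + x) (Finset.Ioo p N) ⊆ Finset.Ioc p (p + ⌊x⌋₊) := by
      intro l hl
      rw [Finset.mem_filter, Finset.mem_Ioo] at hl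
      obtain ⟨⟨h1, h2⟩, h3⟩ := hl
      rw [Finset.mem_Ioc]
      refine ⟨h1, ?_⟩
      have h4 : (p : ℝ) < l := by exact_mod_cast h1
      have h5 : ((l - p : ℕ) : ℝ) ≤ x := by
        rw [Nat.cast_sub h1.le]
        nlinarith
      have := Nat.le_floor h5
      omega
    have h2 := Finset.card_le_card h1
    rw [Nat.card_Ioc] at h2
    have h3 : ((⌊x⌋₊ : ℕ) : ℝ) ≤ x := Nat.floor_le hx0
    refine le_trans ?_ h3
    exact_mod_cast (by omega)
  have h6 : Real.log p ≤ (p : ℝ) ^ (1 / j) / (1 / j) := Real.log_le_rpow_div (by linarith) (by positivity)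
  have h7 : (0 : ℝ) < (p : ℝ) ^ (1 / j) := by positivity
  calc _ ≤ x * (p : ℝ) ^ (-(1 / j)) := by gcongr
    _ ≤ (C1 * ((p : ℝ) ^ (1 / j) / (1 / j))) * (p : ℝ) ^ (-(1 / j)) := by rw [hx]; gcongr
    _ = C1 * j := by
      rw [Real.rpow_neg (by linarith)]
      field_simp

lemma pack_cond (Cst P β δ ε x y : ℝ) (hCst : 0 ≤ Cst) (hP : 0 ≤ P) (hCP : Cst * P * 2 ≤ 1) (hδ : 0 < δ) (hε : 0 < ε) (hy : 1 ≤ y)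
    (hx : x ≤ ε⁻¹ * y ^ 2) (hx0 : 0 ≤ x) (hβ : δ * y ^ 6 ≤ β) (hεy : ε⁻¹ * δ ^ (-(1/2) : ℝ) ≤ y) :
    Cst * P * (1 + x * β ^ (-(1/2) : ℝ)) ≤ 1 := by
  have hy0 : 0 < y := by linarith
  have h1 : β ^ (-(1/2) : ℝ) ≤ δ ^ (-(1/2) : ℝ) * (y ^ 3)⁻¹ := by
    calc β ^ (-(1/2) : ℝ) ≤ (δ * y ^ 6) ^ (-(1/2) : ℝ) := Real.rpow_le_rpow_of_nonpos (by positivity) hβ (by norm_num)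
      _ = _ := by
        rw [Real.mul_rpow hδ.le (by positivity)]
        congr 1
        rw [Real.rpow_neg (by positivity), ← Real.sqrt_eq_rpow]
        congr 1
        rw [show y ^ 6 = (y ^ 3) ^ 2 by ring, Real.sqrt_sq (by positivity)]
  have h2 : x * β ^ (-(1/2) : ℝ) ≤ 1 := by
    have hβ0 : 0 ≤ β := le_trans (by positivity) hβ
    calc x * β ^ (-(1/2) : ℝ) ≤ (ε⁻¹ * y ^ 2) * (δ ^ (-(1/2) : ℝ) * (y ^ 3)⁻¹) := by gcongr
      _ = (ε⁻¹ * δ ^ (-(1/2) : ℝ)) * y⁻¹ := by field_simp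
      _ ≤ y * y⁻¹ := by gcongr
      _ = 1 := mul_inv_cancel₀ hy0.ne'
  calc _ ≤ Cst * P * 2 := by
        apply mul_le_mul_of_nonneg_left _ (by positivity); linarith
    _ ≤ 1 := hCP
end ser
end KM

open MeasureTheory
open scoped ENNReal
namespace KM
set_option linter.unusedSectionVars false
set_option linter.unusedSimpArgs false
set_option linter.unusedVariables false
open Matrix

section l11
lemma not_badS {κ : Type*} [Fintype κ] [DecidableEq κ] {ω : κ → ℝ} {s δ : ℝ} {h : Matrix κ κ ℝ} (hh : h ∉ badS (fun a => δ * Real.exp (-s * ω a))) :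
    ∀ w : κ → ℤ, w ≠ 0 → ∃ a, δ < |((fl ω s * h) *ᵥ vR w) a| := by
  intro w hw
  by_contra hc
  push Not at hc
  refine hh ⟨w, hw, fun a => ?_⟩
  rw [fl_mulVec_inv ω s, abs_mul, Real.abs_exp, mul_comm]
  exact mul_le_mul_of_nonneg_right (hc a) (Real.exp_pos _).le

lemma GG_vol {κ J K : Type*} [Fintype κ] [DecidableEq κ] [Fintype J] [Fintype K] [DecidableEq J] [DecidableEq K] (e : J ⊕ K ≃ κ) (M D : ℝ) (hM : 1 ≤ M) (hD : 1 ≤ D) : ∃ C : ℝ, 0 ≤ C ∧ ∀ ω : κ → ℝ, ∑ a, ω a = 0 → 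
    ∀ k r : ℝ, 0 < r → ∀ E, HE e D r E → volume (GG ω M k E) ≤ ENNReal.ofReal (C * r ^ (Fintype.card J * Fintype.card κ)) := by
  obtain ⟨C, hC, h3⟩ := L3 (κ := κ) J M hM
  have hd := dC_pos (κ := κ) M (by linarith)
  refine ⟨C * (dC κ M * D * 2) ^ (Fintype.card J * Fintype.card κ), by positivity, fun ω hω k r hr E hE => ?_⟩
  refine le_trans (measure_mono ?_) ((h3 (fun a _ => Real.exp (-k * ω a) * (dC κ M * D * (2 * r))) (fun a c => by positivity)).trans (le_of_eq ?_))
  · intro g hg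
    refine ⟨hg.1, ?_⟩
    obtain ⟨w, hw, h4⟩ := GG_small hω hD hr hE hg
    refine ⟨w, hw, fun c a => ?_⟩
    rw [fl_mulVec_inv ω k, abs_mul, Real.abs_exp]
    exact mul_le_mul_of_nonneg_left (h4 c a) (Real.exp_pos _).le
  · congr 1
    rw [mul_assoc C]
    congr 1
    have hpe : ∏ a, Real.exp (-k * ω a) = 1 := by
      rw [← Real.exp_sum, ← Finset.mul_sum, hω, mul_zero, Real.exp_zero]
    rw [← mul_pow]
    simp only [Finset.prod_mul_distrib, Finset.prod_const, Finset.card_univ, hpe, one_mul]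
    ring

variable {T B : Type*} [Fintype T] [DecidableEq T] [Fintype B] [DecidableEq B]
variable {J K : Type*} [Fintype J] [Fintype K] [DecidableEq J] [DecidableEq K]

lemma L11 [Nonempty T] [Nonempty B] [Nonempty J] [Nonempty K] (e : J ⊕ K ≃ T ⊕ B) {p' q' : ℝ} (hp : 0 < p') (hq : 0 < q') 
    (hpq : Fintype.card T * p' = Fintype.card B * q') (hσ : 0 < ∑ c : J, (om p' q' : T ⊕ B → ℝ) (e (Sum.inl c))) :
    ∃ M : ℝ, 1 ≤ M ∧ ∃ t : ℕ, ∃ c0 : ℝ, 0 < c0 ∧ ∃ C0 : ℝ, 0 ≤ C0 ∧ ∀ F : ℕ → ℝ, (∀ p, 1 ≤ p → 0 < F p) → (∀ p l, 1 ≤ p → p ≤ l → F p ≤ F l) → 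
      (¬ Summable fun p => if p = 0 then 0 else 1 / F p) → ∀ ε : ℝ, 0 < ε → ε ≤ 1 → 
      ENNReal.ofReal c0 ≤ volume {g : Matrix (T ⊕ B) (T ⊕ B) ℝ | g ∈ Om M ∧ ∃ᶠ p : ℕ in Filter.atTop, 1 ≤ p ∧ 
        Small J (fl (om p' q') (2 ^ t * p) * g) (C0 * (ε / F p) ^ (((Fintype.card J * Fintype.card (T ⊕ B) : ℕ) : ℝ)⁻¹))} := by
  set ω : T ⊕ B → ℝ := om p' q' with hωd
  have hω : ∑ a, ω a = 0 := sum_om hpq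
  obtain ⟨H, cH, hcH, Cst, hCst, D, hD, hpack⟩ := pack e
  set d := Fintype.card (T ⊕ B) with hd
  set j := Fintype.card J with hj
  have hd1 : 0 < d := Fintype.card_pos
  have hj1 : 0 < j := Fintype.card_pos
  set N := j * d with hN
  have hN1 : 0 < N := by positivity
  obtain ⟨δ, hδ, hδ1⟩ : ∃ δ : ℝ, 0 < δ ∧ Cst * δ ^ d * 2 ≤ 1 := by
    refine ⟨min 1 (1 / (2 * (Cst + 1))), by positivity, ?_⟩
    have h1 : (min 1 (1 / (2 * (Cst + 1)))) ^ d ≤ 1 / (2 * (Cst + 1)) := 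
      (pow_le_of_le_one (by positivity) (min_le_left _ _) hd1.ne').trans (min_le_right _ _)
    calc _ ≤ Cst * (1 / (2 * (Cst + 1))) * 2 := by gcongr
      _ = Cst / (Cst + 1) := by field_simp
      _ ≤ 1 := (div_le_one (by linarith)).mpr (by linarith)
  obtain ⟨M, hM, c7, hc7, h7⟩ := L7 (κ := T ⊕ B) D δ hD hδ
  obtain ⟨s8, hs8, C8, hC8, h8⟩ := L8 e ω hω hσ M D hM hD
  obtain ⟨C9, hC9, h9⟩ := L9 e hp.le hq.le hpq M D δ hM hD hδ
  obtain ⟨C2, hC2, h2⟩ := GG_vol e M D hM hD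
  obtain ⟨t, ht⟩ : ∃ t : ℕ, s8 ≤ (2 : ℝ) ^ t := (pow_unbounded_of_one_lt s8 (by norm_num)).imp fun _ => le_of_lt
  set s0 : ℝ := 2 ^ t with hs0
  have hs01 : 1 ≤ s0 := one_le_pow₀ (by norm_num)
  set C := C2 + C8 + C9 + 1 with hCdef
  have hC : 0 < C := by positivity
  set c := c7 * cH with hcdef
  have hc : 0 < c := by positivity
  set C1 : ℝ := 6 / p' with hC1
  have hC10 : 0 ≤ C1 := by positivity
  set A : ℝ := C1 * j with hA
  have hdC := dC_pos (κ := T ⊕ B) M (by linarith)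
  refine ⟨M, hM, t, c ^ 2 / (2 * (C * (2 + 2 * A))), by positivity, dC (T ⊕ B) M * D * 2, by positivity, ?_⟩
  intro F hF hFm hns ε hε hε1
  set r : ℕ → ℝ := fun p => (ε * qq F p) ^ ((N : ℝ)⁻¹) with hr
  have hq0 := qq_nonneg hF
  have hrN : ∀ p, r p ^ N = ε * qq F p := fun p => Real.rpow_inv_natCast_pow (mul_nonneg hε.le (hq0 p)) hN1.ne'
  have hrpos : ∀ p, qq F p ≠ 0 → 0 < r p := fun p h => Real.rpow_pos_of_pos (mul_pos hε (lt_of_le_of_ne (hq0 p) (Ne.symm h))) _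
  have hεq1 : ∀ p, qq F p ≠ 0 → ε * qq F p ≤ 1 := fun p h => by
    obtain ⟨h1, h2, h3, h4⟩ := qq_ne hF h
    have h5 : (1 : ℝ) / p ≤ 1 := by rw [div_le_one (by positivity)]; exact_mod_cast h1
    nlinarith [hq0 p]
  have hr1 : ∀ p, qq F p ≠ 0 → r p ≤ 1 := fun p h => Real.rpow_le_one (mul_nonneg hε.le (hq0 p)) (hεq1 p h) (by positivity)
  have hranti : ∀ p l, p ≤ l → qq F p ≠ 0 → r l ≤ r p := fun p l hpl h => 
    Real.rpow_le_rpow (mul_nonneg hε.le (hq0 l)) (mul_le_mul_of_nonneg_left (qq_anti hF hFm hpl h) hε.le) (by positivity)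
  have hrd : ∀ p, qq F p ≠ 0 → (r p)⁻¹ ^ d ≤ ε⁻¹ * (p : ℝ) ^ 2 := by
    intro p h
    obtain ⟨g1, g2, g3, g4⟩ := qq_ne hF h
    have hp0 : (0 : ℝ) < p := by exact_mod_cast g1
    rw [inv_pow]
    have h5 : ε * qq F p ≤ r p ^ d := by
      rw [← hrN, hN, mul_comm j d, pow_mul]
      exact pow_le_of_le_one (by have := hrpos p h; positivity) (pow_le_one₀ (hrpos p h).le (hr1 p h)) hj1.ne'
    calc (r p ^ d)⁻¹ ≤ (ε * (1 / (p : ℝ) ^ 2))⁻¹ := by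
          apply inv_anti₀ (by positivity)
          exact le_trans (by gcongr) h5
      _ = _ := by field_simp
  have hrd2 : ∀ p l, p ≤ l → 1 ≤ p → qq F l ≠ 0 → r l ^ d ≤ (p : ℝ) ^ (-(1 / (j : ℝ))) := by
    intro p l hpl hp1 h
    obtain ⟨g1, g2, g3, g4⟩ := qq_ne hF h
    have hp0 : (0 : ℝ) < p := by exact_mod_cast hp1
    have hpl' : (p : ℝ) ≤ l := by exact_mod_cast hpl
    have h5 : r l ^ d = (ε * qq F l) ^ (1 / (j : ℝ)) := by
      rw [← hrN, hN, mul_comm j d, pow_mul, one_div, Real.pow_rpow_inv_natCast (by have := hrpos l h; positivity) hj1.ne']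
    rw [h5, Real.rpow_neg hp0.le, ← Real.inv_rpow hp0.le]
    apply Real.rpow_le_rpow (mul_nonneg hε.le (hq0 l)) _ (by positivity)
    calc ε * qq F l ≤ 1 * (1 / (l : ℝ)) := mul_le_mul hε1 g3 (hq0 l) (by norm_num)
      _ ≤ _ := by rw [one_mul, ← one_div]; exact one_div_le_one_div_of_le hp0 hpl'
  set s : ℕ → ℝ := fun p => C1 * Real.log p with hs
  set E : ℕ → Set (Matrix (T ⊕ B) (T ⊕ B) ℝ) := fun p => 
    (H (r p) \ badS (fun a => δ * Real.exp (-(-(s0 * p)) * ω a))) \ badS (fun a => δ * Real.exp (-(s p) * ω a)) with hE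
  have hEm : ∀ p, qq F p ≠ 0 → MeasurableSet (E p) := fun p h => 
    (((hpack (r p) (hrpos p h) (hr1 p h)).1.diff (measurableSet_badS _)).diff (measurableSet_badS _))
  have hEH : ∀ p, E p ⊆ H (r p) := fun p h hh => hh.1.1
  have hHE : ∀ p, qq F p ≠ 0 → HE e D (r p) (E p) := fun p h x hx => (hpack (r p) (hrpos p h) (hr1 p h)).2.1 x (hEH p hx)
  classical
  set G : ℕ → Set (Matrix (T ⊕ B) (T ⊕ B) ℝ) := fun p => if qq F p = 0 then ∅ else GG ω M (s0 * p) (E p) with hG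
  have hGm : ∀ p, MeasurableSet (G p) := by
    intro p
    simp only [hG]
    split_ifs with h
    · exact MeasurableSet.empty
    · exact measurableSet_GG ω M _ (hEm p h)
  have hGZ : ∀ p, G p ⊆ Om M := by
    intro p g hg
    simp only [hG] at hg
    split_ifs at hg with h
    · exact absurd hg (Set.notMem_empty _)
    · exact hg.1
  have hlogo : ∃ P1 : ℕ, ∀ p ≥ P1, 1 ≤ p ∧ 6 * Real.log p ≤ q' * p ∧ ε⁻¹ * δ ^ (-(1/2) : ℝ) ≤ p := by
    have h1 := (Real.isLittleO_log_id_atTop.def (show (0 : ℝ) < q' / 6 by positivity))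
    have h2 := tendsto_natCast_atTop_atTop (R := ℝ) |>.eventually h1
    have h3 := (tendsto_natCast_atTop_atTop (R := ℝ)).eventually_ge_atTop (ε⁻¹ * δ ^ (-(1/2) : ℝ))
    obtain ⟨P1, hP1⟩ := Filter.eventually_atTop.mp (h2.and (h3.and (Filter.eventually_ge_atTop 1)))
    refine ⟨P1, fun p hp => ?_⟩
    obtain ⟨g1, g2, g3⟩ := hP1 p hp
    refine ⟨g3, ?_, g2⟩
    simp only [id, Real.norm_eq_abs, Nat.abs_cast] at g1
    have := le_abs_self (Real.log p)
    linarith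
  obtain ⟨P0, hP0⟩ := hlogo
  have hexp : ∀ p : ℕ, 1 ≤ p → Real.exp (6 * Real.log p) = (p : ℝ) ^ 6 := by
    intro p hp1
    have hp0 : (0 : ℝ) < p := by exact_mod_cast hp1
    rw [mul_comm, Real.exp_mul, Real.exp_log hp0]; norm_cast
  have hprod : ∀ k : ℝ, ∏ a, (δ * Real.exp (k * ω a)) = δ ^ d := by
    intro k
    rw [Finset.prod_mul_distrib, prod_exp_om hpq, Finset.prod_const, mul_one, Finset.card_univ]
  have key := KS volume G hGm (fun p => ε * qq F p) (fun p => mul_nonneg hε.le (hq0 p)) ?_ 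
    (fun p l => if s0 * (l : ℝ) < s0 * p + C1 * Real.log p then (p : ℝ) ^ (-(1 / (j : ℝ))) else 0) 
    (fun p l => by split_ifs <;> positivity) c C A hc hC (by positivity) P0 ?_ ?_ ?_ ?_
  · have key2 := KS_limsup volume G hGm (Om M) (vol_Om_lt_top M).ne hGZ _ P0 key
    refine key2.trans (measure_mono ?_)
    intro g hg
    have hg' : ∃ᶠ p in Filter.atTop, g ∈ G p := hg
    refine ⟨?_, ?_⟩
    · obtain ⟨p, hp⟩ := hg'.exists
      exact hGZ p hp
    · refine hg'.mono fun p hp => ?_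
      simp only [hG] at hp
      split_ifs at hp with h
      · exact absurd hp (Set.notMem_empty _)
      · obtain ⟨g1, g2, g3, g4⟩ := qq_ne hF h
        refine ⟨g1, (GG_small hω hD (hrpos p h) (hHE p h) hp).mono ?_⟩
        rw [← mul_assoc]
        apply mul_le_mul_of_nonneg_left _ (by positivity)
        apply Real.rpow_le_rpow (mul_nonneg hε.le (hq0 p)) _ (by positivity)
        rw [div_eq_mul_one_div]
        exact mul_le_mul_of_nonneg_left g4 hε.le
  · intro h
    exact qq_ns hF hFm hns ((summable_mul_left_iff hε.ne').mp h)
  · intro p hp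
    obtain ⟨g1, g2, g3⟩ := hP0 p hp
    have hp1 : (1 : ℝ) ≤ p := by exact_mod_cast g1
    by_cases h : qq F p = 0
    · simp [h]
    · simp only [hG, if_neg h]
      obtain ⟨k1, k2, k3, k4⟩ := hpack (r p) (hrpos p h) (hr1 p h)
      obtain ⟨a1⟩ := ‹Nonempty B›
      obtain ⟨a2⟩ := ‹Nonempty T›
      have hv := k4 (fun a => δ * Real.exp (-(-(s0 * p)) * ω a)) (fun a => δ * Real.exp (-(s p) * ω a)) (fun a => by positivity) (fun a => by positivity)
        (Sum.inr a1) (Sum.inl a2) ?_ ?_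
      · have h10 := h7 ω hω (s0 * p) (E p) (hEm p h) (fun x hx => ⟨(hHE p h x hx).2.1, (hHE p h x hx).2.2.1⟩) 
          (fun x hx y hy => k3 x (hEH p hx) y (hEH p hy)) (fun x hx => not_badS hx.1.2)
        refine le_trans ?_ h10
        rw [hcdef, mul_assoc, ENNReal.ofReal_mul hc7.le, ← hrN]
        gcongr
      · rw [hprod]
        refine pack_cond Cst _ _ δ ε _ p hCst (by positivity) hδ1 hδ hε hp1 (hrd p h) (by have := hrpos p h; positivity) ?_ g3
        apply mul_le_mul_of_nonneg_left _ hδ.le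
        rw [← hexp p g1]
        apply Real.exp_le_exp.mpr
        have : ω (Sum.inr a1) = q' := rfl
        rw [this, neg_neg]
        refine g2.trans ?_
        rw [mul_comm]
        gcongr
        nlinarith
      · rw [hprod]
        refine pack_cond Cst _ _ δ ε _ p hCst (by positivity) hδ1 hδ hε hp1 (hrd p h) (by have := hrpos p h; positivity) ?_ g3
        apply mul_le_mul_of_nonneg_left _ hδ.le
        rw [← hexp p g1]
        apply Real.exp_le_exp.mpr
        have : ω (Sum.inl a2) = -p' := rfl
        rw [this, hs, hC1]
        apply le_of_eq
        field_simp
  · intro p hp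
    by_cases h : qq F p = 0
    · simp [hG, h]
    · simp only [hG, if_neg h]
      refine (h2 ω hω (s0 * p) (r p) (hrpos p h) _ (hHE p h)).trans (ENNReal.ofReal_le_ofReal ?_)
      rw [← hN, hrN]
      apply mul_le_mul_of_nonneg_right _ (mul_nonneg hε.le (hq0 p))
      linarith
  · intro p hp l hl
    have hgt : p < l := hl
    obtain ⟨g1, g2, g3⟩ := hP0 p hp
    have hp1 : (1 : ℝ) ≤ p := by exact_mod_cast g1
    have hpl : (p : ℝ) + 1 ≤ l := by exact_mod_cast hgt
    by_cases h : qq F p = 0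
    · simp [hG, h]
    by_cases h' : qq F l = 0
    · simp [hG, h']
    simp only [hG, if_neg h, if_neg h']
    have hx := mul_nonneg hε.le (hq0 p)
    have hy := mul_nonneg hε.le (hq0 l)
    split_ifs with hnear
    · refine (h8 (s0 * p) (s0 * l) (r p) (r l) (by nlinarith) (hrpos l h') (hranti p l hgt.le h) _ _ (hHE p h) (hHE l h')).trans (ENNReal.ofReal_le_ofReal ?_)
      rw [← hN, hrN]
      have h11 := hrd2 p l hgt.le g1 h'
      have h12 := pow_pos (hrpos l h') d
      apply mul_le_mul (by linarith) _ (by positivity) hC.le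
      apply mul_le_mul_of_nonneg_left _ hx
      linarith
    · refine (h9 (s0 * p) (s p) (s0 * l) (r p) (r l) (by positivity) (mul_nonneg hC10 (Real.log_nonneg hp1)) (by rw [hs]; exact not_lt.mp hnear) (hrpos p h) (hrpos l h') _ _ 
        (hEm p h) (hEm l h') (hHE p h) (hHE l h') (fun x hx => not_badS hx.2)).trans (ENNReal.ofReal_le_ofReal ?_)
      rw [← hN, hrN, hrN, add_zero]
      apply mul_le_mul_of_nonneg_right (by linarith) (mul_nonneg hx hy)
  · intro p N' hp
    obtain ⟨g1, g2, g3⟩ := hP0 p hp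
    exact near_sum C1 j s0 hC10 (by exact_mod_cast hj1) hs01 p N' g1
end l11
end KM

open MeasureTheory
open scoped ENNReal
namespace KM
set_option linter.unusedSectionVars false
set_option linter.unusedSimpArgs false
set_option linter.unusedVariables false
open Matrix

section l12
lemma null_det {κ : Type*} [Fintype κ] [DecidableEq κ] : volume {g : Matrix κ κ ℝ | g.det = 0} = 0 := by
  have hcont : Continuous fun x : Matrix κ κ ℝ × ℝ => (scalar κ x.2 - x.1).det := by
    apply Continuous.matrix_det
    refine Continuous.sub ?_ continuous_fst
    refine continuous_pi fun a => continuous_pi fun b => ?_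
    simp only [scalar_apply, diagonal_apply]
    split_ifs
    · exact continuous_snd
    · exact continuous_const
  have hms : MeasurableSet {x : Matrix κ κ ℝ × ℝ | (scalar κ x.2 - x.1).det = 0} :=
    (isClosed_singleton.preimage hcont).measurableSet
  have h0 : ((volume : Measure (Matrix κ κ ℝ)).prod (volume : Measure ℝ)) {x : Matrix κ κ ℝ × ℝ | (scalar κ x.2 - x.1).det = 0} = 0 := by
    rw [Measure.measure_prod_null hms]
    refine Filter.Eventually.of_forall fun g => ?_
    refine Set.Finite.measure_zero ?_ _
    refine (Polynomial.finite_setOfPred_isRoot (p := g.charpoly) g.charpoly_monic.ne_zero).subset fun t ht => ?_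
    have ht' : (scalar κ t - g).det = 0 := ht
    rw [← eval_charpoly] at ht'
    exact ht'
  rw [← Measure.prod_swap, Measure.map_apply measurable_swap hms, Measure.measure_prod_null (measurable_swap hms)] at h0
  obtain ⟨t, ht⟩ := h0.exists
  have h1 := (measurePreserving_sub_right (volume : Measure (Matrix κ κ ℝ)) (scalar κ t)).measure_preimage 
    (s := {g : Matrix κ κ ℝ | g.det = 0}) (isClosed_singleton.preimage (continuous_id.matrix_det)).measurableSet.nullMeasurableSet
  rw [← h1]
  refine measure_mono_null (fun g hg => ?_) ht
  have hg' : (g - scalar κ t).det = 0 := hg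
  have : (scalar κ t - g).det = 0 := by rw [← neg_sub, det_neg, hg', mul_zero]
  exact this

variable {T B : Type*} [Fintype T] [DecidableEq T] [Fintype B] [DecidableEq B]

lemma null_transfer (S : Set (Matrix B T ℝ)) (hS : volume S = 0) : 
    volume {g : Matrix (T ⊕ B) (T ⊕ B) ℝ | g.toBlocks₂₂.det = 0 ∨ g.toBlocks₂₂⁻¹ * g.toBlocks₂₁ ∈ S} = 0 := by
  set S' := toMeasurable volume S with hS'
  have hm' : MeasurableSet S' := measurableSet_toMeasurable _ _
  have hv' : volume S' = 0 := by rw [hS', measure_toMeasurable, hS]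
  have hc22 : Continuous fun g : Matrix (T ⊕ B) (T ⊕ B) ℝ => g.toBlocks₂₂ := 
    continuous_pi fun a => continuous_pi fun b => continuous_elem _ _
  have hc21 : Continuous fun g : Matrix (T ⊕ B) (T ⊕ B) ℝ => g.toBlocks₂₁ := 
    continuous_pi fun a => continuous_pi fun b => continuous_elem _ _
  have hcd := hc22.matrix_det
  have hca := (hc22.matrix_adjugate).matrix_mul hc21
  have hmq : Measurable fun g : Matrix (T ⊕ B) (T ⊕ B) ℝ => g.toBlocks₂₂⁻¹ * g.toBlocks₂₁ := by
    have e1 : (fun g : Matrix (T ⊕ B) (T ⊕ B) ℝ => g.toBlocks₂₂⁻¹ * g.toBlocks₂₁) = 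
        fun g => (g.toBlocks₂₂.det)⁻¹ • (g.toBlocks₂₂.adjugate * g.toBlocks₂₁) := by
      funext g
      rw [Matrix.inv_def, Ring.inverse_eq_inv', Matrix.smul_mul]
    rw [e1]
    refine measurable_pi_iff.mpr fun a => measurable_pi_iff.mpr fun b => ?_
    exact (hcd.measurable.inv).mul (((continuous_elem a b).comp hca).measurable)
  set Q : Set (Matrix (T ⊕ B) (T ⊕ B) ℝ) := {g | g.toBlocks₂₂.det = 0 ∨ g.toBlocks₂₂⁻¹ * g.toBlocks₂₁ ∈ S'} with hQ
  have hQm : MeasurableSet Q := (isClosed_singleton.preimage hcd).measurableSet.union (hmq hm')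
  refine measure_mono_null (t := Q) (fun g hg => hg.imp id fun h => subset_toMeasurable _ _ h) ?_
  rw [← lintegral_indicator_one hQm, lintegral_blk' _ (measurable_one.indicator hQm)]
  have hae : ∀ᵐ Z : Matrix B B ℝ, Z.det ≠ 0 := by
    rw [ae_iff]; simpa using null_det (κ := B)
  refine (lintegral_congr_ae (g := fun _ => 0) ?_).trans lintegral_zero
  filter_upwards [hae] with Z hZ
  have hZi : (Z⁻¹).det ≠ 0 := by
    rw [det_nonsing_inv, Ring.inverse_eq_inv']; exact inv_ne_zero hZ
  have h1 := lintegral_mul_left (l := T) Z⁻¹ hZi (S'.indicator (1 : Matrix B T ℝ → ℝ≥0∞)) (measurable_one.indicator hm')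
  rw [lintegral_indicator_one hm', hv', mul_zero] at h1
  have h1 := (lintegral_eq_zero_iff ((measurable_one.indicator hm').comp (show Measurable fun h : Matrix B T ℝ => Z⁻¹ * h from meas_mul_left Z⁻¹))).mp h1
  refine (lintegral_congr_ae (g := fun _ => 0) ?_).trans lintegral_zero
  filter_upwards [h1] with C hC
  have hC' : Z⁻¹ * C ∉ S' := by
    intro h
    have hC2 : S'.indicator (1 : Matrix B T ℝ → ℝ≥0∞) (Z⁻¹ * C) = 0 := hC
    rw [Set.indicator_of_mem h] at hC2
    exact one_ne_zero hC2
  have h2 : ∀ N A, Q.indicator (1 : Matrix (T ⊕ B) (T ⊕ B) ℝ → ℝ≥0∞) (fromBlocks A N C Z) = 0 := by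
    intro N A
    apply Set.indicator_of_notMem
    rintro (h | h)
    · rw [toBlocks_fromBlocks₂₂] at h; exact hZ h
    · rw [toBlocks_fromBlocks₂₂, toBlocks_fromBlocks₂₁] at h; exact hC' h
  simp only [h2, lintegral_zero]

lemma Bd_exists {κ l : Type*} [Fintype κ] [Fintype l] (X : Matrix κ l ℝ) : ∃ M : ℝ, 0 ≤ M ∧ Bd M X := by
  refine ⟨∑ a, ∑ b, |X a b|, by positivity, fun a b => ?_⟩
  calc |X a b| ≤ ∑ b, |X a b| := Finset.single_le_sum (f := fun b => |X a b|) (fun _ _ => abs_nonneg _) (Finset.mem_univ b)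
    _ ≤ _ := Finset.single_le_sum (f := fun a => ∑ b, |X a b|) (fun _ _ => Finset.sum_nonneg fun _ _ => abs_nonneg _) (Finset.mem_univ a)

lemma transfer {p q : ℝ} (hp : 0 ≤ p) (hq : 0 ≤ q) (g : Matrix (T ⊕ B) (T ⊕ B) ℝ) (hg : g.det ≠ 0) (hg2 : g.toBlocks₂₂.det ≠ 0) (I : Type*) :
    ∃ C : ℝ, 0 < C ∧ ∀ k r : ℝ, 0 ≤ k → 0 ≤ r → Small I (fl (om p q) k * g) r → 
      Small I (fl (om p q) k * ub (g.toBlocks₂₂⁻¹ * g.toBlocks₂₁)) (C * r) := by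
  set A := g.toBlocks₁₁ with hA
  set N := g.toBlocks₁₂ with hN
  set C := g.toBlocks₂₁ with hC
  set Z := g.toBlocks₂₂ with hZ
  have hgb : g = fromBlocks A N C Z := (fromBlocks_toBlocks g).symm
  have hZu : IsUnit Z.det := isUnit_iff_ne_zero.mpr hg2
  set b := Z⁻¹ * C with hb
  set X := A - N * b with hX
  have hfac : g = fromBlocks X N 0 Z * ub b := by
    rw [hgb, ub, fromBlocks_multiply]
    simp only [hX, hb, mul_one, Matrix.mul_one, Matrix.mul_zero, Matrix.zero_mul, zero_add, add_zero, sub_add_cancel]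
    rw [← Matrix.mul_assoc Z, Matrix.mul_nonsing_inv _ hZu, Matrix.one_mul]
  have hXu : IsUnit X.det := by
    rw [isUnit_iff_ne_zero]
    intro h
    apply hg
    rw [hfac, det_mul, det_fromBlocks_zero₂₁, h, zero_mul, zero_mul]
  have hinv : fromBlocks X⁻¹ (-(X⁻¹ * N * Z⁻¹)) 0 Z⁻¹ * fromBlocks X N 0 Z = 1 := by
    rw [fromBlocks_multiply, ← fromBlocks_one]
    simp only [Matrix.mul_zero, Matrix.zero_mul, add_zero, zero_add, Matrix.nonsing_inv_mul _ hXu, Matrix.nonsing_inv_mul _ hZu, Matrix.neg_mul]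
    rw [Matrix.mul_assoc _ Z⁻¹ Z, Matrix.nonsing_inv_mul _ hZu, Matrix.mul_one, add_neg_cancel]
  have hub : ub b = fromBlocks X⁻¹ (-(X⁻¹ * N * Z⁻¹)) 0 Z⁻¹ * g := by
    conv_rhs => rw [hfac, ← Matrix.mul_assoc, hinv, Matrix.one_mul]
  obtain ⟨M1, hM1, h1⟩ := Bd_exists X⁻¹
  obtain ⟨M2, hM2, h2⟩ := Bd_exists (-(X⁻¹ * N * Z⁻¹))
  obtain ⟨M3, hM3, h3⟩ := Bd_exists Z⁻¹
  set M := M1 + M2 + M3 with hM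
  refine ⟨Fintype.card (T ⊕ B) * M + 1, by positivity, fun k r hk hr hs => ?_⟩
  have h4 := Bd_conj (p := p) (q := q) (s := k) (by positivity) (show 0 ≤ M by positivity) (h1.mono (by linarith)) (h2.mono (by linarith)) (h3.mono (by linarith))
  have h5 := hs.left (by positivity) h4
  refine Small.mono ?_ ?_ (r := Fintype.card (T ⊕ B) * (M * r))
  · convert! h5 using 1
    rw [hub]
    generalize fromBlocks X⁻¹ (-(X⁻¹ * N * Z⁻¹)) 0 Z⁻¹ = V
    rw [Matrix.mul_assoc, ← Matrix.mul_assoc (fl _ (-k)), fl_neg_mul, Matrix.one_mul, Matrix.mul_assoc]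
  · nlinarith
end l12
end KM

open MeasureTheory
open scoped ENNReal
namespace KM
set_option linter.unusedSectionVars false
set_option linter.unusedSimpArgs false
set_option linter.unusedVariables false
open Matrix

section fin
def eE (m n i : ℕ) (hi : i ≤ m + n) : Fin i ⊕ Fin (m + n - i) ≃ Fin n ⊕ Fin m :=
  ((finSumFinEquiv.trans (finCongr (by omega : i + (m + n - i) = m + n))).trans finSumFinEquiv.symm).trans (Equiv.sumComm _ _)

lemma eE_om (m n i : ℕ) (hi : i ≤ m + n) (p q : ℝ) (c : Fin i) : 
    (om p q : Fin n ⊕ Fin m → ℝ) (eE m n i hi (Sum.inl c)) = if (c : ℕ) < m then q else -p := by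
  split_ifs with h
  · have : eE m n i hi (Sum.inl c) = Sum.inr ⟨c, h⟩ := by
      rw [← Equiv.eq_symm_apply]
      simp only [eE, Equiv.symm_trans_apply, Equiv.sumComm_symm, Equiv.sumComm_apply, Sum.swap_inr, Equiv.symm_symm]
      rw [Equiv.eq_symm_apply]
      apply Fin.ext
      simp
    rw [this]; rfl
  · have hc := c.2
    have : eE m n i hi (Sum.inl c) = Sum.inl ⟨c - m, by omega⟩ := by
      rw [← Equiv.eq_symm_apply]
      simp only [eE, Equiv.symm_trans_apply, Equiv.sumComm_symm, Equiv.sumComm_apply, Sum.swap_inl, Equiv.symm_symm]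
      rw [Equiv.eq_symm_apply]
      apply Fin.ext
      simp
      omega
    rw [this]; rfl

lemma eE_sum (m n i : ℕ) (hm : 1 ≤ m) (hn : 1 ≤ n) (hi1 : 1 ≤ i) (hi : i ≤ m + n) (hi2 : i < m + n) : 
    0 < ∑ c : Fin i, (om (n : ℝ)⁻¹ (m : ℝ)⁻¹ : Fin n ⊕ Fin m → ℝ) (eE m n i hi (Sum.inl c)) := by
  have hm0 : (0 : ℝ) < m := by exact_mod_cast hm
  have hn0 : (0 : ℝ) < n := by exact_mod_cast hn
  simp only [eE_om]
  rw [Fin.sum_univ_eq_sum_range (fun c => if c < m then (m : ℝ)⁻¹ else -(n : ℝ)⁻¹) i]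
  rcases le_total i m with h | h
  · apply Finset.sum_pos
    · intro c hc
      rw [Finset.mem_range] at hc
      rw [if_pos (by omega)]; positivity
    · exact ⟨0, Finset.mem_range.mpr (by omega)⟩
  · obtain ⟨u, rfl⟩ := Nat.exists_eq_add_of_le h
    rw [Finset.sum_range_add]
    have h1 : ∑ x ∈ Finset.range m, (if x < m then (m : ℝ)⁻¹ else -(n : ℝ)⁻¹) = 1 := by
      rw [Finset.sum_congr rfl (fun x hx => if_pos (Finset.mem_range.mp hx))]
      simp [hm0.ne']
    have h2 : ∑ x ∈ Finset.range u, (if m + x < m then (m : ℝ)⁻¹ else -(n : ℝ)⁻¹) = u * -(n : ℝ)⁻¹ := by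
      rw [Finset.sum_congr rfl (fun x hx => if_neg (by omega))]
      simp
    rw [h1, h2]
    have h3 : (u : ℝ) < n := by exact_mod_cast (by omega)
    have h4 : (u : ℝ) * (n : ℝ)⁻¹ < 1 := by rw [← div_eq_mul_inv, div_lt_one hn0]; exact h3
    linarith

theorem div_dir (m n : ℕ) (hm : 1 ≤ m) (hn : 1 ≤ n)
    (f : ℝ → ℝ) (hfpos : ∀ x > (0 : ℝ), 0 < f x) (hfmono : MonotoneOn f (Set.Ioi 0))
    (i : ℕ) (hi1 : 1 ≤ i) (hi2 : i ≤ m + n - 1) (hns : ¬ Summable fun k : ℕ => 1 / f (k + 1)) 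
    (hae : ∀ᵐ B : Fin m → Fin n → ℝ ∂volume, ∃ R₀ > (0 : ℝ), ∀ R ≥ R₀,
        f (Real.log R) ^ (-(((m + n : ℕ) : ℝ) * (i : ℝ))⁻¹)
          < succMin (colLattice (AQ m n R * UB B)) i) : False := by
  have hm0 : (0 : ℝ) < m := by exact_mod_cast hm
  have hn0 : (0 : ℝ) < n := by exact_mod_cast hn
  haveI : NeZero m := ⟨by omega⟩
  haveI : NeZero n := ⟨by omega⟩
  haveI : NeZero i := ⟨by omega⟩
  haveI : NeZero (m + n - i) := ⟨by omega⟩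
  set p : ℝ := (n : ℝ)⁻¹ with hp
  set q : ℝ := (m : ℝ)⁻¹ with hq
  have hpq : Fintype.card (Fin n) * p = Fintype.card (Fin m) * q := by
    rw [Fintype.card_fin, Fintype.card_fin, hp, hq, mul_inv_cancel₀ hn0.ne', mul_inv_cancel₀ hm0.ne']
  obtain ⟨M, hM, t, c0, hc0, C0, hC0, h11⟩ := L11 (eE m n i (by omega)) (p' := p) (q' := q) (by positivity) (by positivity) hpq 
    (eE_sum m n i hm hn hi1 (by omega) (by omega))
  set N : ℕ := Fintype.card (Fin i) * Fintype.card (Fin n ⊕ Fin m) with hN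
  have hNe : ((m + n : ℕ) : ℝ) * (i : ℝ) = (N : ℝ) := by
    simp only [hN, Fintype.card_fin, Fintype.card_sum]; push_cast; ring
  have hN1 : 0 < N := by
    simp only [hN, Fintype.card_fin, Fintype.card_sum]; positivity
  rw [hNe] at hae
  set F : ℕ → ℝ := fun j => f (2 ^ t * j) with hF
  have hFpos : ∀ j, 1 ≤ j → 0 < F j := fun j hj => hfpos _ (by
    have : (0 : ℝ) < j := by exact_mod_cast hj
    positivity)
  have hFmono : ∀ j l, 1 ≤ j → j ≤ l → F j ≤ F l := fun j l hj hl => by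
    have h1 : (0 : ℝ) < j := by exact_mod_cast hj
    have h2 : (j : ℝ) ≤ l := by exact_mod_cast hl
    exact hfmono (Set.mem_Ioi.mpr (by positivity)) (Set.mem_Ioi.mpr (by have : (0 : ℝ) < l := by linarith
                                                                        positivity)) (by gcongr)
  have hFns : ¬ Summable fun j => if j = 0 then 0 else 1 / F j := by
    have h1 : ¬ Summable (fun j : ℕ => if j = 0 then 0 else 1 / f j) := by
      intro h
      apply hns
      have := (summable_nat_add_iff 1).mpr h
      simpa using this
    have h2 := ser_dil _ (fun j => ?_) (fun j l hj hl => ?_) t h1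
    · intro h
      apply h2
      convert! h using 2 with j
      rcases Nat.eq_zero_or_pos j with rfl | hj
      · simp
      · rw [if_neg (by positivity), if_neg (by omega)]
        simp [hF]
    · split_ifs with h
      · exact le_rfl
      · have := hfpos j (by exact_mod_cast Nat.pos_of_ne_zero h)
        positivity
    · rw [if_neg (by omega), if_neg (by omega)]
      have hj' : (0 : ℝ) < j := by exact_mod_cast hj
      have hl' : (j : ℝ) ≤ l := by exact_mod_cast hl
      exact one_div_le_one_div_of_le (hfpos j hj') (hfmono hj' (Set.mem_Ioi.mpr (by linarith)) hl')
  set S : ℕ → Set (Matrix (Fin n ⊕ Fin m) (Fin n ⊕ Fin m) ℝ) := fun k => {g | g ∈ Om M ∧ ∃ᶠ j : ℕ in Filter.atTop, 1 ≤ j ∧ 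
        Small (Fin i) (fl (om p q) (2 ^ t * j) * g) (C0 * ((1 / ((k : ℝ) + 1)) / F j) ^ ((N : ℝ)⁻¹))} with hS
  have hSvol : ∀ k, ENNReal.ofReal c0 ≤ volume (S k) := fun k => 
    h11 F hFpos hFmono hFns (1 / ((k : ℝ) + 1)) (by positivity) (by rw [div_le_one (by positivity)]; linarith [(Nat.cast_nonneg k : (0 : ℝ) ≤ k)])
  have hSm : ∀ k, MeasurableSet (S k) := by
    intro k
    refine (measurableSet_Om M).inter ?_
    have e1 : {g : Matrix (Fin n ⊕ Fin m) (Fin n ⊕ Fin m) ℝ | ∃ᶠ j : ℕ in Filter.atTop, 1 ≤ j ∧ 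
        Small (Fin i) (fl (om p q) (2 ^ t * j) * g) (C0 * ((1 / ((k : ℝ) + 1)) / F j) ^ ((N : ℝ)⁻¹))} = 
        ⋂ P : ℕ, ⋃ j : ℕ, ⋃ (_ : P ≤ j), ⋃ (_ : 1 ≤ j), (fun g => fl (om p q) (2 ^ t * j) * g) ⁻¹' {g : Matrix (Fin n ⊕ Fin m) (Fin n ⊕ Fin m) ℝ | Small (Fin i) g (C0 * ((1 / ((k : ℝ) + 1)) / F j) ^ ((N : ℝ)⁻¹))} := by
      ext g
      simp only [Set.mem_ofPred_eq, Filter.frequently_atTop, Set.mem_iInter, Set.mem_iUnion, exists_prop, Set.mem_preimage, ge_iff_le]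
    have e2 : MeasurableSet (⋂ P : ℕ, ⋃ j : ℕ, ⋃ (_ : P ≤ j), ⋃ (_ : 1 ≤ j), (fun g => fl (om p q) (2 ^ t * j) * g) ⁻¹' {g : Matrix (Fin n ⊕ Fin m) (Fin n ⊕ Fin m) ℝ | Small (Fin i) g (C0 * ((1 / ((k : ℝ) + 1)) / F j) ^ ((N : ℝ)⁻¹))}) := 
      MeasurableSet.iInter fun P => MeasurableSet.iUnion fun j => MeasurableSet.iUnion fun _ => MeasurableSet.iUnion fun _ => 
        (meas_mul_left _) (measurableSet_Small _)
    rw [← e1] at e2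
    exact e2
  have hSanti : Antitone S := by
    intro k l hkl g hg
    refine ⟨hg.1, hg.2.mono fun j hj => ⟨hj.1, hj.2.mono ?_⟩⟩
    have hFj := hFpos j hj.1
    have hkl' : (k : ℝ) ≤ l := by exact_mod_cast hkl
    gcongr
  have hInt : ENNReal.ofReal c0 ≤ volume (⋂ k, S k) := by
    rw [hSanti.measure_iInter (fun k => (hSm k).nullMeasurableSet) ⟨0, ((measure_mono (fun g hg => hg.1)).trans_lt (vol_Om_lt_top M)).ne⟩]
    exact le_iInf hSvol
  have hnull := null_transfer (T := Fin n) (B := Fin m) _ (ae_iff.mp hae)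
  have hsub : (⋂ k, S k) ⊆ {g : Matrix (Fin n ⊕ Fin m) (Fin n ⊕ Fin m) ℝ | g.toBlocks₂₂.det = 0 ∨ g.toBlocks₂₂⁻¹ * g.toBlocks₂₁ ∈ 
      {B : Fin m → Fin n → ℝ | ¬ ∃ R₀ > (0 : ℝ), ∀ R ≥ R₀, f (Real.log R) ^ (-((N : ℝ))⁻¹) < succMin (colLattice (AQ m n R * UB B)) i}} := by
    intro g hg
    by_cases hg2 : g.toBlocks₂₂.det = 0
    · exact Or.inl hg2
    right
    have hgO : g ∈ Om M := (Set.mem_iInter.mp hg 0).1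
    have hgd := Om.det_ne (by linarith) hgO
    obtain ⟨Cg, hCg, htr⟩ := transfer (p := p) (q := q) (by positivity) (by positivity) g hgd hg2 (Fin i)
    set b := g.toBlocks₂₂⁻¹ * g.toBlocks₂₁ with hb
    rintro ⟨R0, hR0, hR⟩
    set d : ℝ := (Fintype.card (Fin n ⊕ Fin m) : ℝ) with hd
    -- choose k
    have hlim : Filter.Tendsto (fun k : ℕ => (d + 1) * (Cg * ((C0 + 1) * (1 / ((k : ℝ) + 1)) ^ ((N : ℝ)⁻¹)))) Filter.atTop (nhds 0) := by
      have h1 : Filter.Tendsto (fun k : ℕ => (1 / ((k : ℝ) + 1)) ^ ((N : ℝ)⁻¹)) Filter.atTop (nhds 0) := by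
        have := (tendsto_one_div_add_atTop_nhds_zero_nat (𝕜 := ℝ)).rpow_const (p := (N : ℝ)⁻¹) (Or.inr (by positivity))
        rwa [Real.zero_rpow (by positivity)] at this
      have := ((h1.const_mul (C0 + 1)).const_mul Cg).const_mul (d + 1)
      simpa using this
    obtain ⟨k, hk⟩ := (hlim.eventually (gt_mem_nhds (show (0 : ℝ) < 1 by norm_num))).exists
    have hfr := (Set.mem_iInter.mp hg k).2
    have hev : ∀ᶠ j : ℕ in Filter.atTop, R0 ≤ Real.exp (2 ^ t * j) := by
      filter_upwards [(tendsto_natCast_atTop_atTop (R := ℝ)).eventually_ge_atTop R0] with j hj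
      have h1 : (1 : ℝ) ≤ 2 ^ t := one_le_pow₀ (by norm_num)
      have h2 : (0 : ℝ) ≤ j := Nat.cast_nonneg j
      have h3 := Real.add_one_le_exp ((2 : ℝ) ^ t * j)
      nlinarith
    obtain ⟨j, ⟨hj1, hj2⟩, hj3⟩ := (hfr.and_eventually hev).exists
    have hFj := hFpos j hj1
    set ρ : ℝ := (C0 + 1) * ((1 / ((k : ℝ) + 1)) / F j) ^ ((N : ℝ)⁻¹) with hρ
    have hρ0 : 0 < ρ := by positivity
    have hs := htr (2 ^ t * j) ρ (by positivity) hρ0.le (hj2.mono (by rw [hρ]; gcongr; linarith))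
    have hlt := hR _ hj3
    have heq := AQ_UB_eq (m := m) (n := n) (Real.exp_pos (2 ^ t * j)) b
    rw [Real.log_exp] at heq hlt
    have hlt : f (2 ^ t * j) ^ (-(N : ℝ)⁻¹) < succMin (colLattice (fl (om p q) (2 ^ t * j) * ub b)) i := by
      refine lt_of_lt_of_eq hlt ?_
      exact congrArg (fun X => succMin (colLattice X) i) heq
    have hle := succMin_le_of_Small (by rw [det_fl_ub hpq]; exact one_ne_zero) (mul_pos hCg hρ0) hs
    have hlt' : F j ^ (-(N : ℝ)⁻¹) < (d + 1) * (Cg * ρ) := lt_of_lt_of_le hlt hle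
    have h6 : ρ = ((C0 + 1) * (1 / ((k : ℝ) + 1)) ^ ((N : ℝ)⁻¹)) * F j ^ (-(N : ℝ)⁻¹) := by
      rw [hρ, Real.div_rpow (by positivity) hFj.le, Real.rpow_neg hFj.le]; ring
    have h7 : 0 < F j ^ (-(N : ℝ)⁻¹) := Real.rpow_pos_of_pos hFj _
    rw [h6] at hlt'
    nlinarith
  have h0 := measure_mono_null hsub hnull
  rw [h0] at hInt
  exact absurd hInt (not_le.mpr (ENNReal.ofReal_pos.mpr hc0))
end fin
end KM

/-- **Theorem 2.7 (Kleinbock–Margulis), first part.** For increasing `f : ℝ_{>0} → ℝ_{>0}`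
and `1 ≤ i ≤ d − 1` (`d = m + n`): `∑ 1/f(k) < ∞` iff for almost every `m×n` real matrix `B`
one has `λ_i(A_R U_B ℤ^d) > (f(log R))^{−1/(d·i)}` for all sufficiently large `R`. -/
theorem succMin_lower_zero_one_law (m n : ℕ) (hm : 1 ≤ m) (hn : 1 ≤ n)
    (f : ℝ → ℝ) (hfpos : ∀ x > (0 : ℝ), 0 < f x) (hfmono : MonotoneOn f (Set.Ioi 0))
    (i : ℕ) (hi1 : 1 ≤ i) (hi2 : i ≤ m + n - 1) :
    (Summable fun k : ℕ => 1 / f (k + 1)) ↔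
      ∀ᵐ B : Fin m → Fin n → ℝ ∂volume, ∃ R₀ > (0 : ℝ), ∀ R ≥ R₀,
        f (Real.log R) ^ (-(((m + n : ℕ) : ℝ) * (i : ℝ))⁻¹)
          < succMin (colLattice (AQ m n R * UB B)) i := by
  refine ⟨fun h => KM.conv_dir m n hm hn f hfpos hfmono i hi1 hi2 h, fun h => ?_⟩
  by_contra hns
  exact KM.div_dir m n hm hn f hfpos hfmono i hi1 hi2 hns h
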